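/- Let (ρ, u, B) be a strong solution on Ω×(0,T] of the isentropic compressible MHD system with Navier-slip boundary conditions satisfying the a priori hypotheses sup_{Ω×[0,T]} ρ ≤ 2ρ̂ and (2μ+λ)^{−2}∫₀^T‖P−P̄‖⁴_{L⁴}dt ≤ 2. Then, with D₂ the constant from the L^∞(0,T;L²) estimate of (div u, curl u, curl B), and provided λ ≥ exp{(2+M)^{exp(D(1+C₀)³)}} with D ≥ 2D₂, one has (2μ+λ)^{−1}∫₀^T ‖P−P̄‖⁴_{L⁴} dt ≤ (2+M)^{exp(3D₂(1+C₀)³)}. -/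

import Mathlib

noncomputable section

open MeasureTheory Real Set Filter Topology Bornology

/-- Points of the plane (with an equivalent norm to the Euclidean one). -/
abbrev V2 := Fin 2 → ℝ

namespace MHD

/-- `i`-th partial derivative of a scalar field. -/
def pd (i : Fin 2) (f : V2 → ℝ) (x : V2) : ℝ :=
  fderiv ℝ f x (Pi.single i 1)

/-- Gradient of a scalar field. -/
def grad (f : V2 → ℝ) (x : V2) : V2 := fun i => pd i f x

/-- Divergence of a planar vector field. -/
def div2 (u : V2 → V2) (x : V2) : ℝ := ∑ i, pd i (fun y => u y i) x

/-- (Scalar) curl of a planar vector field. -/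
def curl2 (u : V2 → V2) (x : V2) : ℝ :=
  pd 0 (fun y => u y 1) x - pd 1 (fun y => u y 0) x

/-- Laplacian of a scalar field. -/
def lap (f : V2 → ℝ) (x : V2) : ℝ := ∑ j, pd j (pd j f) x

/-- Euclidean inner product on the plane. -/
def dot (a b : V2) : ℝ := ∑ i, a i * b i

/-- Squared Euclidean norm on the plane. -/
def nsq (a : V2) : ℝ := ∑ i, (a i) ^ 2

/-- Rotation by -90 degrees : `perp (n¹,n²) = (n²,−n¹)`. -/
def perp (v : V2) : V2 := ![v 1, -(v 0)]

/-- Squared Frobenius norm of the spatial gradient of a vector field. -/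
def gnsq (u : V2 → V2) (x : V2) : ℝ := ∑ i, ∑ j, (pd j (fun y => u y i) x) ^ 2

/-- Squared Frobenius norm of the second spatial gradient of a vector field. -/
def g2nsq (u : V2 → V2) (x : V2) : ℝ :=
  ∑ i, ∑ j, ∑ k, (pd k (fun y => pd j (fun z => u z i) y) x) ^ 2

/-- `Lᵖ(Ω)` norm of a scalar field. -/
def LpS (p : ℝ) (Ω : Set V2) (f : V2 → ℝ) : ℝ :=
  (∫ x in Ω, |f x| ^ p) ^ (1 / p)

/-- `Lᵖ(Ω)` norm of a vector field (Euclidean norm pointwise). -/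
def LpV (p : ℝ) (Ω : Set V2) (u : V2 → V2) : ℝ :=
  (∫ x in Ω, (nsq (u x)) ^ (p / 2)) ^ (1 / p)

/-- `Lᵖ(Ω)` norm of the gradient of a vector field. -/
def LpG (p : ℝ) (Ω : Set V2) (u : V2 → V2) : ℝ :=
  (∫ x in Ω, (gnsq u x) ^ (p / 2)) ^ (1 / p)

/-- `Lᵖ(Ω)` norm of the second gradient of a vector field. -/
def LpG2 (p : ℝ) (Ω : Set V2) (u : V2 → V2) : ℝ :=
  (∫ x in Ω, (g2nsq u x) ^ (p / 2)) ^ (1 / p)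

/-- Average of a scalar field over `Ω`. -/
def avg (Ω : Set V2) (f : V2 → ℝ) : ℝ := (∫ x in Ω, f x) / (volume Ω).toReal

/-- Time derivative of a time dependent scalar field. -/
def dt (f : ℝ → V2 → ℝ) (t : ℝ) (x : V2) : ℝ := deriv (fun s => f s x) t

/-- Time derivative of a time dependent vector field. -/
def dtV (u : ℝ → V2 → V2) (t : ℝ) (x : V2) : V2 := fun i => dt (fun s y => u s y i) t x

/-- Material derivative `u̇ = u_t + (u·∇)u` of the velocity field itself. -/
def matD (u : ℝ → V2 → V2) (t : ℝ) (x : V2) : V2 := fun i =>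
  dt (fun s y => u s y i) t x + dot (u t x) (grad (fun y => u t y i) x)

/-- The material derivative `(div u)· = (div u)_t + u·∇ div u`. -/
def divdot (u : ℝ → V2 → V2) (t : ℝ) (x : V2) : ℝ :=
  deriv (fun s => div2 (u s) x) t + dot (u t x) (grad (fun y => div2 (u t) y) x)

/-- Average pressure `P̄` at time `t`. -/
def Pbar (Ω : Set V2) (a γ : ℝ) (ρ : ℝ → V2 → ℝ) (t : ℝ) : ℝ :=
  avg Ω (fun x => a * ρ t x ^ γ)

/-- Effective viscous flux `F = (2μ+λ) div u − (P − P̄) − |B|²/2`. -/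
def Fflux (Ω : Set V2) (a γ μ lam : ℝ) (ρ : ℝ → V2 → ℝ) (u B : ℝ → V2 → V2)
    (t : ℝ) (x : V2) : ℝ :=
  (2 * μ + lam) * div2 (u t) x - (a * ρ t x ^ γ - Pbar Ω a γ ρ t) - nsq (B t x) / 2

/-- Potential energy density `G(ρ)`. -/
def Gpot (a γ ρb : ℝ) (r : ℝ) : ℝ :=
  r * ∫ ξ in ρb..r, (a * ξ ^ γ - a * ρb ^ γ) / ξ ^ 2

/-- Initial total energy `C₀`. -/
def C0 (Ω : Set V2) (a γ : ℝ) (ρ₀ : V2 → ℝ) (u₀ B₀ : V2 → V2) : ℝ :=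
  ∫ x in Ω, (ρ₀ x * nsq (u₀ x) / 2 + nsq (B₀ x) / 2 + Gpot a γ (avg Ω ρ₀) (ρ₀ x))

/-- The time weight `σ(t) = min{1,t}`. -/
def tw (t : ℝ) : ℝ := min 1 t

/-- Smoothness (in time and space) of a time dependent scalar field. -/
def Smooth2 (f : ℝ → V2 → ℝ) : Prop := ContDiff ℝ (⊤ : ℕ∞) (fun p : ℝ × V2 => f p.1 p.2)

/-- Smoothness (in time and space) of a time dependent vector field. -/
def Smooth2V (u : ℝ → V2 → V2) : Prop := ∀ i, Smooth2 (fun t x => u t x i)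

/-- A bounded domain with smooth boundary, given by a smooth defining function `φ`,
with outward unit normal `n` on the boundary. -/
structure SmoothDomain (Ω : Set V2) (n : V2 → V2) : Prop where
  nonempty : Ω.Nonempty
  bounded : IsBounded Ω
  defining : ∃ φ : V2 → ℝ, ContDiff ℝ (⊤ : ℕ∞) φ ∧ Ω = {x | φ x < 0} ∧
      frontier Ω = {x | φ x = 0} ∧
      (∀ x ∈ frontier Ω, grad φ x ≠ 0) ∧
      (∀ x ∈ frontier Ω, n x = (Real.sqrt (nsq (grad φ x)))⁻¹ • grad φ x)

/-- Outward unit normal on the boundary of a convex domain, characterized by the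
supporting hyperplane property. -/
def ConvexOuterNormal (Ω : Set V2) (n : V2 → V2) : Prop :=
  ∀ x ∈ frontier Ω, nsq (n x) = 1 ∧ ∀ y ∈ closure Ω, dot (n x) (y - x) ≤ 0

/-- Membership in `H¹(Ω)` for (a smooth representative of) a vector field. -/
def InH1V (Ω : Set V2) (f : V2 → V2) : Prop :=
  (∀ i, Differentiable ℝ fun x => f x i) ∧
  IntegrableOn (fun x => nsq (f x)) Ω volume ∧ IntegrableOn (fun x => gnsq f x) Ω volume

/-- Classical (pointwise) solution of the isentropic compressible MHD system with
Navier-slip boundary conditions, for times in the set `I`. -/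
structure IsMHDSol (Ω : Set V2) (n : V2 → V2) (a γ μ lam ν : ℝ) (I : Set ℝ)
    (ρ : ℝ → V2 → ℝ) (u B : ℝ → V2 → V2) : Prop where
  mass : ∀ t ∈ I, ∀ x ∈ Ω,
    dt ρ t x + div2 (fun y j => ρ t y * u t y j) x = 0
  momentum : ∀ t ∈ I, ∀ x ∈ Ω, ∀ i,
    dt (fun s y => ρ s y * u s y i) t x
      + (∑ j, pd j (fun y => ρ t y * u t y i * u t y j) x)
      + pd i (fun y => a * ρ t y ^ γ) x
    = μ * lap (fun y => u t y i) x
      + (μ + lam) * pd i (fun y => div2 (u t) y) x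
      + dot (B t x) (grad (fun y => B t y i) x)
      - pd i (fun y => nsq (B t y)) x / 2
  magnetic : ∀ t ∈ I, ∀ x ∈ Ω, ∀ i,
    dt (fun s y => B s y i) t x + dot (u t x) (grad (fun y => B t y i) x)
      - dot (B t x) (grad (fun y => u t y i) x) + B t x i * div2 (u t) x
    = ν * lap (fun y => B t y i) x
  divB : ∀ t ∈ I, ∀ x ∈ Ω, div2 (B t) x = 0
  slipU : ∀ t ∈ I, ∀ x ∈ frontier Ω, dot (u t x) (n x) = 0 ∧ curl2 (u t) x = 0
  slipB : ∀ t ∈ I, ∀ x ∈ frontier Ω, dot (B t x) (n x) = 0 ∧ curl2 (B t) x = 0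


/-- Hypotheses of the global existence theorem on the strong solution `(ρ,u,B)` and
its initial data, with constants `ρ̂` and `M` (conditions (1.8)–(1.9) of the paper). -/
def DataHyps (Ω : Set V2) (n : V2 → V2) (a γ μ lam ν ρhat M T : ℝ)
    (ρ : ℝ → V2 → ℝ) (u B : ℝ → V2 → V2) : Prop :=
  0 ≤ μ + lam ∧ 0 < T ∧
  Smooth2 ρ ∧ Smooth2V u ∧ Smooth2V B ∧
  IsMHDSol Ω n a γ μ lam ν (Ioc 0 T) ρ u B ∧
  (∀ t ∈ Icc 0 T, ∀ x ∈ Ω, 0 ≤ ρ t x) ∧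
  (∀ x ∈ Ω, ρ 0 x ≤ ρhat) ∧
  (∀ x ∈ frontier Ω, dot (u 0 x) (n x) = 0 ∧ curl2 (u 0) x = 0 ∧
      dot (B 0 x) (n x) = 0 ∧ curl2 (B 0) x = 0) ∧
  (∀ x ∈ Ω, div2 (B 0) x = 0) ∧
  (C0 Ω a γ (ρ 0) (u 0) (B 0)
      + (2 * μ + lam) * (LpS 2 Ω (div2 (u 0))) ^ 2
      + μ * (LpS 2 Ω (curl2 (u 0))) ^ 2
      + ν * (LpS 2 Ω (curl2 (B 0))) ^ 2 ≤ M)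

/-- The a priori hypotheses (3.1): `sup ρ ≤ 2ρ̂` and
`(2μ+λ)⁻² ∫₀^T ‖P−P̄‖⁴_{L⁴} dt ≤ 2`. -/
def APriori (Ω : Set V2) (a γ μ lam ρhat T : ℝ) (ρ : ℝ → V2 → ℝ) : Prop :=
  (∀ t ∈ Icc 0 T, ∀ x ∈ Ω, ρ t x ≤ 2 * ρhat) ∧
  ((2 * μ + lam) ^ 2)⁻¹ * (∫ t in (0:ℝ)..T,
      (LpS 4 Ω (fun x => a * ρ t x ^ γ - Pbar Ω a γ ρ t)) ^ 4) ≤ 2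

section


lemma pd_add {i : Fin 2} {f g : V2 → ℝ} {x : V2} (hf : DifferentiableAt ℝ f x)
    (hg : DifferentiableAt ℝ g x) : pd i (fun y => f y + g y) x = pd i f x + pd i g x := by
  unfold pd; rw [fderiv_fun_add hf hg]; rfl

lemma pd_sub {i : Fin 2} {f g : V2 → ℝ} {x : V2} (hf : DifferentiableAt ℝ f x)
    (hg : DifferentiableAt ℝ g x) : pd i (fun y => f y - g y) x = pd i f x - pd i g x := by
  unfold pd; rw [fderiv_fun_sub hf hg]; rfl

lemma pd_mul {i : Fin 2} {f g : V2 → ℝ} {x : V2} (hf : DifferentiableAt ℝ f x)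
    (hg : DifferentiableAt ℝ g x) :
    pd i (fun y => f y * g y) x = f x * pd i g x + pd i f x * g x := by
  unfold pd; rw [fderiv_fun_mul hf hg]; simp; ring

lemma pd_const {i : Fin 2} {c : ℝ} {x : V2} : pd i (fun _ => c) x = 0 := by
  unfold pd; simp

lemma pd_neg {i : Fin 2} {f : V2 → ℝ} {x : V2} :
    pd i (fun y => - f y) x = - pd i f x := by
  unfold pd; rw [fderiv_fun_neg]; simp

lemma pd_const_mul {i : Fin 2} {c : ℝ} {f : V2 → ℝ} {x : V2} (hf : DifferentiableAt ℝ f x) :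
    pd i (fun y => c * f y) x = c * pd i f x := by
  unfold pd; rw [fderiv_const_mul hf]; simp

lemma pd_comp {i : Fin 2} {g : ℝ → ℝ} {f : V2 → ℝ} {x : V2} (hg : DifferentiableAt ℝ g (f x))
    (hf : DifferentiableAt ℝ f x) : pd i (fun y => g (f y)) x = deriv g (f x) * pd i f x := by
  unfold pd
  have h := (hg.hasDerivAt.comp_hasFDerivAt x hf.hasFDerivAt).fderiv
  have h2 : (g ∘ f) = fun y => g (f y) := rfl
  rw [h2] at h
  rw [h]; simp

lemma fderiv_eq_sum {f : V2 → ℝ} {x : V2} (v : V2) :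
    fderiv ℝ f x v = v 0 * pd 0 f x + v 1 * pd 1 f x := by
  unfold pd
  have hv : v = v 0 • (Pi.single 0 1 : V2) + v 1 • (Pi.single 1 1 : V2) := by
    ext i; fin_cases i <;> simp
  conv_lhs => rw [hv]
  rw [map_add, map_smul, map_smul]; simp

lemma continuous_pd {i : Fin 2} {f : V2 → ℝ} (hf : ContDiff ℝ 1 f) : Continuous (pd i f) :=
  (hf.continuous_fderiv one_ne_zero).clm_apply continuous_const

/-- Continuous functions are integrable on bounded sets. -/
lemma cont_intOn {Y : Type*} [PseudoMetricSpace Y] [ProperSpace Y] [MeasurableSpace Y]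
    [OpensMeasurableSpace Y] {μ : Measure Y} [IsFiniteMeasureOnCompacts μ] {A : Set Y}
    (hA : IsBounded A) {f : Y → ℝ} (hf : Continuous f) : IntegrableOn f A μ :=
  (hf.continuousOn.integrableOn_compact' hA.isCompact_closure
    isClosed_closure.measurableSet).mono_set subset_closure

/-- Parametric continuity of integrals over bounded sets. -/
lemma cont_param {X Y : Type*} [TopologicalSpace X] [PseudoMetricSpace Y] [ProperSpace Y]
    [MeasurableSpace Y] [OpensMeasurableSpace Y] [SecondCountableTopology Y]
    [FirstCountableTopology X] [LocallyCompactSpace X]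
    {μ : Measure Y} [IsFiniteMeasureOnCompacts μ] {A : Set Y}
    (hA : IsBounded A) {f : X → Y → ℝ} (hf : Continuous (fun p : X × Y => f p.1 p.2)) :
    Continuous (fun x => ∫ y in A, f x y ∂μ) := by
  have h := continuous_parametric_integral_of_continuous (μ := μ.restrict A) (f := f) hf
    hA.isCompact_closure
  have h2 : (μ.restrict A).restrict (closure A) = μ.restrict A := by
    rw [Measure.restrict_restrict isClosed_closure.measurableSet,
      inter_eq_self_of_subset_right subset_closure]
  rw [h2] at h
  exact h

lemma strip_local {φ h : V2 → ℝ} (hφ : ContDiff ℝ 1 φ) (hh : ContDiff ℝ 1 h)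
    (h0 : ∀ y, φ y = 0 → 0 ≤ h y) {z : V2} (hz : φ z = 0) (hdz : fderiv ℝ φ z ≠ 0) :
    ∃ U ∈ 𝓝 z, ∃ C : ℝ, 0 ≤ C ∧ ∀ x ∈ U, φ x < 0 → C * φ x ≤ h x := by
  obtain ⟨e, he⟩ : ∃ e, fderiv ℝ φ z e = 1 := by
    obtain ⟨v, hv⟩ : ∃ v, fderiv ℝ φ z v ≠ 0 := by
      by_contra hcon; push Not at hcon; exact hdz (ContinuousLinearMap.ext hcon)
    exact ⟨(fderiv ℝ φ z v)⁻¹ • v, by rw [map_smul, smul_eq_mul, inv_mul_cancel₀ hv]⟩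
  have c1 : Continuous (fun x => fderiv ℝ φ x e) :=
    (hφ.continuous_fderiv one_ne_zero).clm_apply continuous_const
  have c2 : Continuous (fun x => fderiv ℝ h x e) :=
    (hh.continuous_fderiv one_ne_zero).clm_apply continuous_const
  set L := |fderiv ℝ h z e| + 1 with hL
  have hL0 : 0 ≤ L := by positivity
  have e1 : ∀ᶠ x in 𝓝 z, 1/2 < fderiv ℝ φ x e :=
    c1.continuousAt.eventually (lt_mem_nhds (by simp only [he]; norm_num))
  have e2 : ∀ᶠ x in 𝓝 z, fderiv ℝ h x e < L :=
    c2.continuousAt.eventually (gt_mem_nhds (by rw [hL]; linarith [le_abs_self (fderiv ℝ h z e)]))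
  obtain ⟨r, hr, hball⟩ := Metric.eventually_nhds_iff_ball.1 (e1.and e2)
  have e3 : ∀ᶠ x in 𝓝 z, |φ x| * (2 * ‖e‖) < r / 2 := by
    have : Continuous (fun x => |φ x| * (2 * ‖e‖)) := by
      have := hφ.continuous; fun_prop
    exact this.continuousAt.eventually (gt_mem_nhds (by simp [hz, hr]))
  refine ⟨_, inter_mem e3 (Metric.ball_mem_nhds z (half_pos hr)), 2 * L, by positivity, ?_⟩
  rintro x ⟨hx1, hx2⟩ hneg
  have habs : |φ x| = - φ x := abs_of_neg hneg
  have hx1' : |φ x| * (2 * ‖e‖) < r / 2 := hx1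
  set b := 2 * |φ x| with hb
  have hb0 : 0 ≤ b := by positivity
  have hin : ∀ s ∈ Icc (0:ℝ) b, x + s • e ∈ Metric.ball z r := by
    intro s hs
    have : dist (x + s • e) z ≤ dist (x + s • e) x + dist x z := dist_triangle _ _ _
    have h3 : dist (x + s • e) x = s * ‖e‖ := by
      rw [dist_eq_norm]; simp [norm_smul, abs_of_nonneg hs.1]
    have h4 : s * ‖e‖ ≤ b * ‖e‖ := by gcongr; exact hs.2
    rw [Metric.mem_ball] at hx2 ⊢
    nlinarith
  have dl : ∀ (g : V2 → ℝ), ContDiff ℝ 1 g → ∀ s : ℝ,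
      HasDerivAt (fun s : ℝ => g (x + s • e)) (fderiv ℝ g (x + s • e) e) s := by
    intro g hg s
    have h1 : HasDerivAt (fun s : ℝ => x + s • e) e s := by
      simpa using ((hasDerivAt_id s).smul_const e).const_add x
    exact ((hg.differentiable one_ne_zero).differentiableAt (x := x + s • e)).hasFDerivAt.comp_hasDerivAt s h1
  have gcont : ∀ (g : V2 → ℝ), ContDiff ℝ 1 g → Continuous (fun s : ℝ => g (x + s • e)) := by
    intro g hg
    have := hg.continuous
    fun_prop
  have mv : 1/2 * (b - 0) ≤ φ (x + b • e) - φ (x + (0:ℝ) • e) := by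
    refine Convex.mul_sub_le_image_sub_of_le_deriv (f := fun s : ℝ => φ (x + s • e))
      (convex_Icc 0 b) (gcont φ hφ).continuousOn
      (fun s _ => (dl φ hφ s).differentiableAt.differentiableWithinAt) ?_ 0 ⟨le_rfl, hb0⟩ b
      ⟨hb0, le_rfl⟩ hb0
    intro s hs
    rw [(dl φ hφ s).deriv]
    exact (hball _ (hin s (interior_subset hs))).1.le
  have hpos : 0 ≤ φ (x + b • e) := by
    simp only [zero_smul, add_zero] at mv; linarith
  obtain ⟨s, hs, hs0⟩ : ∃ s ∈ Icc (0:ℝ) b, φ (x + s • e) = 0 := by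
    have := intermediate_value_Icc hb0 (gcont φ hφ).continuousOn
    obtain ⟨s, hs, hh⟩ := this ⟨by simpa using hneg.le, hpos⟩
    exact ⟨s, hs, hh⟩
  have mv2 : h (x + s • e) - h (x + (0:ℝ) • e) ≤ L * (s - 0) := by
    refine Convex.image_sub_le_mul_sub_of_deriv_le (f := fun s : ℝ => h (x + s • e))
      (convex_Icc 0 b) (gcont h hh).continuousOn
      (fun s _ => (dl h hh s).differentiableAt.differentiableWithinAt) ?_ 0 ⟨le_rfl, hb0⟩ s
      hs hs.1
    intro s hs
    rw [(dl h hh s).deriv]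
    exact (hball _ (hin s (interior_subset hs))).2.le
  have := h0 _ hs0
  simp only [zero_smul, add_zero, sub_zero] at mv2
  have : L * s ≤ L * b := by gcongr; exact hs.2
  nlinarith

lemma strip_global {Ω : Set V2} {φ h : V2 → ℝ} (hφ : ContDiff ℝ 1 φ) (hh : ContDiff ℝ 1 h)
    (hb : IsBounded Ω) (hΩ : Ω = {x | φ x < 0}) (hfr : frontier Ω = {x | φ x = 0})
    (hd : ∀ x ∈ frontier Ω, fderiv ℝ φ x ≠ 0) (h0 : ∀ x ∈ frontier Ω, 0 ≤ h x) :
    ∃ C : ℝ, 0 ≤ C ∧ ∀ x ∈ Ω, C * φ x ≤ h x := by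
  have key : ∃ C : ℝ, 0 ≤ C ∧ ∀ x ∈ closure Ω, φ x < 0 → C * φ x ≤ h x := by
    refine IsCompact.induction_on (p := fun s => ∃ C : ℝ, 0 ≤ C ∧ ∀ x ∈ s, φ x < 0 → C * φ x ≤ h x)
      hb.isCompact_closure ⟨0, le_rfl, by simp⟩ ?_ ?_ ?_
    · rintro s t hst ⟨C, hC, h⟩; exact ⟨C, hC, fun x hx => h x (hst hx)⟩
    · rintro s t ⟨C, hC, h1⟩ ⟨C', hC', h2⟩
      refine ⟨max C C', le_max_of_le_left hC, ?_⟩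
      rintro x (hx | hx) hneg
      · exact (mul_le_mul_of_nonpos_right (le_max_left _ _) hneg.le).trans (h1 x hx hneg)
      · exact (mul_le_mul_of_nonpos_right (le_max_right _ _) hneg.le).trans (h2 x hx hneg)
    · intro z hz
      by_cases hzf : z ∈ frontier Ω
      · have hz0 : φ z = 0 := by rw [hfr] at hzf; exact hzf
        obtain ⟨U, hU, hC⟩ := strip_local hφ hh (fun y hy => h0 y (by rw [hfr]; exact hy)) hz0
          (hd z hzf)
        exact ⟨U, mem_nhdsWithin_of_mem_nhds hU, hC⟩
      · have hzi : φ z < 0 := by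
          have : z ∈ interior Ω := by
            by_contra hcon; exact hzf ⟨hz, hcon⟩
          have := interior_subset this
          rw [hΩ] at this; exact this
        have e1 : ∀ᶠ x in 𝓝 z, φ x < φ z / 2 :=
          hφ.continuous.continuousAt.eventually (gt_mem_nhds (by linarith))
        have e2 : ∀ᶠ x in 𝓝 z, -(|h z| + 1) < h x :=
          hh.continuous.continuousAt.eventually (lt_mem_nhds (by linarith [neg_abs_le (h z)]))
        refine ⟨_, mem_nhdsWithin_of_mem_nhds (inter_mem e1 e2), (|h z| + 1) / (- φ z / 2),
          div_nonneg (by positivity) (by linarith), ?_⟩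
        rintro x ⟨hx1, hx2⟩ _
        have hx1' : φ x < φ z / 2 := hx1
        have hx2' : -(|h z| + 1) < h x := hx2
        have hp : 0 < - φ z / 2 := by linarith
        have hA : 0 < |h z| + 1 := by positivity
        have : (|h z| + 1) / (- φ z / 2) * φ x ≤ -(|h z| + 1) := by
          rw [div_mul_eq_mul_div, div_le_iff₀ hp]; nlinarith
        linarith
  obtain ⟨C, hC, h⟩ := key
  exact ⟨C, hC, fun x hx => h x (subset_closure hx) (by rw [hΩ] at hx; exact hx)⟩

lemma dsT_zero {r : ℝ} (hr : r ≤ 0 ∨ 1 ≤ r) : deriv Real.smoothTransition r = 0 := by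
  rcases hr with hr | hr
  · apply IsLocalMin.deriv_eq_zero
    apply Filter.Eventually.of_forall
    intro y
    rw [Real.smoothTransition.zero_of_nonpos hr]; exact Real.smoothTransition.nonneg y
  · apply IsLocalMax.deriv_eq_zero
    apply Filter.Eventually.of_forall
    intro y
    rw [Real.smoothTransition.one_of_one_le hr]; exact Real.smoothTransition.le_one y

lemma dsT_cont : Continuous (deriv Real.smoothTransition) :=
  (Real.smoothTransition.contDiff (n := 1)).continuous_deriv le_rfl

lemma dsT_bound : ∃ K : ℝ, 0 ≤ K ∧ ∀ r, |deriv Real.smoothTransition r * r| ≤ K := by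
  obtain ⟨K, hK⟩ := isCompact_Icc.exists_bound_of_continuousOn (s := Icc (0:ℝ) 1)
    (f := fun r => deriv Real.smoothTransition r * r) (dsT_cont.mul continuous_id).continuousOn
  refine ⟨max K 0, le_max_right _ _, fun r => ?_⟩
  by_cases h : r ∈ Icc (0:ℝ) 1
  · exact (hK r h).trans (le_max_left _ _)
  · rw [dsT_zero]
    · simp
    · rw [mem_Icc, not_and_or, not_le, not_le] at h
      exact h.imp le_of_lt le_of_lt

lemma dsT_nonneg (r : ℝ) : 0 ≤ deriv Real.smoothTransition r :=
  Real.smoothTransition.monotone.deriv_nonneg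

lemma div_sign {Ω : Set V2} {φ : V2 → ℝ} {w : V2 → V2} (hφ : ContDiff ℝ (⊤ : ℕ∞) φ)
    (hw : ∀ i, ContDiff ℝ 1 (fun x => w x i))
    (hb : IsBounded Ω) (hΩ : Ω = {x | φ x < 0}) (hfr : frontier Ω = {x | φ x = 0})
    (hd : ∀ x ∈ frontier Ω, grad φ x ≠ 0) (h0 : ∀ x ∈ frontier Ω, 0 ≤ dot (w x) (grad φ x)) :
    0 ≤ ∫ x in Ω, div2 w x := by
  have hφ1 : ContDiff ℝ 1 φ := hφ.of_le (by exact_mod_cast le_top)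
  have hφ2 : ∀ i, ContDiff ℝ 1 (pd i φ) := fun i => by
    unfold pd
    exact (hφ.fderiv_right (m := 1) (by rw [one_add_one_eq_two]; exact WithTop.coe_le_coe.2 le_top)).clm_apply contDiff_const
  have hopen : IsOpen Ω := by rw [hΩ]; exact isOpen_lt hφ1.continuous continuous_const
  have hh : ContDiff ℝ 1 (fun x => dot (w x) (grad φ x)) := by
    unfold dot grad
    exact ContDiff.sum fun i _ => (hw i).mul (hφ2 i)
  obtain ⟨C, hC, hs⟩ := strip_global hφ1 hh hb hΩ hfr (fun x hx h => hd x hx (by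
    ext i; simp [grad, pd, h])) h0
  obtain ⟨K, hK, hKb⟩ := dsT_bound
  set θ := Real.smoothTransition with hθ
  have hθ1 : ContDiff ℝ 1 θ := Real.smoothTransition.contDiff
  have hθd : Differentiable ℝ θ := hθ1.differentiable one_ne_zero
  let η : ℕ → V2 → ℝ := fun n x => θ (-((n + 1 : ℝ) * φ x))
  have hη : ∀ n, ContDiff ℝ 1 (η n) := fun n =>
    hθ1.comp (contDiff_const.mul hφ1).neg
  have hη0 : ∀ n x, x ∉ Ω → η n x = 0 := by
    intro n x hx
    apply Real.smoothTransition.zero_of_nonpos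
    rw [hΩ, Set.mem_ofPred_eq, not_lt] at hx
    have : 0 ≤ (n + 1 : ℝ) * φ x := by positivity
    linarith
  have hηc : ∀ n, HasCompactSupport (η n) := fun n =>
    HasCompactSupport.intro hb.isCompact_closure (fun x hx => hη0 n x (fun h => hx (subset_closure h)))
  have hpdη : ∀ n i x, pd i (η n) x = - ((n+1:ℝ) * deriv θ (-((n + 1 : ℝ) * φ x)) * pd i φ x) := by
    intro n i x
    have hdφ : DifferentiableAt ℝ φ x := hφ1.differentiable one_ne_zero x
    rw [show η n = fun y => θ ((fun y => -((n + 1 : ℝ) * φ y)) y) from rfl,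
      pd_comp (g := θ) (f := fun y => -((n + 1 : ℝ) * φ y)) (hθd _) (by fun_prop), pd_neg, pd_const_mul hdφ]
    ring
  -- integration by parts
  have ibp : ∀ n : ℕ, ∫ x in Ω, η n x * div2 w x
      = ∫ x in Ω, (n+1:ℝ) * deriv θ (-((n + 1 : ℝ) * φ x)) * dot (w x) (grad φ x) := by
    intro n
    have each : ∀ i, ∫ x, η n x * pd i (fun y => w y i) x = - ∫ x, pd i (η n) x * w x i := by
      intro i
      have cw := (hw i).continuous
      have cη := (hη n).continuous
      have cpw : Continuous (pd i (fun y => w y i)) := continuous_pd (hw i)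
      have cpη : Continuous (pd i (η n)) := continuous_pd (hη n)
      have hsup : HasCompactSupport (pd i (η n)) := by
        have := (hηc n).fderiv (𝕜 := ℝ)
        exact this.comp_left (g := fun L : V2 →L[ℝ] ℝ => L (Pi.single i 1)) (by simp)
      refine integral_mul_fderiv_eq_neg_fderiv_mul_of_integrable ?_ ?_ ?_ ?_ ?_
      · exact (cpη.mul cw).integrable_of_hasCompactSupport hsup.mul_right
      · exact (cη.mul cpw).integrable_of_hasCompactSupport (hηc n).mul_right
      · exact (cη.mul cw).integrable_of_hasCompactSupport (hηc n).mul_right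
      · intro x _; exact (hη n).differentiable one_ne_zero x
      · intro x _; exact (hw i).differentiable one_ne_zero x
    have i1 : ∀ i, IntegrableOn (fun x => η n x * pd i (fun y => w y i) x) Ω volume := fun i =>
      cont_intOn hb ((hη n).continuous.mul (continuous_pd (hw i)))
    have i2 : ∀ i, IntegrableOn (fun x => pd i (η n) x * w x i) Ω volume := fun i =>
      cont_intOn hb ((continuous_pd (hη n)).mul (hw i).continuous)
    have each' : ∀ i, ∫ x in Ω, η n x * pd i (fun y => w y i) x
        = - ∫ x in Ω, pd i (η n) x * w x i := by
      intro i
      rw [setIntegral_eq_integral_of_forall_compl_eq_zero, setIntegral_eq_integral_of_forall_compl_eq_zero]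
      · exact each i
      · intro x hx
        rw [hpdη, dsT_zero]
        · simp
        · left
          rw [hΩ, Set.mem_ofPred_eq, not_lt] at hx
          have : 0 ≤ (n + 1 : ℝ) * φ x := by positivity
          linarith
      · intro x hx; rw [hη0 n x hx, zero_mul]
    calc ∫ x in Ω, η n x * div2 w x
        = ∫ x in Ω, ∑ i, η n x * pd i (fun y => w y i) x := by
          simp only [div2, Finset.mul_sum]
      _ = ∑ i, ∫ x in Ω, η n x * pd i (fun y => w y i) x := integral_finsetSum _ (fun i _ => i1 i)
      _ = ∑ i, - ∫ x in Ω, pd i (η n) x * w x i := by simp only [each']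
      _ = - ∫ x in Ω, ∑ i, pd i (η n) x * w x i := by
          rw [integral_finsetSum _ (fun i _ => i2 i), Finset.sum_neg_distrib]
      _ = _ := by
          rw [← integral_neg]
          congr 1; ext x
          simp only [hpdη, dot, grad, Fin.sum_univ_two]; ring
  have lower : ∀ n : ℕ, ∫ x in Ω, -(C * (deriv θ (-((n + 1 : ℝ) * φ x)) * (-((n + 1 : ℝ) * φ x))))
      ≤ ∫ x in Ω, η n x * div2 w x := by
    intro n
    rw [ibp n]
    have c1 : Continuous fun x => deriv θ (-((n + 1 : ℝ) * φ x)) :=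
      dsT_cont.comp (continuous_const.mul hφ1.continuous).neg
    have c2 := hφ1.continuous
    refine setIntegral_mono_on (cont_intOn hb (by fun_prop))
      (cont_intOn hb ((continuous_const.mul c1).mul hh.continuous)) hopen.measurableSet ?_
    intro x hx
    have h1 := hs x hx
    have h2 := dsT_nonneg (-((n + 1 : ℝ) * φ x))
    have h3 : 0 ≤ (n+1:ℝ) * deriv θ (-((n + 1 : ℝ) * φ x)) := by positivity
    nlinarith [mul_le_mul_of_nonneg_left h1 h3]
  have lim1 : Tendsto (fun n : ℕ => ∫ x in Ω, η n x * div2 w x) atTop (𝓝 (∫ x in Ω, div2 w x)) := by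
    have cdiv : Continuous (div2 w) := by
      unfold div2; exact continuous_finsetSum _ fun i _ => continuous_pd (hw i)
    refine tendsto_integral_of_dominated_convergence (fun x => |div2 w x|) ?_ ?_ ?_ ?_
    · intro n; exact ((hη n).continuous.mul cdiv).aestronglyMeasurable
    · exact (cont_intOn hb cdiv).abs
    · intro n; refine Filter.Eventually.of_forall fun x => ?_
      rw [Real.norm_eq_abs, abs_mul]
      have : |η n x| ≤ 1 := by
        rw [abs_of_nonneg (Real.smoothTransition.nonneg _)]; exact Real.smoothTransition.le_one _
      exact mul_le_of_le_one_left (abs_nonneg _) this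
    · filter_upwards [ae_restrict_mem hopen.measurableSet] with x hx
      have hneg : φ x < 0 := by rw [hΩ] at hx; exact hx
      obtain ⟨N, hN⟩ := exists_nat_gt (1 / (- φ x))
      refine tendsto_const_nhds.congr' ?_
      filter_upwards [eventually_ge_atTop N] with n hn
      have : η n x = 1 := by
        apply Real.smoothTransition.one_of_one_le
        rw [div_lt_iff₀ (by linarith)] at hN
        have : (N:ℝ) ≤ n := by exact_mod_cast hn
        nlinarith
      rw [this, one_mul]
  have lim2 : Tendsto (fun n : ℕ => ∫ x in Ω, -(C * (deriv θ (-((n + 1 : ℝ) * φ x)) * (-((n + 1 : ℝ) * φ x)))))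
      atTop (𝓝 (∫ x in Ω, (0:ℝ))) := by
    refine tendsto_integral_of_dominated_convergence (fun x => C * K) ?_ ?_ ?_ ?_
    · intro n
      have c1 : Continuous fun x => deriv θ (-((n + 1 : ℝ) * φ x)) :=
        dsT_cont.comp (continuous_const.mul hφ1.continuous).neg
      have c2 := hφ1.continuous
      exact Continuous.aestronglyMeasurable (by fun_prop)
    · exact cont_intOn hb continuous_const
    · intro n; refine Filter.Eventually.of_forall fun x => ?_
      rw [Real.norm_eq_abs, abs_neg, abs_mul, abs_of_nonneg hC]
      exact mul_le_mul_of_nonneg_left (hKb _) hC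
    · filter_upwards [ae_restrict_mem hopen.measurableSet] with x hx
      have hneg : φ x < 0 := by rw [hΩ] at hx; exact hx
      obtain ⟨N, hN⟩ := exists_nat_gt (1 / (- φ x))
      refine tendsto_const_nhds.congr' ?_
      filter_upwards [eventually_ge_atTop N] with n hn
      rw [dsT_zero]
      · simp
      · right
        rw [div_lt_iff₀ (by linarith)] at hN
        have : (N:ℝ) ≤ n := by exact_mod_cast hn
        nlinarith
  have := le_of_tendsto_of_tendsto' lim2 lim1 lower
  simpa using this

lemma div_zero {Ω : Set V2} {φ : V2 → ℝ} {w : V2 → V2} (hφ : ContDiff ℝ (⊤ : ℕ∞) φ)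
    (hw : ∀ i, ContDiff ℝ 1 (fun x => w x i))
    (hb : IsBounded Ω) (hΩ : Ω = {x | φ x < 0}) (hfr : frontier Ω = {x | φ x = 0})
    (hd : ∀ x ∈ frontier Ω, grad φ x ≠ 0) (h0 : ∀ x ∈ frontier Ω, dot (w x) (grad φ x) = 0) :
    ∫ x in Ω, div2 w x = 0 := by
  have h1 := div_sign hφ hw hb hΩ hfr hd (fun x hx => (h0 x hx).ge)
  have h2 := div_sign (w := fun x i => - w x i) hφ (fun i => (hw i).neg) hb hΩ hfr hd
    (fun x hx => by
      have := h0 x hx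
      simp only [dot, Fin.sum_univ_two] at this ⊢
      linarith)
  have h3 : (fun x => div2 (fun x i => - w x i) x) = fun x => - div2 w x := by
    ext x; simp only [div2, Fin.sum_univ_two, pd_neg]; ring
  simp only [h3, integral_neg] at h2
  linarith


end

section


/-- Bundled geometric hypotheses. -/
structure Dom (Ω : Set V2) (φ : V2 → ℝ) : Prop where
  smooth : ContDiff ℝ (⊤ : ℕ∞) φ
  bdd : IsBounded Ω
  eq : Ω = {x | φ x < 0}
  fr : frontier Ω = {x | φ x = 0}
  gr : ∀ x ∈ frontier Ω, grad φ x ≠ 0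
  conv : Convex ℝ Ω
  ne : Ω.Nonempty

variable {Ω : Set V2} {φ : V2 → ℝ}

lemma Dom.isOpen (D : Dom Ω φ) : IsOpen Ω := by
  rw [D.eq]; exact isOpen_lt D.smooth.continuous continuous_const

lemma Dom.meas (D : Dom Ω φ) : MeasurableSet Ω := D.isOpen.measurableSet

lemma Dom.div_zero (D : Dom Ω φ) {w : V2 → V2} (hw : ∀ i, ContDiff ℝ 1 (fun x => w x i))
    (h0 : ∀ x ∈ frontier Ω, dot (w x) (grad φ x) = 0) : ∫ x in Ω, div2 w x = 0 :=
  MHD.div_zero D.smooth hw D.bdd D.eq D.fr D.gr h0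

lemma contDiff_pd {i : Fin 2} {m k : WithTop ℕ∞} {f : V2 → ℝ} (hf : ContDiff ℝ k f) (h : m + 1 ≤ k) :
    ContDiff ℝ m (pd i f) := by
  unfold pd
  exact (hf.fderiv_right h).clm_apply contDiff_const

lemma top_le1 : (1:WithTop ℕ∞) ≤ ((⊤:ℕ∞):WithTop ℕ∞) := WithTop.coe_le_coe.2 le_top
lemma top_le2 : (2:WithTop ℕ∞) ≤ ((⊤:ℕ∞):WithTop ℕ∞) := WithTop.coe_le_coe.2 le_top

lemma contDiff_pd2 {i : Fin 2} {f : V2 → ℝ} (hf : ContDiff ℝ 2 f) :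
    ContDiff ℝ 1 (pd i f) := contDiff_pd hf (by rw [one_add_one_eq_two])

lemma line_deriv {g : V2 → ℝ} (hg : ContDiff ℝ 1 g) (x τ : V2) (s : ℝ) :
    HasDerivAt (fun s : ℝ => g (x + s • τ)) (fderiv ℝ g (x + s • τ) τ) s := by
  have h1 : HasDerivAt (fun s : ℝ => x + s • τ) τ s := by
    simpa using ((hasDerivAt_id s).smul_const τ).const_add x
  exact ((hg.differentiable one_ne_zero).differentiableAt (x := x + s • τ)).hasFDerivAt.comp_hasDerivAt s h1

lemma Dom.tangent_nonneg (D : Dom Ω φ) {x τ : V2} (hx : x ∈ frontier Ω)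
    (hτ : dot τ (grad φ x) = 0) : 0 ≤ φ (x + τ) := by
  by_contra hcon
  push Not at hcon
  have hφ1 : ContDiff ℝ 1 φ := D.smooth.of_le top_le1
  have hp : x + τ ∈ Ω := by rw [D.eq]; exact hcon
  set g := grad φ x with hg
  have hc : Continuous (fun ε : ℝ => x + (τ + ε • g)) := by fun_prop
  have hev : ∀ᶠ ε in 𝓝 (0:ℝ), x + (τ + ε • g) ∈ Ω :=
    hc.continuousAt.eventually (D.isOpen.mem_nhds (by simpa using hp))
  obtain ⟨ε, he, hε⟩ := (hev.filter_mono nhdsWithin_le_nhds |>.and self_mem_nhdsWithin :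
    ∀ᶠ ε in 𝓝[>] (0:ℝ), _ ∧ ε ∈ Ioi (0:ℝ)).exists
  have hε0 : 0 < ε := hε
  set v := τ + ε • g with hv
  have hneg : ∀ s ∈ Ioc (0:ℝ) 1, φ (x + s • v) ≤ 0 := by
    intro s hs
    have h1 : x + v ∈ interior Ω := by rw [D.isOpen.interior_eq]; exact he
    have h2 := D.conv.combo_closure_interior_mem_interior (frontier_subset_closure hx) h1
      (a := 1 - s) (b := s) (by linarith [hs.2]) hs.1 (by ring)
    have h3 : (1 - s) • x + s • (x + v) = x + s • v := by
      rw [smul_add, sub_smul, one_smul]; abel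
    rw [h3] at h2
    have := interior_subset h2
    rw [D.eq] at this
    exact le_of_lt this
  have hx0 : φ x = 0 := by have := hx; rw [D.fr] at this; exact this
  have hder := line_deriv hφ1 x v 0
  simp only [zero_smul, add_zero] at hder
  have hle : fderiv ℝ φ x v ≤ 0 := by
    have h5 := hder.tendsto_slope_zero_right
    refine le_of_tendsto h5 ?_
    filter_upwards [Ioc_mem_nhdsGT (zero_lt_one' ℝ)] with s hs
    simp only [zero_add, zero_smul, add_zero, hx0, sub_zero, smul_eq_mul]
    exact mul_nonpos_of_nonneg_of_nonpos (by simpa using hs.1.le) (hneg s hs)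
  have hne : g ≠ 0 := D.gr x hx
  have hpos : 0 < nsq g := by
    have : nsq g ≠ 0 := by
      intro h
      apply hne
      simp only [nsq, Fin.sum_univ_two] at h
      ext i; fin_cases i
      · simpa using (by nlinarith [sq_nonneg (g 0), sq_nonneg (g 1)] : g 0 ^ 2 = 0)
      · simpa using (by nlinarith [sq_nonneg (g 0), sq_nonneg (g 1)] : g 1 ^ 2 = 0)
    exact lt_of_le_of_ne (Finset.sum_nonneg fun i _ => sq_nonneg _) this.symm
  have h6 : fderiv ℝ φ x v = ε * nsq g := by
    rw [fderiv_eq_sum]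
    simp only [dot, Fin.sum_univ_two, nsq, hv, hg, grad, Pi.add_apply, Pi.smul_apply, smul_eq_mul] at hτ ⊢
    linear_combination hτ
  rw [h6] at hle
  nlinarith

lemma Dom.hess_nonneg (D : Dom Ω φ) {x τ : V2} (hx : x ∈ frontier Ω)
    (hτ : dot τ (grad φ x) = 0) : 0 ≤ ∑ i, ∑ j, τ i * τ j * pd j (pd i φ) x := by
  have hφ1 : ContDiff ℝ 1 φ := D.smooth.of_le top_le1
  have hφ2 : ∀ i, ContDiff ℝ 1 (pd i φ) := fun i => contDiff_pd2 (D.smooth.of_le top_le2)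
  set g : ℝ → ℝ := fun s => φ (x + s • τ) with hg
  have hx0 : φ x = 0 := by have := hx; rw [D.fr] at this; exact this
  have hnn : ∀ s, 0 ≤ g s := fun s => D.tangent_nonneg hx (by
    simp only [dot, Fin.sum_univ_two, Pi.smul_apply, smul_eq_mul] at hτ ⊢
    linear_combination s * hτ)
  have hg' : deriv g = fun s => τ 0 * pd 0 φ (x + s • τ) + τ 1 * pd 1 φ (x + s • τ) := by
    ext s; rw [(line_deriv hφ1 x τ s).deriv, fderiv_eq_sum]
  have hg'' : deriv (deriv g) 0 = ∑ i, ∑ j, τ i * τ j * pd j (pd i φ) x := by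
    rw [hg']
    have := ((line_deriv (hφ2 0) x τ 0).const_mul (τ 0)).fun_add ((line_deriv (hφ2 1) x τ 0).const_mul (τ 1))
    rw [HasDerivAt.deriv this]
    simp only [zero_smul, add_zero, fderiv_eq_sum, Fin.sum_univ_two]; ring
  rw [← hg'']
  by_contra hcon
  push Not at hcon
  have h0 : deriv g 0 = 0 := by
    rw [hg']; simp only [dot, Fin.sum_univ_two, grad] at hτ; simpa using hτ
  have hmax := isLocalMax_of_deriv_deriv_neg hcon h0
    (by simp only [hg]; have := hφ1.continuous; fun_prop)
  have hz : g =ᶠ[𝓝 0] fun _ => 0 := by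
    filter_upwards [hmax] with s hs
    have : g 0 = 0 := by simp [hg, hx0]
    rw [this] at hs
    exact le_antisymm hs (hnn s)
  have := hz.deriv.deriv_eq
  simp at this
  linarith

/-- A function vanishing on the boundary has zero tangential derivative. -/
lemma Dom.tangent_deriv (D : Dom Ω φ) {h : V2 → ℝ} (hh : ContDiff ℝ 1 h)
    (h0 : ∀ x ∈ frontier Ω, h x = 0) {x τ : V2} (hx : x ∈ frontier Ω)
    (hτ : dot τ (grad φ x) = 0) : dot τ (grad h x) = 0 := by
  have hφ1 : ContDiff ℝ 1 φ := D.smooth.of_le top_le1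
  have hx0 : φ x = 0 := by have := hx; rw [D.fr] at this; exact this
  have hext : IsLocalExtrOn h {y | φ y = φ x} x := by
    left
    filter_upwards [self_mem_nhdsWithin] with y hy
    rw [h0 x hx, h0 y (by rw [D.fr]; rw [hx0] at hy; exact hy)]
  obtain ⟨a, b, hab, hsum⟩ := IsLocalExtrOn.exists_multipliers_of_hasStrictFDerivAt_1d hext
    (hφ1.contDiffAt.hasStrictFDerivAt one_ne_zero) (hh.contDiffAt.hasStrictFDerivAt one_ne_zero)
  have e1 : fderiv ℝ φ x τ = 0 := by
    rw [fderiv_eq_sum]; simpa [dot, Fin.sum_univ_two, grad] using hτ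
  have e2 := congrArg (fun L : V2 →L[ℝ] ℝ => L τ) hsum
  simp only [add_apply, smul_apply, e1, zero_apply, smul_eq_mul] at e2
  have hb : b ≠ 0 := by
    rintro rfl
    have ha : a ≠ 0 := by rintro rfl; exact hab rfl
    simp only [zero_smul, add_zero, smul_eq_zero, ha, false_or] at hsum
    exact D.gr x hx (by ext i; simp [grad, pd, hsum])
  have e3 : fderiv ℝ h x τ = 0 := by simpa [hb] using e2
  rw [fderiv_eq_sum] at e3
  simpa [dot, Fin.sum_univ_two, grad] using e3

lemma pd_comm {f : V2 → ℝ} (hf : ContDiff ℝ 2 f) (i j : Fin 2) (x : V2) :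
    pd i (pd j f) x = pd j (pd i f) x := by
  have hs : IsSymmSndFDerivAt ℝ f x := hf.contDiffAt.isSymmSndFDerivAt (by simp)
  have key : ∀ k l, pd k (pd l f) x = fderiv ℝ (fderiv ℝ f) x (Pi.single k 1) (Pi.single l 1) := by
    intro k l
    unfold pd
    have hd : DifferentiableAt ℝ (fderiv ℝ f) x :=
      ((hf.fderiv_right (m := 1) (by rw [one_add_one_eq_two])).differentiable one_ne_zero) x
    have := (hd.hasFDerivAt.clm_apply (hasFDerivAt_const (Pi.single l (1:ℝ) : V2) x)).fderiv
    rw [this]; simp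
  rw [key, key]; exact hs _ _

/-- div-curl estimate on convex domains. -/
lemma Dom.div_curl (D : Dom Ω φ) {u : V2 → V2} (hu : ∀ i, ContDiff ℝ 2 (fun x => u x i))
    (h0 : ∀ x ∈ frontier Ω, dot (u x) (grad φ x) = 0) :
    ∫ x in Ω, gnsq u x ≤ ∫ x in Ω, ((div2 u x) ^ 2 + (curl2 u x) ^ 2) := by
  have hu1 : ∀ i, ContDiff ℝ 1 (fun x => u x i) := fun i => (hu i).of_le one_le_two
  have hpu : ∀ i j, ContDiff ℝ 1 (pd j (fun x => u x i)) := fun i j => contDiff_pd2 (hu i)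
  have hφ2 : ∀ i, ContDiff ℝ 1 (pd i φ) := fun i => contDiff_pd2 (D.smooth.of_le top_le2)
  set w : V2 → V2 := fun x i => u x i * (pd 0 (fun y => u y 0) x + pd 1 (fun y => u y 1) x)
    - (u x 0 * pd 0 (fun y => u y i) x + u x 1 * pd 1 (fun y => u y i) x) with hw
  have hw1 : ∀ i, ContDiff ℝ 1 (fun x => w x i) := fun i =>
    ((hu1 i).mul ((hpu 0 0).add (hpu 1 1))).sub
      (((hu1 0).mul (hpu i 0)).add ((hu1 1).mul (hpu i 1)))
  have dif : ∀ {f : V2 → ℝ}, ContDiff ℝ 1 f → ∀ x, DifferentiableAt ℝ f x := fun hf x =>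
    hf.differentiable one_ne_zero x
  have hdiv : ∀ x, div2 w x = (div2 u x) ^ 2 + (curl2 u x) ^ 2 - gnsq u x := by
    intro x
    have hpw : ∀ i k, pd k (fun y => w y i) x =
        (u x i * (pd k (pd 0 (fun y => u y 0)) x + pd k (pd 1 (fun y => u y 1)) x)
          + pd k (fun y => u y i) x * (pd 0 (fun y => u y 0) x + pd 1 (fun y => u y 1) x))
        - ((u x 0 * pd k (pd 0 (fun y => u y i)) x + pd k (fun y => u y 0) x * pd 0 (fun y => u y i) x)
          + (u x 1 * pd k (pd 1 (fun y => u y i)) x + pd k (fun y => u y 1) x * pd 1 (fun y => u y i) x)) := by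
      intro i k
      have a1 := dif (hu1 i) x
      have a2 := dif (hu1 0) x
      have a3 := dif (hu1 1) x
      have a4 := fun i j => dif (hpu i j) x
      simp only [hw]
      rw [pd_sub (a1.fun_mul ((a4 0 0).fun_add (a4 1 1)))
        ((a2.fun_mul (a4 i 0)).fun_add (a3.fun_mul (a4 i 1))),
        pd_mul a1 ((a4 0 0).fun_add (a4 1 1)), pd_add (a4 0 0) (a4 1 1),
        pd_add (a2.fun_mul (a4 i 0)) (a3.fun_mul (a4 i 1)), pd_mul a2 (a4 i 0), pd_mul a3 (a4 i 1)]
    simp only [div2, curl2, gnsq, Fin.sum_univ_two, hpw]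
    rw [pd_comm (hu 1) 0 1, pd_comm (hu 0) 1 0]
    ring
  have hsign := div_sign D.smooth hw1 D.bdd D.eq D.fr D.gr (fun x hx => by
    have hh : ContDiff ℝ 1 (fun x => dot (u x) (grad φ x)) := by
      unfold dot grad; exact ContDiff.sum fun i _ => (hu1 i).mul (hφ2 i)
    have ht := D.tangent_deriv hh h0 hx (h0 x hx)
    have hH := D.hess_nonneg hx (h0 x hx)
    have h00 := h0 x hx
    have hgr : ∀ k, pd k (fun x => dot (u x) (grad φ x)) x =
      (u x 0 * pd k (pd 0 φ) x + pd k (fun y => u y 0) x * pd 0 φ x)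
      + (u x 1 * pd k (pd 1 φ) x + pd k (fun y => u y 1) x * pd 1 φ x) := by
      intro k
      simp only [dot, grad, Fin.sum_univ_two]
      have a2 := dif (hu1 0) x
      have a3 := dif (hu1 1) x
      have b2 := dif (hφ2 0) x
      have b3 := dif (hφ2 1) x
      rw [pd_add (a2.fun_mul b2) (a3.fun_mul b3), pd_mul a2 b2, pd_mul a3 b3]
    simp only [dot, Fin.sum_univ_two] at ht h00 hH ⊢
    simp only [grad] at h00 ⊢
    rw [show grad (fun x => u x 0 * grad φ x 0 + u x 1 * grad φ x 1) x =
      grad (fun x => dot (u x) (grad φ x)) x by simp only [dot, Fin.sum_univ_two]] at ht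
    simp only [grad] at ht hgr
    rw [hgr, hgr] at ht
    simp only [hw]
    have : ∀ a b : ℝ, b = a → 0 ≤ b → 0 ≤ a := fun a b h h' => h ▸ h'
    refine this _ _ ?_ hH
    linear_combination ht - (pd 0 (fun y => u y 0) x + pd 1 (fun y => u y 1) x) * h00)
  simp only [hdiv] at hsign
  have c1 : Continuous (gnsq u) := by
    unfold gnsq
    exact continuous_finsetSum _ fun i _ => continuous_finsetSum _ fun j _ => ((hpu i j).continuous).pow 2
  have c2 : Continuous (fun x => (div2 u x) ^ 2 + (curl2 u x) ^ 2) := by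
    have a := fun i j => (hpu i j).continuous
    simp only [div2, curl2, Fin.sum_univ_two]
    exact (((a 0 0).add (a 1 1)).pow 2).add (((a 1 0).sub (a 0 1)).pow 2)
  rw [integral_sub (cont_intOn D.bdd c2) (cont_intOn D.bdd c1)] at hsign
  linarith

lemma pd_coord (i j : Fin 2) (x : V2) : pd j (fun y : V2 => y i) x = if i = j then 1 else 0 := by
  unfold pd
  have : fderiv ℝ (fun y : V2 => y i) x = ContinuousLinearMap.proj i :=
    (ContinuousLinearMap.proj (R := ℝ) (φ := fun _ : Fin 2 => ℝ) i).fderiv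
  rw [this]; simp [Pi.single_apply]

lemma Dom.poincare (D : Dom Ω φ) : ∃ C : ℝ, 0 ≤ C ∧ ∀ u : V2 → V2,
    (∀ i, ContDiff ℝ 1 (fun x => u x i)) →
    (∀ x ∈ frontier Ω, dot (u x) (grad φ x) = 0) →
    ∫ x in Ω, nsq (u x) ≤ C * ∫ x in Ω, gnsq u x := by
  obtain ⟨R, hR⟩ := D.bdd.exists_norm_le
  refine ⟨20 * R ^ 2, by positivity, fun u hu h0 => ?_⟩
  have hpu : ∀ i j, Continuous (pd j (fun x => u x i)) := fun i j => continuous_pd (hu i)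
  set w : V2 → V2 := fun x j => (x 0 * u x 0 + x 1 * u x 1) * u x j with hw
  have hcx : ∀ i, ContDiff ℝ 1 (fun x : V2 => x i) := fun i => contDiff_apply ℝ ℝ i
  have hw1 : ∀ i, ContDiff ℝ 1 (fun x => w x i) := fun i =>
    (((hcx 0).mul (hu 0)).add ((hcx 1).mul (hu 1))).mul (hu i)
  have hz := D.div_zero hw1 (fun x hx => by
    have := h0 x hx
    simp only [dot, Fin.sum_univ_two, hw] at this ⊢
    linear_combination (x 0 * u x 0 + x 1 * u x 1) * this)
  have hdiv : ∀ x, div2 w x = nsq (u x) + (x 0 * (u x 0 * pd 0 (fun y => u y 0) x + u x 1 * pd 1 (fun y => u y 0) x)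
      + x 1 * (u x 0 * pd 0 (fun y => u y 1) x + u x 1 * pd 1 (fun y => u y 1) x)
      + (x 0 * u x 0 + x 1 * u x 1) * (pd 0 (fun y => u y 0) x + pd 1 (fun y => u y 1) x)) := by
    intro x
    have dif : ∀ {f : V2 → ℝ}, ContDiff ℝ 1 f → DifferentiableAt ℝ f x := fun hf =>
      hf.differentiable one_ne_zero x
    have a := fun i => dif (hu i)
    have b := fun i => dif (hcx i)
    have : ∀ j k, pd k (fun y => w y j) x = (x 0 * u x 0 + x 1 * u x 1) * pd k (fun y => u y j) x
        + ((x 0 * pd k (fun y => u y 0) x + pd k (fun y : V2 => y 0) x * u x 0) +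
          (x 1 * pd k (fun y => u y 1) x + pd k (fun y : V2 => y 1) x * u x 1)) * u x j := by
      intro j k
      simp only [hw]
      rw [pd_mul (((b 0).fun_mul (a 0)).fun_add ((b 1).fun_mul (a 1))) (a j),
        pd_add ((b 0).fun_mul (a 0)) ((b 1).fun_mul (a 1)), pd_mul (b 0) (a 0), pd_mul (b 1) (a 1)]
    simp only [div2, Fin.sum_univ_two, this, pd_coord, nsq]
    simp
    ring
  have cn : Continuous fun x => nsq (u x) := by
    unfold nsq; exact continuous_finsetSum _ fun i _ => (hu i).continuous.pow 2
  have cg : Continuous (gnsq u) := by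
    unfold gnsq
    exact continuous_finsetSum _ fun i _ => continuous_finsetSum _ fun j _ => (hpu i j).pow 2
  have cd : Continuous (div2 w) := by
    unfold div2; exact continuous_finsetSum _ fun i _ => continuous_pd (hw1 i)
  have key : ∫ x in Ω, (nsq (u x) - 2 * div2 w x) ≤ ∫ x in Ω, 20 * R ^ 2 * gnsq u x := by
    refine setIntegral_mono_on (cont_intOn D.bdd (cn.sub (continuous_const.mul cd)))
      (cont_intOn D.bdd (continuous_const.mul cg)) D.meas ?_
    intro x hx
    have hn := hR x hx
    have h1 : ∀ i, x i ^ 2 ≤ R ^ 2 := fun i => by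
      rw [← sq_abs (x i)]
      exact pow_le_pow_left₀ (abs_nonneg _) ((norm_le_pi_norm x i).trans hn) 2
    rw [hdiv]
    simp only [nsq, gnsq, Fin.sum_univ_two]
    generalize u x 0 = a, u x 1 = b, pd 0 (fun y => u y 0) x = p, pd 1 (fun y => u y 0) x = q,
      pd 0 (fun y => u y 1) x = r, pd 1 (fun y => u y 1) x = s at *
    have y1 : ∀ i (v c : ℝ), -(2 * (x i * (v * c))) ≤ v ^ 2 / 4 + 4 * R ^ 2 * c ^ 2 := by
      intro i v c
      have := mul_le_mul_of_nonneg_right (h1 i) (sq_nonneg c)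
      nlinarith [sq_nonneg (v / 2 + 2 * (x i * c))]
    have := y1 0 a p
    have := y1 0 b q
    have := y1 1 a r
    have := y1 1 b s
    have := y1 0 a (p + s)
    have := y1 1 b (p + s)
    have h2 : R ^ 2 * (p + s) ^ 2 ≤ R ^ 2 * (2 * p ^ 2 + 2 * s ^ 2) := by
      gcongr; nlinarith [sq_nonneg (p - s)]
    have h3 : 0 ≤ R ^ 2 * q ^ 2 := by positivity
    have h4 : 0 ≤ R ^ 2 * r ^ 2 := by positivity
    nlinarith
  rw [integral_sub (cont_intOn D.bdd cn) ((cont_intOn D.bdd cd).const_mul 2),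
    integral_const_mul, integral_const_mul, hz] at key
  linarith


end

section
open scoped FourierTransform ENNReal SchwartzMap ContDiff

abbrev E2 := EuclideanSpace ℝ (Fin 2)

lemma fourier_ae (g : E2 → ℂ) (h1 : Integrable g) (h2 : MemLp g 2) :
    (𝓕 (h2.toLp g) : Lp ℂ 2 (volume : Measure E2)) =ᵐ[volume] 𝓕 g := by
  have hc : Continuous (𝓕 g) := by
    exact VectorFourier.fourierIntegral_continuous Real.continuous_fourierChar
      (by exact continuous_inner) h1
  apply ae_eq_of_integral_contDiff_smul_eq
  · exact (Lp.memLp _).locallyIntegrable one_le_two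
  · exact hc.locallyIntegrable
  · intro k k_smooth k_cpt
    have hg₁ : HasCompactSupport (Complex.ofRealCLM ∘ k) := k_cpt.comp_left rfl
    have hg₂ : ContDiff ℝ ∞ (Complex.ofRealCLM ∘ k) := by fun_prop
    set kS := hg₁.toSchwartzMap hg₂ with hkS
    have hkx : ∀ x, kS x = (k x : ℂ) := fun x => rfl
    calc ∫ x, k x • (𝓕 (h2.toLp g) : Lp ℂ 2 (volume : Measure E2)) x
        = ((𝓕 (h2.toLp g) : Lp ℂ 2 (volume : Measure E2)) : 𝓢'(E2, ℂ)) kS := by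
          rw [Lp.toTemperedDistribution_apply]; simp [hkx]
      _ = (𝓕 ((h2.toLp g : Lp ℂ 2 (volume : Measure E2)) : 𝓢'(E2, ℂ))) kS := by
          rw [Lp.fourier_toTemperedDistribution_eq]
      _ = ∫ x, (𝓕 kS) x • (h2.toLp g) x := by
          rw [TemperedDistribution.fourier_apply, Lp.toTemperedDistribution_apply]
      _ = ∫ x, (𝓕 kS) x • g x := by
          apply integral_congr_ae
          filter_upwards [h2.coeFn_toLp] with x hx
          rw [hx]
      _ = ∫ x, (𝓕 (fun x => kS x)) x • g x := by
          rw [SchwartzMap.fourier_coe]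
      _ = ∫ x, kS x • 𝓕 g x := by
          have := VectorFourier.integral_fourierIntegral_smul_eq_flip (L := innerₗ E2)
            (μ := volume) (ν := volume) (f := fun x => kS x) (g := g)
            Real.continuous_fourierChar (by exact continuous_inner) kS.integrable h1
          rw [flip_innerₗ] at this
          exact this
      _ = _ := by simp [hkx]

lemma planch (g : E2 → ℂ) (h1 : Integrable g) (h2 : MemLp g 2) :
    ∫⁻ x, ‖𝓕 g x‖ₑ ^ 2 = ∫⁻ x, ‖g x‖ₑ ^ 2 := by
  have e : eLpNorm (𝓕 g) 2 volume = eLpNorm g 2 volume := by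
    rw [← eLpNorm_congr_ae (fourier_ae g h1 h2), ← eLpNorm_congr_ae h2.coeFn_toLp]
    have := Lp.norm_fourier_eq (h2.toLp g)
    rw [Lp.norm_def, Lp.norm_def, ENNReal.toReal_eq_toReal_iff' (Lp.eLpNorm_ne_top _) (Lp.eLpNorm_ne_top _)] at this
    exact this
  have h3 : ∀ f : E2 → ℂ, ∫⁻ x, ‖f x‖ₑ ^ 2 = eLpNorm f 2 volume ^ (2:ℝ) := by
    intro f
    rw [eLpNorm_eq_lintegral_rpow_enorm_toReal (by norm_num) (by norm_num), ← ENNReal.rpow_mul]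
    simp
  rw [h3, h3, e]

lemma lint_kernel (r : ℝ) (hr : 0 ≤ r) :
    ∫⁻ s in Ioi (1:ℝ), ENNReal.ofReal (r / (s ^ 2 + r ^ 2)) ≤ ENNReal.ofReal π := by
  rcases hr.eq_or_lt with rfl | hr
  · simp
  refine (setLIntegral_le_lintegral _ _).trans ?_
  have e : ∀ s : ℝ, r / (s ^ 2 + r ^ 2) = r⁻¹ * (1 + (s / r) ^ 2)⁻¹ := by
    intro s; field_simp; ring
  simp only [e]
  have hi : Integrable (fun s : ℝ => (1 + (s / r) ^ 2)⁻¹) :=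
    integrable_inv_one_add_sq.comp_div hr.ne'
  rw [← ofReal_integral_eq_lintegral_ofReal (hi.const_mul _)
    (Filter.Eventually.of_forall fun s => by positivity)]
  rw [integral_const_mul, Measure.integral_comp_div (fun s : ℝ => (1 + s ^ 2)⁻¹), integral_univ_inv_one_add_sq,
    abs_of_pos hr, smul_eq_mul, inv_mul_cancel_left₀ hr.ne']

/-- The majorant of the symbol. -/
def ksym (ζ : E2) : ℝ := ‖ζ‖ / (1 + ‖ζ‖ ^ 2)

lemma ksym_nonneg (ζ : E2) : 0 ≤ ksym ζ := by unfold ksym; positivity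

lemma ksym_meas : Measurable ksym := by unfold ksym; fun_prop

lemma sq_fn (h : E2 → ℝ≥0∞) (hh : Measurable h) (ε : ℝ) (hε : |ε| = 1) :
    ∫⁻ s in Ioi (1:ℝ), ∫⁻ ζ, ENNReal.ofReal (s * ksym ζ) * h ((ε * s) • ζ)
      ≤ ENNReal.ofReal π * ∫⁻ ζ, h ζ := by
  have step : ∀ s ∈ Ioi (1:ℝ), ∫⁻ ζ, ENNReal.ofReal (s * ksym ζ) * h ((ε * s) • ζ)
      = ∫⁻ ζ, ENNReal.ofReal (‖ζ‖ / (s ^ 2 + ‖ζ‖ ^ 2)) * h ζ := by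
    intro s hs
    have hs0 : (0:ℝ) < s := lt_trans one_pos hs
    have hε0 : ε ≠ 0 := by rintro rfl; simp at hε
    have hc : ε * s ≠ 0 := mul_ne_zero hε0 hs0.ne'
    have hε2 : ε ^ 2 = 1 := by rw [← sq_abs, hε, one_pow]
    set F : E2 → ℝ≥0∞ := fun η => ENNReal.ofReal (s * ksym ((ε * s)⁻¹ • η)) * h η with hF
    have hFm : Measurable F := by
      refine Measurable.mul ?_ hh
      exact (measurable_const.mul (ksym_meas.comp (measurable_const_smul _))).ennreal_ofReal
    have e1 : (fun ζ => ENNReal.ofReal (s * ksym ζ) * h ((ε * s) • ζ)) = fun ζ => F ((ε * s) • ζ) := by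
      ext ζ; simp only [hF]; rw [smul_smul, inv_mul_cancel₀ hc, one_smul]
    rw [e1, ← lintegral_map hFm (measurable_const_smul (ε * s)), Measure.map_addHaar_smul _ hc,
      lintegral_smul_measure, smul_eq_mul, ← lintegral_const_mul _ hFm]
    · congr 1; ext ζ
      simp only [hF]
      rw [← mul_assoc, ← ENNReal.ofReal_mul (by positivity)]
      congr 2
      simp only [finrank_euclideanSpace, Fintype.card_fin, ksym, norm_smul, norm_inv, norm_mul,
        Real.norm_eq_abs, hε, one_mul, abs_of_pos hs0, mul_pow, hε2, abs_inv, abs_pow]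
      field_simp
  rw [setLIntegral_congr_fun measurableSet_Ioi step]
  rw [lintegral_lintegral_swap]
  · rw [← lintegral_const_mul _ hh]
    refine lintegral_mono fun ζ => ?_
    rw [lintegral_mul_const]
    · gcongr; exact lint_kernel _ (norm_nonneg _)
    · fun_prop
  · apply Measurable.aemeasurable
    apply Measurable.mul
    · fun_prop
    · exact hh.comp measurable_snd

lemma symbol_bound (w : 𝓢(E2, ℂ)) (m : E2) :
    ∃ C : ℝ, 0 ≤ C ∧ ∀ ζ, ‖𝓕 (SchwartzMap.evalCLM ℝ E2 ℂ m (SchwartzMap.fderivCLM ℝ E2 ℂ w)) ζ‖ ≤ C * ksym ζ := by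
  obtain ⟨C0, hC0⟩ := (𝓕 w).decay 0 0
  obtain ⟨C2, hC2⟩ := (𝓕 w).decay 2 0
  have e : SchwartzMap.evalCLM ℝ E2 ℂ m (SchwartzMap.fderivCLM ℝ E2 ℂ w) = LineDeriv.lineDerivOp m w := rfl
  refine ⟨2 * π * ‖m‖ * (C0 + C2), ?_, fun ζ => ?_⟩
  · have h1 := hC0.1
    have h2 := hC2.1
    positivity
  · rw [e, SchwartzMap.fourier_lineDerivOp_eq]
    have : (inner ℝ · m : E2 → ℝ).HasTemperateGrowth := ((innerSL ℝ).flip m).hasTemperateGrowth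
    simp only [smul_apply, SchwartzMap.smulLeftCLM_apply_apply this]
    have h1 := hC0.2 ζ
    have h2 := hC2.2 ζ
    simp only [pow_zero, one_mul, norm_iteratedFDeriv_zero] at h1 h2
    have h3 : |inner ℝ ζ m| ≤ ‖ζ‖ * ‖m‖ := abs_real_inner_le_norm ζ m
    rw [norm_smul, norm_smul, Real.norm_eq_abs]
    have h4 : ‖(2 * π * Complex.I : ℂ)‖ = 2 * π := by
      simp [abs_of_pos Real.pi_pos]
    rw [h4]
    have h5 : ‖(𝓕 w) ζ‖ ≤ (C0 + C2) / (1 + ‖ζ‖ ^ 2) := by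
      rw [le_div_iff₀ (by positivity)]; nlinarith
    calc 2 * π * (|inner ℝ ζ m| * ‖(𝓕 w) ζ‖) ≤ 2 * π * ((‖ζ‖ * ‖m‖) * ((C0 + C2) / (1 + ‖ζ‖ ^ 2))) := by
          gcongr
      _ = _ := by unfold ksym; ring

lemma fourier_cont (g : E2 → ℂ) (h1 : Integrable g) : Continuous (𝓕 g) := by
  exact VectorFourier.fourierIntegral_continuous Real.continuous_fourierChar
      (by exact continuous_inner) h1

lemma bilin_id (ψ : 𝓢(E2, ℂ)) (g F : E2 → ℂ) (hg : Integrable g) (hF : Integrable F) (s τ : ℝ) :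
    ∫ p : E2 × E2, g p.1 * F p.2 * ψ (s • p.1 - τ • p.2)
      = ∫ ζ, (𝓕 ψ) ζ * (𝓕 g (-s • ζ) * 𝓕 F (τ • ζ)) := by
  have inv : ∀ z, ψ z = ∫ ζ, 𝐞 (inner ℝ ζ z) • (𝓕 ψ) ζ := by
    intro z
    conv_lhs => rw [← FourierTransform.fourierInv_fourier_eq (F := 𝓢(E2, ℂ)) ψ]
    rw [SchwartzMap.fourierInv_coe, Real.fourierInv_eq]
  have h1 : ∀ ζ, (𝓕 ψ) ζ * (𝓕 g (-s • ζ) * 𝓕 F (τ • ζ))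
      = ∫ p : E2 × E2, g p.1 * F p.2 * (𝐞 (inner ℝ ζ (s • p.1 - τ • p.2)) • (𝓕 ψ) ζ) := by
    intro ζ
    rw [Real.fourier_eq, Real.fourier_eq, ← integral_prod_mul, ← integral_const_mul]
    congr 1; ext p
    simp only [Circle.smul_def, smul_eq_mul]
    have : (𝐞 (inner ℝ ζ (s • p.1 - τ • p.2)) : ℂ)
        = (𝐞 (-inner ℝ p.1 (-s • ζ)) : ℂ) * (𝐞 (-inner ℝ p.2 (τ • ζ)) : ℂ) := by
      rw [← Circle.coe_mul, ← AddChar.map_add_eq_mul]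
      congr 2
      rw [inner_sub_right, inner_smul_right, inner_smul_right, inner_smul_right, inner_smul_right,
        real_inner_comm ζ, real_inner_comm ζ]
      ring
    rw [this]; ring
  simp only [h1]
  rw [integral_integral_swap]
  · congr 1; ext p
    rw [inv, ← integral_const_mul]
  · have hI : Integrable (fun q : E2 × (E2 × E2) => (𝓕 ψ) q.1 * (g q.2.1 * F q.2.2))
        (volume.prod volume) :=
      Integrable.mul_prod (𝓕 ψ).integrable (hg.mul_prod hF)
    have hc : Continuous (fun q : E2 × (E2 × E2) => (𝐞 (inner ℝ q.1 (s • q.2.1 - τ • q.2.2)) : ℂ)) := by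
      have := Real.continuous_fourierChar
      fun_prop
    have := hI.bdd_mul (c := 1) hc.aestronglyMeasurable (Filter.Eventually.of_forall fun q => (Circle.norm_coe _).le)
    refine this.congr (Filter.Eventually.of_forall fun q => ?_)
    simp only [Circle.smul_def, smul_eq_mul, Function.uncurry]
    ring

lemma point_bd {C k s : ℝ} {P A B : ℂ} (hC : 0 ≤ C) (hk : 0 ≤ k) (hs2 : 2 < s)
    (hbz : ‖P‖ ≤ C * k) :
    ENNReal.ofReal s * ‖P * (A * B)‖ₑ ≤ ENNReal.ofReal C * (ENNReal.ofReal (s * k) * ‖A‖ₑ ^ 2) +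
          ENNReal.ofReal (2 * C) * (ENNReal.ofReal ((s - 1) * k) * ‖B‖ₑ ^ 2) := by
  rw [← ofReal_norm, ← ofReal_norm, ← ofReal_norm, ← ENNReal.ofReal_pow (norm_nonneg _),
    ← ENNReal.ofReal_pow (norm_nonneg _)]
  have p1 : 0 ≤ s * k := by nlinarith
  have p2 : 0 ≤ (s - 1) * k := by nlinarith
  rw [← ENNReal.ofReal_mul (by linarith), ← ENNReal.ofReal_mul p1, ← ENNReal.ofReal_mul p2,
    ← ENNReal.ofReal_mul (by positivity), ← ENNReal.ofReal_mul (by positivity),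
    ← ENNReal.ofReal_add (by positivity) (by positivity)]
  apply ENNReal.ofReal_le_ofReal
  rw [norm_mul, norm_mul]
  have hs0 : 0 ≤ s := by linarith
  have h1 : s * (‖P‖ * (‖A‖ * ‖B‖)) ≤ s * ((C * k) * (‖A‖ * ‖B‖)) := by
    gcongr
  have hCk : 0 ≤ C * k := by positivity
  have h2 : s * (‖A‖ * ‖B‖) ≤ s * ‖A‖ ^ 2 + 2 * (s - 1) * ‖B‖ ^ 2 := by
    nlinarith [sq_nonneg (‖A‖ - ‖B‖), sq_nonneg (‖A‖), sq_nonneg ‖B‖]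
  nlinarith [mul_le_mul_of_nonneg_left h2 hCk]

lemma fourier_point (p : E2 → ℂ) (hp : Continuous p) {C : ℝ} (hC : 0 ≤ C) (hb : ∀ ζ, ‖p ζ‖ ≤ C * ksym ζ)
    (A B : E2 → ℂ) (hA : Continuous A) (hB : Continuous B) (s : ℝ) (hs2 : 2 < s) :
    ENNReal.ofReal s * ‖∫ ζ, p ζ * (A ζ * B ζ)‖ₑ
      ≤ ENNReal.ofReal C * (∫⁻ ζ, ENNReal.ofReal (s * ksym ζ) * ‖A ζ‖ₑ ^ 2) +
        ENNReal.ofReal (2 * C) * (∫⁻ ζ, ENNReal.ofReal ((s - 1) * ksym ζ) * ‖B ζ‖ₑ ^ 2) := by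
  have m1 : Measurable fun ζ : E2 => ‖A ζ‖ₑ ^ 2 := hA.enorm.measurable.pow_const 2
  have m2 : Measurable fun ζ : E2 => ‖B ζ‖ₑ ^ 2 := hB.enorm.measurable.pow_const 2
  have m3 : Measurable fun ζ : E2 => ENNReal.ofReal (s * ksym ζ) :=
    (measurable_const.mul ksym_meas).ennreal_ofReal
  have m4 : Measurable fun ζ : E2 => ENNReal.ofReal ((s-1) * ksym ζ) :=
    (measurable_const.mul ksym_meas).ennreal_ofReal
  have h1 : ENNReal.ofReal s * ‖∫ ζ, p ζ * (A ζ * B ζ)‖ₑ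
      ≤ ENNReal.ofReal s * ∫⁻ ζ, ‖p ζ * (A ζ * B ζ)‖ₑ := by
    gcongr; exact enorm_integral_le_lintegral_enorm _
  refine h1.trans ?_
  have m5 : Measurable fun ζ : E2 => ‖p ζ * (A ζ * B ζ)‖ₑ := ((hp.mul (hA.mul hB)).enorm).measurable
  have m6 : Measurable fun ζ : E2 => ENNReal.ofReal (s * ksym ζ) * ‖A ζ‖ₑ ^ 2 := m3.mul m1
  have m7 : Measurable fun ζ : E2 => ENNReal.ofReal ((s-1) * ksym ζ) * ‖B ζ‖ₑ ^ 2 := m4.mul m2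
  rw [← lintegral_const_mul _ m5,
    ← lintegral_const_mul _ m6, ← lintegral_const_mul _ m7,
    ← lintegral_add_left (m6.const_mul _)]
  exact lintegral_mono fun ζ => point_bd hC (ksym_nonneg ζ) hs2 (hb ζ)

lemma fourier_main0 (ψ : 𝓢(E2, ℂ)) {C : ℝ} (hC : 0 ≤ C) (hb : ∀ ζ, ‖𝓕 ψ ζ‖ ≤ C * ksym ζ)
    (g F : E2 → ℂ) (hg : Integrable g) (hg2 : MemLp g 2) (hF : Integrable F) (hF2 : MemLp F 2) :
    ∫⁻ s in Ioi (2:ℝ), ENNReal.ofReal s *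
      ‖∫ p : E2 × E2, g p.1 * F p.2 * ψ (s • p.1 - (s - 1) • p.2)‖ₑ
    ≤ ENNReal.ofReal (2 * C * π) * ((∫⁻ x, ‖g x‖ₑ ^ 2) + ∫⁻ x, ‖F x‖ₑ ^ 2) := by
  set hgf : E2 → ℝ≥0∞ := fun ζ => ‖𝓕 g ζ‖ₑ ^ 2 with hgf'
  set hFf : E2 → ℝ≥0∞ := fun ζ => ‖𝓕 F ζ‖ₑ ^ 2 with hFf'
  have mg : Measurable hgf := (fourier_cont g hg).enorm.measurable.pow_const 2
  have mF : Measurable hFf := (fourier_cont F hF).enorm.measurable.pow_const 2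
  have point : ∀ s ∈ Ioi (2:ℝ), ENNReal.ofReal s *
      ‖∫ p : E2 × E2, g p.1 * F p.2 * ψ (s • p.1 - (s - 1) • p.2)‖ₑ
      ≤ ENNReal.ofReal C * (∫⁻ ζ, ENNReal.ofReal (s * ksym ζ) * hgf ((-1 * s) • ζ)) +
        ENNReal.ofReal (2 * C) * (∫⁻ ζ, ENNReal.ofReal ((s - 1) * ksym ζ) * hFf ((1 * (s - 1)) • ζ)) := by
    intro s hs
    have hs2 : (2:ℝ) < s := hs
    rw [bilin_id ψ g F hg hF s (s - 1)]
    have c1 : Continuous fun ζ : E2 => 𝓕 g (-s • ζ) := (fourier_cont g hg).comp (continuous_const_smul _)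
    have c2 : Continuous fun ζ : E2 => 𝓕 F ((s-1) • ζ) := (fourier_cont F hF).comp (continuous_const_smul _)
    have := fourier_point (fun ζ => (𝓕 ψ) ζ) (𝓕 ψ).continuous hC hb _ _ c1 c2 s hs2
    simp only [hgf', hFf', neg_one_mul, one_mul]
    exact this
  have mG : Measurable fun s : ℝ => ∫⁻ ζ, ENNReal.ofReal (s * ksym ζ) * hgf ((-1 * s) • ζ) := by
    apply Measurable.lintegral_prod_right (f := fun (s : ℝ) (ζ : E2) => ENNReal.ofReal (s * ksym ζ) * hgf ((-1 * s) • ζ))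
    exact (measurable_fst.mul (ksym_meas.comp measurable_snd)).ennreal_ofReal.mul
      (mg.comp (by fun_prop))
  have mH : Measurable fun s : ℝ => ∫⁻ ζ, ENNReal.ofReal (s * ksym ζ) * hFf ((1 * s) • ζ) := by
    apply Measurable.lintegral_prod_right (f := fun (s : ℝ) (ζ : E2) => ENNReal.ofReal (s * ksym ζ) * hFf ((1 * s) • ζ))
    exact (measurable_fst.mul (ksym_meas.comp measurable_snd)).ennreal_ofReal.mul
      (mF.comp (by fun_prop))
  have b1 := sq_fn hgf mg (-1) (by simp)
  have b2 := sq_fn hFf mF 1 (by simp)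
  rw [planch g hg hg2] at b1
  rw [planch F hF hF2] at b2
  have shift : ∫⁻ s in Ioi (2:ℝ), ∫⁻ ζ, ENNReal.ofReal ((s - 1) * ksym ζ) * hFf ((1 * (s - 1)) • ζ)
      = ∫⁻ s in Ioi (1:ℝ), ∫⁻ ζ, ENNReal.ofReal (s * ksym ζ) * hFf ((1 * s) • ζ) := by
    have mp := (measurePreserving_sub_right (volume : Measure ℝ) 1)
    have := mp.setLIntegral_comp_preimage (s := Ioi 1) measurableSet_Ioi mH
    rw [← this]
    congr 2
    ext s; simp; constructor <;> intro h <;> linarith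
  calc _ ≤ ∫⁻ s in Ioi (2:ℝ), (ENNReal.ofReal C * (∫⁻ ζ, ENNReal.ofReal (s * ksym ζ) * hgf ((-1 * s) • ζ)) +
        ENNReal.ofReal (2 * C) * (∫⁻ ζ, ENNReal.ofReal ((s - 1) * ksym ζ) * hFf ((1 * (s - 1)) • ζ))) :=
        setLIntegral_mono' measurableSet_Ioi point
    _ = ENNReal.ofReal C * (∫⁻ s in Ioi (2:ℝ), ∫⁻ ζ, ENNReal.ofReal (s * ksym ζ) * hgf ((-1 * s) • ζ)) +
        ENNReal.ofReal (2 * C) * (∫⁻ s in Ioi (2:ℝ), ∫⁻ ζ, ENNReal.ofReal ((s - 1) * ksym ζ) * hFf ((1 * (s - 1)) • ζ)) := by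
        rw [lintegral_add_left (mG.const_mul _), lintegral_const_mul _ mG, lintegral_const_mul]
        exact mH.comp (measurable_id.sub_const 1)
    _ ≤ ENNReal.ofReal C * (ENNReal.ofReal π * ∫⁻ x, ‖g x‖ₑ ^ 2) +
        ENNReal.ofReal (2 * C) * (ENNReal.ofReal π * ∫⁻ x, ‖F x‖ₑ ^ 2) := by
        rw [shift]
        gcongr
        exact (lintegral_mono_set (Ioi_subset_Ioi one_le_two)).trans b1
    _ ≤ _ := by
        rw [mul_add, ← mul_assoc, ← mul_assoc, ← ENNReal.ofReal_mul hC, ← ENNReal.ofReal_mul (by positivity)]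
        gcongr
        nlinarith [mul_nonneg hC Real.pi_pos.le]

lemma fourier_main (w : 𝓢(E2, ℂ)) (m : E2) : ∃ C : ℝ, 0 ≤ C ∧ ∀ g F : E2 → ℂ,
    Integrable g → MemLp g 2 → Integrable F → MemLp F 2 →
    ∫⁻ s in Ioi (2:ℝ), ENNReal.ofReal s *
      ‖∫ p : E2 × E2, g p.1 * F p.2 * (fderiv ℝ w (s • p.1 - (s - 1) • p.2) m)‖ₑ
    ≤ ENNReal.ofReal C * ((∫⁻ x, ‖g x‖ₑ ^ 2) + ∫⁻ x, ‖F x‖ₑ ^ 2) := by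
  obtain ⟨C, hC, hb⟩ := symbol_bound w m
  refine ⟨2 * C * π, by positivity, fun g F hg hg2 hF hF2 => ?_⟩
  exact fourier_main0 _ hC hb g F hg hg2 hF hF2


end

section
open scoped FourierTransform ENNReal SchwartzMap ContDiff

/-- extension by zero, transported to Euclidean space, complex valued -/
def extE (Ω : Set V2) (g : V2 → ℝ) (v : E2) : ℂ := ((Ω.indicator g (WithLp.ofLp v) : ℝ) : ℂ)

lemma extE_props {Ω : Set V2} (hm : MeasurableSet Ω) (hb : IsBounded Ω) {g : V2 → ℝ} (hg : Continuous g) :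
    Integrable (extE Ω g) ∧ MemLp (extE Ω g) 2 ∧
      ∫⁻ v, ‖extE Ω g v‖ₑ ^ 2 = ENNReal.ofReal (∫ x in Ω, g x ^ 2) := by
  have mp : MeasurePreserving (@WithLp.ofLp 2 (Fin 2 → ℝ)) := PiLp.volume_preserving_ofLp (Fin 2)
  have gm : Measurable (Ω.indicator g) := hg.measurable.indicator hm
  have i1 : Integrable (fun x => Ω.indicator g x) :=
    (integrable_indicator_iff hm).2 (cont_intOn hb hg)
  have i2 : Integrable (fun x => (Ω.indicator g x) ^ 2) := by
    have : (fun x => (Ω.indicator g x) ^ 2) = Ω.indicator (fun x => g x ^ 2) := by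
      ext x; by_cases h : x ∈ Ω <;> simp [h]
    rw [this]
    exact (integrable_indicator_iff hm).2 (cont_intOn hb (hg.pow 2))
  have em : Measurable (extE Ω g) :=
    Complex.measurable_ofReal.comp (gm.comp mp.measurable)
  refine ⟨?_, ?_, ?_⟩
  · have := (mp.integrable_comp i1.aestronglyMeasurable).2 i1
    exact this.ofReal
  · rw [memLp_two_iff_integrable_sq_norm em.aestronglyMeasurable]
    have := (mp.integrable_comp i2.aestronglyMeasurable).2 i2
    refine this.congr (Filter.Eventually.of_forall fun v => ?_)
    simp [extE]
  · have h1 : ∀ v, ‖extE Ω g v‖ₑ ^ 2 = ENNReal.ofReal ((Ω.indicator g (WithLp.ofLp v)) ^ 2) := by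
      intro v
      rw [← ofReal_norm, ← ENNReal.ofReal_pow (norm_nonneg _)]; simp [extE]
    simp only [h1]
    rw [mp.lintegral_comp (f := fun x => ENNReal.ofReal ((Ω.indicator g x) ^ 2)) (gm.pow_const 2).ennreal_ofReal,
      ← ofReal_integral_eq_lintegral_ofReal i2 (Filter.Eventually.of_forall fun x => sq_nonneg _)]
    congr 1
    rw [← integral_indicator hm]
    congr 1; ext x; by_cases h : x ∈ Ω <;> simp [h]

lemma fourier_V2 (w : V2 → ℝ) (hw : ContDiff ℝ (⊤ : ℕ∞) w) (hc : HasCompactSupport w) (j : Fin 2) :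
    ∃ C : ℝ, 0 ≤ C ∧ ∀ (Ω : Set V2) (g F : V2 → ℝ) (S : ℝ), MeasurableSet Ω → IsBounded Ω →
      Continuous g → Continuous F → 2 ≤ S →
      |∫ s in (2:ℝ)..S, s * ∫ p in Ω ×ˢ Ω, g p.1 * F p.2 * pd j w (s • p.1 - (s - 1) • p.2)|
        ≤ C * ((∫ x in Ω, g x ^ 2) + ∫ x in Ω, F x ^ 2) := by
  set L : E2 →L[ℝ] V2 := (EuclideanSpace.equiv (Fin 2) ℝ : E2 →L[ℝ] V2) with hL
  have hLa : ∀ v : E2, L v = WithLp.ofLp v := fun v => rfl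
  set wE : E2 → ℂ := fun v => ((w (L v) : ℝ) : ℂ) with hwE
  have wc : HasCompactSupport wE := by
    have : HasCompactSupport (fun v : E2 => w (L v)) :=
      hc.comp_homeomorph (EuclideanSpace.equiv (Fin 2) ℝ).toHomeomorph
    exact this.comp_left (g := fun r : ℝ => (r : ℂ)) (by simp)
  have ws : ContDiff ℝ ∞ wE := Complex.ofRealCLM.contDiff.comp (hw.comp L.contDiff)
  set m : E2 := WithLp.toLp 2 (Pi.single j 1) with hm
  have hfd : ∀ z : E2, fderiv ℝ wE z m = ((pd j w (WithLp.ofLp z) : ℝ) : ℂ) := by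
    intro z
    have h1 : HasFDerivAt wE (Complex.ofRealCLM.comp ((fderiv ℝ w (L z)).comp L)) z :=
      Complex.ofRealCLM.hasFDerivAt.comp z
        (((hw.differentiable (by simp)).differentiableAt).hasFDerivAt.comp z L.hasFDerivAt)
    rw [h1.fderiv]; rfl
  obtain ⟨C, hC, hb⟩ := fourier_main (wc.toSchwartzMap ws) m
  refine ⟨C, hC, fun Ω g F S hΩ hΩb hg hF hS => ?_⟩
  obtain ⟨g1, g2, g3⟩ := extE_props hΩ hΩb hg
  obtain ⟨F1, F2, F3⟩ := extE_props hΩ hΩb hF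
  have key := hb _ _ g1 g2 F1 F2
  rw [g3, F3] at key
  have mp : MeasurePreserving (@WithLp.ofLp 2 (Fin 2 → ℝ)) := PiLp.volume_preserving_ofLp (Fin 2)
  have mpp := mp.prod mp
  have emb : MeasurableEmbedding (Prod.map (@WithLp.ofLp 2 (Fin 2 → ℝ)) (@WithLp.ofLp 2 (Fin 2 → ℝ))) := by
    have e : MeasurableEquiv E2 V2 := (MeasurableEquiv.toLp 2 (Fin 2 → ℝ)).symm
    exact ((MeasurableEquiv.toLp 2 (Fin 2 → ℝ)).symm.prodCongr (MeasurableEquiv.toLp 2 (Fin 2 → ℝ)).symm).measurableEmbedding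
  have conv : ∀ s : ℝ, ∫ p : E2 × E2, extE Ω g p.1 * extE Ω F p.2 *
      (fderiv ℝ (wc.toSchwartzMap ws) (s • p.1 - (s - 1) • p.2) m)
      = ((∫ p in Ω ×ˢ Ω, g p.1 * F p.2 * pd j w (s • p.1 - (s - 1) • p.2) : ℝ) : ℂ) := by
    intro s
    rw [← integral_indicator (hΩ.prod hΩ)]
    have : _ = ∫ y : V2 × V2, _ ∂(volume.prod volume) := mpp.integral_comp emb ((Ω ×ˢ Ω).indicator fun p : V2 × V2 => g p.1 * F p.2 * pd j w (s • p.1 - (s - 1) • p.2))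
    rw [Measure.volume_eq_prod V2 V2, ← this, ← integral_complex_ofReal]
    rw [Measure.volume_eq_prod]
    congr 1; ext p
    have : fderiv ℝ (wc.toSchwartzMap ws) (s • p.1 - (s - 1) • p.2) m
       = ((pd j w (s • WithLp.ofLp p.1 - (s - 1) • WithLp.ofLp p.2) : ℝ) : ℂ) := hfd _
    rw [this]
    simp only [extE, Set.indicator, Prod.map, Set.mem_prod]
    by_cases h1 : WithLp.ofLp p.1 ∈ Ω <;> by_cases h2 : WithLp.ofLp p.2 ∈ Ω <;> simp [h1, h2]
  simp only [conv] at key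
  have fin : ‖∫ s in (2:ℝ)..S, s * ∫ p in Ω ×ˢ Ω, g p.1 * F p.2 * pd j w (s • p.1 - (s - 1) • p.2)‖ₑ
      ≤ ENNReal.ofReal (C * ((∫ x in Ω, g x ^ 2) + ∫ x in Ω, F x ^ 2)) := by
    rw [intervalIntegral.integral_of_le hS, ENNReal.ofReal_mul hC,
      ENNReal.ofReal_add (integral_nonneg fun _ => sq_nonneg _) (integral_nonneg fun _ => sq_nonneg _)]
    refine (enorm_integral_le_lintegral_enorm _).trans (le_trans ?_ key)
    refine (lintegral_mono_set Ioc_subset_Ioi_self).trans ?_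
    refine setLIntegral_mono' measurableSet_Ioi fun s hs => ?_
    have hs0 : (0:ℝ) ≤ s := by have : (2:ℝ) < s := hs; linarith
    rw [enorm_mul, ← ofReal_norm s, Real.norm_of_nonneg hs0, ← ofReal_norm, ← ofReal_norm, Complex.norm_real]
  rw [← ofReal_norm, ENNReal.ofReal_le_ofReal_iff (mul_nonneg hC (add_nonneg
    (integral_nonneg fun _ => sq_nonneg _) (integral_nonneg fun _ => sq_nonneg _)))] at fin
  exact fin


end

section


lemma deriv_param {Y : Type*} [PseudoMetricSpace Y] [ProperSpace Y]
    [MeasurableSpace Y] [OpensMeasurableSpace Y] [SecondCountableTopology Y]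
    {μ : Measure Y} [IsFiniteMeasureOnCompacts μ] {A : Set Y}
    (hA : IsBounded A) (hAm : MeasurableSet A) {H H' : ℝ → Y → ℝ}
    (hc : Continuous (fun p : ℝ × Y => H p.1 p.2))
    (hc' : Continuous (fun p : ℝ × Y => H' p.1 p.2))
    (hd : ∀ t y, HasDerivAt (fun s => H s y) (H' t y) t) (t : ℝ) :
    HasDerivAt (fun s => ∫ y in A, H s y ∂μ) (∫ y in A, H' t y ∂μ) t := by
  obtain ⟨K, hK⟩ := ((isCompact_Icc (a := t - 1) (b := t + 1)).prod hA.isCompact_closure).exists_bound_of_continuousOn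
    (f := fun p : ℝ × Y => H' p.1 p.2) hc'.continuousOn
  have c1 : ∀ s, Continuous (H s) := fun s => hc.comp (by fun_prop : Continuous fun y : Y => (s, y))
  have c2 : ∀ s, Continuous (H' s) := fun s => hc'.comp (by fun_prop : Continuous fun y : Y => (s, y))
  refine (hasDerivAt_integral_of_dominated_loc_of_deriv_le (μ := μ.restrict A) (F := H) (F' := H')
    (bound := fun _ => K) (s := Icc (t - 1) (t + 1))
    (Icc_mem_nhds (by linarith) (by linarith))
    (Eventually.of_forall fun s => (c1 s).aestronglyMeasurable)
    (cont_intOn hA (c1 t)) (c2 t).aestronglyMeasurable ?_ (cont_intOn hA continuous_const) ?_).2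
  · rw [ae_restrict_iff' hAm]
    exact Eventually.of_forall fun y hy s hs => hK (s, y) ⟨hs, subset_closure hy⟩
  · exact Eventually.of_forall fun y s _ => hd s y

lemma ftc {g g' : ℝ → ℝ} (hg : ∀ t, HasDerivAt g (g' t) t) (hc : Continuous g') (a b : ℝ) :
    ∫ t in a..b, g' t = g b - g a :=
  intervalIntegral.integral_eq_sub_of_hasDerivAt (fun x _ => hg x) (hc.intervalIntegrable a b)

lemma Smooth2.slice {f : ℝ → V2 → ℝ} (hf : Smooth2 f) (t : ℝ) : ContDiff ℝ (⊤ : ℕ∞) (f t) :=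
  ContDiff.comp (g := fun p : ℝ × V2 => f p.1 p.2) hf (contDiff_const.prodMk contDiff_id)

lemma Smooth2.cont {f : ℝ → V2 → ℝ} (hf : Smooth2 f) : Continuous (fun p : ℝ × V2 => f p.1 p.2) :=
  ContDiff.continuous hf

lemma pd_uncurry {f : ℝ → V2 → ℝ} (hf : ContDiff ℝ 1 (fun p : ℝ × V2 => f p.1 p.2)) (i : Fin 2) (t : ℝ) (x : V2) :
    pd i (f t) x = fderiv ℝ (fun p : ℝ × V2 => f p.1 p.2) (t, x) (0, Pi.single i 1) := by
  have h := ((hf.differentiable one_ne_zero).differentiableAt (x := (t, x))).hasFDerivAt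
  have h2 : HasFDerivAt (fun y : V2 => ((t, y) : ℝ × V2)) (ContinuousLinearMap.inr ℝ ℝ V2) x :=
    hasFDerivAt_prodMk_right t x
  have := (h.comp x h2).fderiv
  unfold pd
  have e : f t = (fun p : ℝ × V2 => f p.1 p.2) ∘ fun y => (t, y) := rfl
  rw [e, this]; simp

lemma hasDeriv_uncurry {f : ℝ → V2 → ℝ} (hf : ContDiff ℝ 1 (fun p : ℝ × V2 => f p.1 p.2)) (t : ℝ) (x : V2) :
    HasDerivAt (fun s => f s x) (fderiv ℝ (fun p : ℝ × V2 => f p.1 p.2) (t, x) (1, 0)) t := by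
  have h := ((hf.differentiable one_ne_zero).differentiableAt (x := (t, x))).hasFDerivAt
  have h2 : HasDerivAt (fun s : ℝ => ((s, x) : ℝ × V2)) (1, 0) t :=
    (hasDerivAt_id t).prodMk (hasDerivAt_const t x)
  exact h.comp_hasDerivAt t h2

lemma hasDeriv_dt {f : ℝ → V2 → ℝ} (hf : ContDiff ℝ 1 (fun p : ℝ × V2 => f p.1 p.2)) (t : ℝ) (x : V2) :
    HasDerivAt (fun s => f s x) (dt f t x) t :=
  (hasDeriv_uncurry hf t x).differentiableAt.hasDerivAt

lemma cont_pd2 {f : ℝ → V2 → ℝ} (hf : ContDiff ℝ 1 (fun p : ℝ × V2 => f p.1 p.2)) (i : Fin 2) :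
    Continuous (fun p : ℝ × V2 => pd i (f p.1) p.2) := by
  simp only [pd_uncurry hf]
  exact (hf.continuous_fderiv one_ne_zero).clm_apply continuous_const

lemma cont_dt {f : ℝ → V2 → ℝ} (hf : ContDiff ℝ 1 (fun p : ℝ × V2 => f p.1 p.2)) :
    Continuous (fun p : ℝ × V2 => dt f p.1 p.2) := by
  have : ∀ t x, dt f t x = fderiv ℝ (fun p : ℝ × V2 => f p.1 p.2) (t, x) (1, 0) :=
    fun t x => (hasDeriv_uncurry hf t x).deriv
  simp only [this]
  exact (hf.continuous_fderiv one_ne_zero).clm_apply continuous_const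

/-- double integrals of continuous functions over `Ω × Ω` -/
lemma dbl_yx {Ω : Set V2} (hb : IsBounded Ω) {K : V2 × V2 → ℝ} (hK : Continuous K) :
    ∫ p in Ω ×ˢ Ω, K p = ∫ y in Ω, ∫ x in Ω, K (x, y) := by
  have hI : IntegrableOn K (Ω ×ˢ Ω) (volume.prod volume) := cont_intOn (hb.prod hb) hK
  rw [Measure.volume_eq_prod, ← Measure.prod_restrict]
  rw [IntegrableOn, ← Measure.prod_restrict] at hI
  exact integral_prod_symm _ hI

lemma dbl_xy {Ω : Set V2} (hb : IsBounded Ω) {K : V2 × V2 → ℝ} (hK : Continuous K) :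
    ∫ p in Ω ×ˢ Ω, K p = ∫ x in Ω, ∫ y in Ω, K (x, y) := by
  have hI : IntegrableOn K (Ω ×ˢ Ω) (volume.prod volume) := cont_intOn (hb.prod hb) hK
  rw [Measure.volume_eq_prod, ← Measure.prod_restrict]
  rw [IntegrableOn, ← Measure.prod_restrict] at hI
  exact integral_prod _ hI

/-- swap of two interval integrals -/
lemma swap_int {h : ℝ → ℝ → ℝ} (hc : Continuous (fun p : ℝ × ℝ => h p.1 p.2)) {a b c d : ℝ}
    (hab : a ≤ b) (hcd : c ≤ d) :
    ∫ s in a..b, ∫ t in c..d, h s t = ∫ t in c..d, ∫ s in a..b, h s t := by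
  simp only [intervalIntegral.integral_of_le hab, intervalIntegral.integral_of_le hcd]
  apply integral_integral_swap
  have hI : IntegrableOn (fun p : ℝ × ℝ => h p.1 p.2) (Ioc a b ×ˢ Ioc c d) (volume.prod volume) :=
    cont_intOn ((Metric.isBounded_Ioc a b).prod (Metric.isBounded_Ioc c d)) hc
  rw [IntegrableOn, ← Measure.prod_restrict] at hI
  exact hI


end

section


/-- The equations at a fixed time, in a convenient form. -/
structure Slice (Ω : Set V2) (φ : V2 → ℝ) (γ μ Λ ν : ℝ) (ρ P rt Pt : V2 → ℝ) (u B mt Bt : V2 → V2) : Prop where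
  dom : Dom Ω φ
  cρ : ContDiff ℝ 1 ρ
  cP : ContDiff ℝ 1 P
  cu : ∀ i, ContDiff ℝ 2 (fun x => u x i)
  cB : ∀ i, ContDiff ℝ 2 (fun x => B x i)
  crt : Continuous rt
  cPt : Continuous Pt
  cmt : ∀ i, Continuous (fun x => mt x i)
  cBt : ∀ i, Continuous (fun x => Bt x i)
  mass : ∀ x ∈ Ω, rt x = - div2 (fun y j => ρ y * u y j) x
  pres : ∀ x ∈ Ω, Pt x = - div2 (fun y j => P y * u y j) x - (γ - 1) * (P x * div2 u x)
  mom0 : ∀ x ∈ Ω, mt x 0 = - (∑ j, pd j (fun y => ρ y * u y 0 * u y j) x) - pd 0 P x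
    + Λ * pd 0 (div2 u) x - μ * pd 1 (curl2 u) x - curl2 B x * B x 1
  mom1 : ∀ x ∈ Ω, mt x 1 = - (∑ j, pd j (fun y => ρ y * u y 1 * u y j) x) - pd 1 P x
    + Λ * pd 1 (div2 u) x + μ * pd 0 (curl2 u) x + curl2 B x * B x 0
  mag0 : ∀ x ∈ Ω, Bt x 0 = pd 1 (fun y => u y 0 * B y 1 - u y 1 * B y 0 - ν * curl2 B y) x
  mag1 : ∀ x ∈ Ω, Bt x 1 = - pd 0 (fun y => u y 0 * B y 1 - u y 1 * B y 0 - ν * curl2 B y) x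
  divB : ∀ x ∈ Ω, div2 B x = 0
  su : ∀ x ∈ frontier Ω, dot (u x) (grad φ x) = 0
  sω : ∀ x ∈ frontier Ω, curl2 u x = 0
  sB : ∀ x ∈ frontier Ω, dot (B x) (grad φ x) = 0
  sJ : ∀ x ∈ frontier Ω, curl2 B x = 0

lemma contDiff_div2 {u : V2 → V2} (hu : ∀ i, ContDiff ℝ 2 (fun x => u x i)) : ContDiff ℝ 1 (div2 u) := by
  have : div2 u = fun x => pd 0 (fun y => u y 0) x + pd 1 (fun y => u y 1) x := by
    ext x; simp [div2]
  rw [this]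
  exact (contDiff_pd2 (hu 0)).add (contDiff_pd2 (hu 1))

lemma contDiff_curl2 {u : V2 → V2} (hu : ∀ i, ContDiff ℝ 2 (fun x => u x i)) : ContDiff ℝ 1 (curl2 u) := by
  have : curl2 u = fun x => pd 0 (fun y => u y 1) x - pd 1 (fun y => u y 0) x := by
    ext x; simp [curl2]
  rw [this]
  exact (contDiff_pd2 (hu 1)).sub (contDiff_pd2 (hu 0))

lemma Slice.energy {Ω : Set V2} {φ : V2 → ℝ} {γ μ Λ ν : ℝ} (hγ : 1 < γ) {ρ P rt Pt : V2 → ℝ} {u B mt Bt : V2 → V2}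
    (S : Slice Ω φ γ μ Λ ν ρ P rt Pt u B mt Bt) :
    ∫ x in Ω, (mt x 0 * u x 0 + mt x 1 * u x 1 - rt x * nsq (u x) / 2 + Bt x 0 * B x 0 + Bt x 1 * B x 1
      + Pt x / (γ - 1)) = - ∫ x in Ω, (Λ * div2 u x ^ 2 + μ * curl2 u x ^ 2 + ν * curl2 B x ^ 2) := by
  have c1u : ∀ i, ContDiff ℝ 1 (fun x => u x i) := fun i => (S.cu i).of_le one_le_two
  have c1B : ∀ i, ContDiff ℝ 1 (fun x => B x i) := fun i => (S.cB i).of_le one_le_two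
  have cD := contDiff_div2 S.cu
  have cω := contDiff_curl2 S.cu
  have cJ := contDiff_curl2 S.cB
  have cρ := S.cρ
  have cP := S.cP
  have u0 := c1u 0
  have u1 := c1u 1
  have B0 := c1B 0
  have B1 := c1B 1
  set X : V2 → ℝ := fun y => u y 0 * B y 1 - u y 1 * B y 0 - ν * curl2 B y with hX
  have cX : ContDiff ℝ 1 X := by rw [hX]; fun_prop
  set W0 : V2 → ℝ := fun y => (-1/2) * (ρ y * (u y 0 * u y 0 + u y 1 * u y 1) * u y 0) + (-(γ/(γ-1))) * (P y * u y 0)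
    + Λ * (div2 u y * u y 0) + μ * (curl2 u y * u y 1) + (-1) * (B y 1 * X y) with hW0
  set W1 : V2 → ℝ := fun y => (-1/2) * (ρ y * (u y 0 * u y 0 + u y 1 * u y 1) * u y 1) + (-(γ/(γ-1))) * (P y * u y 1)
    + Λ * (div2 u y * u y 1) + (-μ) * (curl2 u y * u y 0) + (B y 0 * X y) with hW1
  have cW0 : ContDiff ℝ 1 W0 := by rw [hW0]; fun_prop
  have cW1 : ContDiff ℝ 1 W1 := by rw [hW1]; fun_prop
  set W : V2 → V2 := fun y => ![W0 y, W1 y] with hW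
  have key := S.dom.div_zero (w := W) (by
    intro i; fin_cases i
    · simpa [hW] using cW0
    · simpa [hW] using cW1) (by
    intro x hx
    have h1 := S.su x hx
    have h2 := S.sω x hx
    have h3 := S.sB x hx
    have h4 := S.sJ x hx
    have hg := S.dom.gr x hx
    simp only [dot, Fin.sum_univ_two] at h1 h3
    have hcr : X x = 0 := by
      simp only [hX, h4, mul_zero, sub_zero]
      by_contra hne
      apply hg
      have e0 : (u x 0 * B x 1 - u x 1 * B x 0) * grad φ x 0 = 0 := by linear_combination B x 1 * h1 - u x 1 * h3
      have e1 : (u x 0 * B x 1 - u x 1 * B x 0) * grad φ x 1 = 0 := by linear_combination - B x 0 * h1 + u x 0 * h3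
      ext i; fin_cases i
      · exact (mul_eq_zero.1 e0).resolve_left hne
      · exact (mul_eq_zero.1 e1).resolve_left hne
    simp only [dot, Fin.sum_univ_two, hW, Matrix.cons_val_zero, Matrix.cons_val_one, hW0, hW1, hcr, h2]
    linear_combination ((-1/2) * (ρ x * (u x 0 * u x 0 + u x 1 * u x 1)) + (-(γ/(γ-1))) * P x + Λ * div2 u x) * h1)
  have pw : ∀ x ∈ Ω, div2 W x = (mt x 0 * u x 0 + mt x 1 * u x 1 - rt x * nsq (u x) / 2 + Bt x 0 * B x 0 + Bt x 1 * B x 1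
      + Pt x / (γ - 1)) + (Λ * div2 u x ^ 2 + μ * curl2 u x ^ 2 + ν * curl2 B x ^ 2) := by
    intro x hx
    rw [S.mass x hx, S.pres x hx, S.mom0 x hx, S.mom1 x hx, S.mag0 x hx, S.mag1 x hx]
    have dD := cD.differentiable one_ne_zero
    have dω := cω.differentiable one_ne_zero
    have dJ := cJ.differentiable one_ne_zero
    have dX := cX.differentiable one_ne_zero
    have dρ := cρ.differentiable one_ne_zero
    have dP := cP.differentiable one_ne_zero
    have du0 := u0.differentiable one_ne_zero
    have du1 := u1.differentiable one_ne_zero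
    have dB0 := B0.differentiable one_ne_zero
    have dB1 := B1.differentiable one_ne_zero
    have eD : div2 u x = pd 0 (fun y => u y 0) x + pd 1 (fun y => u y 1) x := by simp [div2]
    have eω : curl2 u x = pd 0 (fun y => u y 1) x - pd 1 (fun y => u y 0) x := rfl
    have eJ : curl2 B x = pd 0 (fun y => B y 1) x - pd 1 (fun y => B y 0) x := rfl
    have eX : X x = u x 0 * B x 1 - u x 1 * B x 0 - ν * curl2 B x := rfl
    have hWd : div2 W x = pd 0 W0 x + pd 1 W1 x := by simp [div2, hW]
    have f0 : (fun y => (fun y (j : Fin 2) => ρ y * u y j) y 0) = fun y => ρ y * u y 0 := rfl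
    rw [hWd]
    change pd 0 (fun y => (-1/2) * (ρ y * (u y 0 * u y 0 + u y 1 * u y 1) * u y 0) + (-(γ/(γ-1))) * (P y * u y 0)
      + Λ * (div2 u y * u y 0) + μ * (curl2 u y * u y 1) + (-1) * (B y 1 * X y)) x
      + pd 1 (fun y => (-1/2) * (ρ y * (u y 0 * u y 0 + u y 1 * u y 1) * u y 1) + (-(γ/(γ-1))) * (P y * u y 1)
      + Λ * (div2 u y * u y 1) + (-μ) * (curl2 u y * u y 0) + (B y 0 * X y)) x = _
    have hd1 : ∀ v : V2 → ℝ, div2 (fun y j => v y * u y j) x = pd 0 (fun y => v y * u y 0) x + pd 1 (fun y => v y * u y 1) x := by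
      intro v; simp [div2]
    rw [hd1, hd1]
    simp only [Fin.sum_univ_two, nsq]
    change _ = ((- (_ + _) - _ + _ - _ - _) * _ + _ - _ + pd 1 X x * _ + (- pd 0 X x) * _ + _ ) + _
    clear_value X
    simp (disch := fun_prop) only [pd_add, pd_mul, pd_const]
    rw [eX]
    have hg1 : γ - 1 ≠ 0 := by linarith
    generalize div2 u x = D at *
    generalize curl2 u x = w at *
    generalize curl2 B x = J at *
    generalize pd 0 (fun y => u y 0) x = a00 at *
    generalize pd 1 (fun y => u y 0) x = a01 at *
    generalize pd 0 (fun y => u y 1) x = a10 at *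
    generalize pd 1 (fun y => u y 1) x = a11 at *
    generalize pd 1 (fun y => B y 0) x = b01 at *
    generalize pd 0 (fun y => B y 1) x = b10 at *
    subst eD eω
    have eb : b10 = J + b01 := by linarith
    subst eb
    field_simp
    ring
  rw [setIntegral_congr_fun S.dom.meas pw] at key
  have hcu : ∀ i, Continuous (fun x => u x i) := fun i => (c1u i).continuous
  have hcB : ∀ i, Continuous (fun x => B x i) := fun i => (c1B i).continuous
  have u0c := hcu 0
  have u1c := hcu 1
  have B0c := hcB 0
  have B1c := hcB 1
  have m0 := S.cmt 0
  have m1 := S.cmt 1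
  have b0 := S.cBt 0
  have b1 := S.cBt 1
  have r := S.crt
  have p := S.cPt
  have dc := cD.continuous
  have wc := cω.continuous
  have jc := cJ.continuous
  rw [integral_add (cont_intOn S.dom.bdd (by unfold nsq; simp only [Fin.sum_univ_two]; fun_prop))
    (cont_intOn S.dom.bdd (by fun_prop))] at key
  linarith

end

section


lemma Slice.weak_mom {Ω : Set V2} {φ : V2 → ℝ} {γ μ Λ ν : ℝ} {ρ P rt Pt : V2 → ℝ} {u B mt Bt : V2 → V2}
    (S : Slice Ω φ γ μ Λ ν ρ P rt Pt u B mt Bt) (c : ℝ) {p0 p1 : V2 → ℝ} (h0 : ContDiff ℝ 1 p0) (h1 : ContDiff ℝ 1 p1)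
    (b0 : ∀ x ∈ frontier Ω, p0 x = 0) (b1 : ∀ x ∈ frontier Ω, p1 x = 0) :
    ∫ x in Ω, (mt x 0 * p0 x + mt x 1 * p1 x) =
      ∫ x in Ω, (ρ x * u x 0 * (u x 0 * pd 0 p0 x + u x 1 * pd 1 p0 x) + ρ x * u x 1 * (u x 0 * pd 0 p1 x + u x 1 * pd 1 p1 x)
        + (P x - c - Λ * div2 u x) * (pd 0 p0 x + pd 1 p1 x) - μ * curl2 u x * (pd 0 p1 x - pd 1 p0 x)
        + curl2 B x * (B x 0 * p1 x - B x 1 * p0 x)) := by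
  have c1u : ∀ i, ContDiff ℝ 1 (fun x => u x i) := fun i => (S.cu i).of_le one_le_two
  have c1B : ∀ i, ContDiff ℝ 1 (fun x => B x i) := fun i => (S.cB i).of_le one_le_two
  have cD := contDiff_div2 S.cu
  have cω := contDiff_curl2 S.cu
  have cJ := contDiff_curl2 S.cB
  have cρ := S.cρ
  have cP := S.cP
  have u0 := c1u 0
  have u1 := c1u 1
  have B0 := c1B 0
  have B1 := c1B 1
  set W0 : V2 → ℝ := fun y => (-1) * (ρ y * u y 0 * u y 0 * p0 y + ρ y * u y 1 * u y 0 * p1 y)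
    + (-1) * ((P y - c - Λ * div2 u y) * p0 y) + μ * (curl2 u y * p1 y) with hW0
  set W1 : V2 → ℝ := fun y => (-1) * (ρ y * u y 0 * u y 1 * p0 y + ρ y * u y 1 * u y 1 * p1 y)
    + (-1) * ((P y - c - Λ * div2 u y) * p1 y) + (-μ) * (curl2 u y * p0 y) with hW1
  have cW0 : ContDiff ℝ 1 W0 := by rw [hW0]; fun_prop
  have cW1 : ContDiff ℝ 1 W1 := by rw [hW1]; fun_prop
  set W : V2 → V2 := fun y => ![W0 y, W1 y] with hW
  have key := S.dom.div_zero (w := W) (by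
    intro i; fin_cases i
    · simpa [hW] using cW0
    · simpa [hW] using cW1) (by
    intro x hx
    simp only [dot, Fin.sum_univ_two, hW, Matrix.cons_val_zero, Matrix.cons_val_one, hW0, hW1, b0 x hx, b1 x hx]
    ring)
  have dD := cD.differentiable one_ne_zero
  have dω := cω.differentiable one_ne_zero
  have dJ := cJ.differentiable one_ne_zero
  have dρ := cρ.differentiable one_ne_zero
  have dP := cP.differentiable one_ne_zero
  have du0 := u0.differentiable one_ne_zero
  have du1 := u1.differentiable one_ne_zero
  have d0 := h0.differentiable one_ne_zero
  have d1 := h1.differentiable one_ne_zero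
  have pw : ∀ x ∈ Ω, div2 W x = (mt x 0 * p0 x + mt x 1 * p1 x) -
      (ρ x * u x 0 * (u x 0 * pd 0 p0 x + u x 1 * pd 1 p0 x) + ρ x * u x 1 * (u x 0 * pd 0 p1 x + u x 1 * pd 1 p1 x)
        + (P x - c - Λ * div2 u x) * (pd 0 p0 x + pd 1 p1 x) - μ * curl2 u x * (pd 0 p1 x - pd 1 p0 x)
        + curl2 B x * (B x 0 * p1 x - B x 1 * p0 x)) := by
    intro x hx
    rw [S.mom0 x hx, S.mom1 x hx]
    have hWd : div2 W x = pd 0 W0 x + pd 1 W1 x := by simp [div2, hW]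
    rw [hWd]
    change pd 0 (fun y => (-1) * (ρ y * u y 0 * u y 0 * p0 y + ρ y * u y 1 * u y 0 * p1 y)
      + (-1) * ((P y - c - Λ * div2 u y) * p0 y) + μ * (curl2 u y * p1 y)) x
      + pd 1 (fun y => (-1) * (ρ y * u y 0 * u y 1 * p0 y + ρ y * u y 1 * u y 1 * p1 y)
      + (-1) * ((P y - c - Λ * div2 u y) * p1 y) + (-μ) * (curl2 u y * p0 y)) x = _
    simp only [Fin.sum_univ_two]
    simp (disch := fun_prop) only [pd_add, pd_sub, pd_mul, pd_const]
    ring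
  rw [setIntegral_congr_fun S.dom.meas pw] at key
  have m0 := S.cmt 0
  have m1 := S.cmt 1
  have q00 := continuous_pd (i := 0) h0
  have q01 := continuous_pd (i := 1) h0
  have q10 := continuous_pd (i := 0) h1
  have q11 := continuous_pd (i := 1) h1
  have u0c := u0.continuous
  have u1c := u1.continuous
  have B0c := B0.continuous
  have B1c := B1.continuous
  have dc := cD.continuous
  have wc := cω.continuous
  have jc := cJ.continuous
  have rc := cρ.continuous
  have pc := cP.continuous
  have h0c := h0.continuous
  have h1c := h1.continuous
  rw [integral_sub (cont_intOn S.dom.bdd (by fun_prop))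
    (cont_intOn S.dom.bdd (by fun_prop))] at key
  linarith

lemma Slice.weak_pres {Ω : Set V2} {φ : V2 → ℝ} {γ μ Λ ν : ℝ} {ρ P rt Pt : V2 → ℝ} {u B mt Bt : V2 → V2}
    (S : Slice Ω φ γ μ Λ ν ρ P rt Pt u B mt Bt) (c c' : ℝ) {η : V2 → ℝ} (hη : ContDiff ℝ 1 η) :
    ∫ x in Ω, (Pt x - c') * η x =
      ∫ x in Ω, ((P x - c) * (u x 0 * pd 0 η x + u x 1 * pd 1 η x)
        - (c * div2 u x + (γ - 1) * (P x * div2 u x) + c') * η x) := by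
  have c1u : ∀ i, ContDiff ℝ 1 (fun x => u x i) := fun i => (S.cu i).of_le one_le_two
  have cD := contDiff_div2 S.cu
  have cP := S.cP
  have u0 := c1u 0
  have u1 := c1u 1
  set W : V2 → V2 := fun y j => (-1) * ((P y - c) * u y j * η y) with hW
  have key := S.dom.div_zero (w := W) (by
    intro i
    have := c1u i
    simp only [hW]; fun_prop) (by
    intro x hx
    have := S.su x hx
    simp only [dot, Fin.sum_univ_two, hW] at this ⊢
    linear_combination (-1) * (P x - c) * η x * this)
  have dP := cP.differentiable one_ne_zero
  have du0 := u0.differentiable one_ne_zero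
  have du1 := u1.differentiable one_ne_zero
  have d0 := hη.differentiable one_ne_zero
  have pw : ∀ x ∈ Ω, div2 W x = (Pt x - c') * η x - 
      ((P x - c) * (u x 0 * pd 0 η x + u x 1 * pd 1 η x)
        - (c * div2 u x + (γ - 1) * (P x * div2 u x) + c') * η x) := by
    intro x hx
    rw [S.pres x hx]
    simp only [div2, Fin.sum_univ_two, hW]
    simp (disch := fun_prop) only [pd_add, pd_sub, pd_mul, pd_const]
    ring
  rw [setIntegral_congr_fun S.dom.meas pw] at key
  have q00 := continuous_pd (i := 0) hη
  have q01 := continuous_pd (i := 1) hη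
  have u0c := u0.continuous
  have u1c := u1.continuous
  have dc := cD.continuous
  have pc := cP.continuous
  have h0c := hη.continuous
  have ptc := S.cPt
  rw [integral_sub (cont_intOn S.dom.bdd (by fun_prop))
    (cont_intOn S.dom.bdd (by fun_prop))] at key
  linarith

/-- The regularizing kernel. -/
structure Ker (Ω : Set V2) (w : V2 → ℝ) (x0 : V2) (R Cw : ℝ) : Prop where
  smooth : ContDiff ℝ (⊤ : ℕ∞) w
  cs : HasCompactSupport w
  supp : tsupport w ⊆ Ω
  int1 : ∫ z in Ω, w z = 1
  rad : ∀ z, (z 1 - x0 1) * pd 0 w z - (z 0 - x0 0) * pd 1 w z = 0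
  bd : ∀ z, |w z| ≤ Cw
  bd' : ∀ j z, |pd j w z| ≤ Cw
  Cpos : 0 ≤ Cw
  Rpos : 0 < R
  diam : ∀ x ∈ Ω, ∀ y ∈ Ω, ‖x - y‖ ≤ R

lemma Ker.zero {Ω : Set V2} {w : V2 → ℝ} {x0 : V2} {R Cw : ℝ} (K : Ker Ω w x0 R Cw) {z : V2} (hz : z ∉ Ω) :
    w z = 0 := image_eq_zero_of_notMem_tsupport fun h => hz (K.supp h)

lemma Ker.zero' {Ω : Set V2} {w : V2 → ℝ} {x0 : V2} {R Cw : ℝ} (K : Ker Ω w x0 R Cw) {z : V2} (hz : z ∉ Ω) (j : Fin 2) :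
    pd j w z = 0 := by
  have : fderiv ℝ w z = 0 := by
    by_contra h
    exact hz (K.supp (support_fderiv_subset ℝ h))
  unfold pd; rw [this]; rfl

lemma exists_ker {Ω : Set V2} {φ : V2 → ℝ} (D : Dom Ω φ) : ∃ w x0 R Cw, Ker Ω w x0 R Cw := by
  obtain ⟨x0, hx0⟩ := D.ne
  obtain ⟨r, hr, hball⟩ := Metric.isOpen_iff.1 D.isOpen x0 hx0
  set r2 := r / 2 with hr2
  have hr2p : 0 < r2 := by positivity
  set θ : V2 → ℝ := fun z => 1 - ((z 0 - x0 0) ^ 2 + (z 1 - x0 1) ^ 2) / r2 ^ 2 with hθ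
  have cθ : ContDiff ℝ (⊤ : ℕ∞) θ := by rw [hθ]; fun_prop
  set v : V2 → ℝ := fun z => Real.smoothTransition (θ z) with hv
  have cv : ContDiff ℝ (⊤ : ℕ∞) v := Real.smoothTransition.contDiff.comp cθ
  have sv : ∀ z, v z ≠ 0 → z ∈ Metric.closedBall x0 r2 := by
    intro z hz
    have h1 : 0 < θ z := by
      by_contra h
      exact hz (Real.smoothTransition.zero_of_nonpos (not_lt.1 h))
    have h2 : (z 0 - x0 0) ^ 2 + (z 1 - x0 1) ^ 2 < r2 ^ 2 := by
      simp only [hθ] at h1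
      have : ((z 0 - x0 0) ^ 2 + (z 1 - x0 1) ^ 2) / r2 ^ 2 < 1 := by linarith
      rwa [div_lt_one (by positivity)] at this
    rw [mem_closedBall_iff_norm, pi_norm_le_iff_of_nonneg hr2p.le]
    intro i
    simp only [Pi.sub_apply, Real.norm_eq_abs]
    apply abs_le_of_sq_le_sq _ hr2p.le
    fin_cases i
    · have := sq_nonneg (z 1 - x0 1); simp only [Fin.zero_eta]; linarith
    · have := sq_nonneg (z 0 - x0 0); simp only [Fin.mk_one]; linarith
  have tv : tsupport v ⊆ Metric.closedBall x0 r2 :=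
    closure_minimal sv Metric.isClosed_closedBall
  have hcb : Metric.closedBall x0 r2 ⊆ Ω :=
    (Metric.closedBall_subset_ball (by rw [hr2]; linarith)).trans hball
  have cs : HasCompactSupport v := HasCompactSupport.of_support_subset_isCompact (isCompact_closedBall x0 r2) sv
  have v0 : v x0 = 1 := by simp [hv, hθ, Real.smoothTransition.one]
  have pos : 0 < ∫ z, v z := cv.continuous.integral_pos_of_hasCompactSupport_nonneg_nonzero cs
    (fun z => Real.smoothTransition.nonneg _) (x := x0) (by rw [v0]; exact one_ne_zero)
  have posΩ : ∫ z in Ω, v z = ∫ z, v z := setIntegral_eq_integral_of_forall_compl_eq_zero (fun z hz => by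
    by_contra h; exact hz (hcb (sv z h)))
  set c := (∫ z, v z)⁻¹ with hc
  set w : V2 → ℝ := fun z => c * v z with hw
  have cw : ContDiff ℝ (⊤ : ℕ∞) w := contDiff_const.mul cv
  have csw : HasCompactSupport w := cs.mul_left
  obtain ⟨C1, hC1⟩ := csw.exists_bound_of_continuous cw.continuous
  have hpd : ∀ j : Fin 2, ∃ C, ∀ z, ‖pd j w z‖ ≤ C := by
    intro j
    have h1 : HasCompactSupport (pd j w) := by
      have := csw.fderiv_apply ℝ (Pi.single j 1)
      exact this
    exact h1.exists_bound_of_continuous (continuous_pd (cw.of_le top_le1))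
  choose C2 hC2 using hpd
  obtain ⟨R, hR⟩ := D.bdd.exists_norm_le
  have hR0 : 0 ≤ R := (norm_nonneg _).trans (hR x0 hx0)
  refine ⟨w, x0, 2 * R + 1, max C1 (max (C2 0) (C2 1)), ⟨cw, csw, ?_, ?_, ?_, ?_, ?_, ?_, ?_, ?_⟩⟩
  · refine (closure_mono ?_).trans (tv.trans hcb)
    intro z hz
    exact fun h => hz (by simp [hw, h])
  · simp only [hw]
    rw [integral_const_mul, posΩ, hc, inv_mul_cancel₀ pos.ne']
  · intro z
    have e : ∀ j, pd j w z = c * (deriv Real.smoothTransition (θ z) * (-(2 * (z j - x0 j)) / r2 ^ 2)) := by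
      intro j
      have d1 : DifferentiableAt ℝ v z := cv.contDiffAt.differentiableAt (by simp)
      have d2 : DifferentiableAt ℝ θ z := cθ.contDiffAt.differentiableAt (by simp)
      have d3 : DifferentiableAt ℝ Real.smoothTransition (θ z) :=
        (Real.smoothTransition.contDiff (n := 1)).contDiffAt.differentiableAt (by simp)
      rw [hw, pd_const_mul d1, hv, pd_comp d3 d2]
      congr 2
      have hθ' : θ = fun z => 1 - (r2 ^ 2)⁻¹ * ((z 0 - x0 0) * (z 0 - x0 0) + (z 1 - x0 1) * (z 1 - x0 1)) := by
        ext z; simp only [hθ]; field_simp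
      rw [hθ']
      simp (disch := fun_prop) only [pd_add, pd_sub, pd_mul, pd_const, pd_coord]
      fin_cases j <;> simp <;> field_simp <;> ring
    rw [e, e]; ring
  · exact fun z => (hC1 z).trans (le_max_left _ _)
  · intro j z
    refine (hC2 j z).trans (le_trans ?_ (le_max_right _ _))
    fin_cases j
    · exact le_max_left _ _
    · exact le_max_right _ _
  · exact ((norm_nonneg _).trans (hC1 x0)).trans (le_max_left _ _)
  · linarith
  · intro x hx y hy
    have := norm_sub_le x y
    have := hR x hx
    have := hR y hy
    linarith

end

section
set_option linter.unusedSimpArgs false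

/-- The moving point. -/
def zz (s : ℝ) (p : V2 × V2) : V2 := s • p.1 - (s - 1) • p.2

/-- The test kernel. -/
def Phi (w : V2 → ℝ) (s : ℝ) (i : Fin 2) (p : V2 × V2) : ℝ := s * (p.1 i - p.2 i) * w (zz s p)

/-- Divergence of the kernel in `x`. -/
def dPhi (w : V2 → ℝ) (s : ℝ) (p : V2 × V2) : ℝ :=
  2 * s * w (zz s p) + s ^ 2 * ((p.1 0 - p.2 0) * pd 0 w (zz s p) + (p.1 1 - p.2 1) * pd 1 w (zz s p))

/-- Curl of the kernel in `x`. -/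
def cPhi (w : V2 → ℝ) (s : ℝ) (p : V2 × V2) : ℝ :=
  s ^ 2 * ((p.1 1 - p.2 1) * pd 0 w (zz s p) - (p.1 0 - p.2 0) * pd 1 w (zz s p))

/-- Transport of the kernel. -/
def nPhi (w : V2 → ℝ) (u : V2 → V2) (s : ℝ) (i : Fin 2) (p : V2 × V2) : ℝ :=
  s * w (zz s p) * (u p.1 i - u p.2 i) + s * (p.1 i - p.2 i) *
    ((s * u p.1 0 - (s - 1) * u p.2 0) * pd 0 w (zz s p) + (s * u p.1 1 - (s - 1) * u p.2 1) * pd 1 w (zz s p))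

lemma pd_affine {w : V2 → ℝ} (hw : Differentiable ℝ w) (j : Fin 2) (a : ℝ) (b x : V2) :
    pd j (fun x => w (a • x + b)) x = a * pd j w (a • x + b) := by
  unfold pd
  have h1 : HasFDerivAt (fun x : V2 => a • x + b) (a • ContinuousLinearMap.id ℝ V2) x :=
    ((hasFDerivAt_id x).const_smul a).add_const b
  have h2 := (hw (a • x + b)).hasFDerivAt.comp x h1
  have h3 : fderiv ℝ (fun x => w (a • x + b)) x = (fderiv ℝ w (a • x + b)).comp (a • ContinuousLinearMap.id ℝ V2) := h2.fderiv
  rw [h3]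
  simp

lemma pd_wx {w : V2 → ℝ} (hw : Differentiable ℝ w) (j : Fin 2) (s : ℝ) (x y : V2) :
    pd j (fun x => w (zz s (x, y))) x = s * pd j w (zz s (x, y)) := by
  have := pd_affine hw j s (-((s - 1) • y)) x
  simpa only [zz, sub_eq_add_neg] using this

lemma pd_wy {w : V2 → ℝ} (hw : Differentiable ℝ w) (j : Fin 2) (s : ℝ) (x y : V2) :
    pd j (fun y => w (zz s (x, y))) y = -(s - 1) * pd j w (zz s (x, y)) := by
  have := pd_affine hw j (-(s - 1)) (s • x) y
  have e : ∀ y : V2, zz s (x, y) = (-(s - 1)) • y + s • x := by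
    intro y; simp only [zz]; module
  simp only [e]; exact this

lemma pd_Phi_x {w : V2 → ℝ} (hw : ContDiff ℝ (⊤ : ℕ∞) w) (i j : Fin 2) (s : ℝ) (x y : V2) :
    pd j (fun x => Phi w s i (x, y)) x = (if i = j then 1 else 0) * (s * w (zz s (x, y)))
      + s * (x i - y i) * (s * pd j w (zz s (x, y))) := by
  have hd : Differentiable ℝ w := hw.differentiable (by simp)
  have h2 : Differentiable ℝ (fun x : V2 => w (zz s (x, y))) := by unfold zz; fun_prop
  have key : ∀ g : V2 → ℝ, Differentiable ℝ g → pd j (fun x => s * (x i - y i) * g x) x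
      = (if i = j then 1 else 0) * (s * g x) + s * (x i - y i) * pd j g x := by
    intro g hg
    simp (disch := fun_prop) only [pd_add, pd_sub, pd_mul, pd_const, pd_coord]
    ring
  refine (key _ h2).trans ?_
  rw [pd_wx hd]

lemma pd_Phi_y {w : V2 → ℝ} (hw : ContDiff ℝ (⊤ : ℕ∞) w) (i j : Fin 2) (s : ℝ) (x y : V2) :
    pd j (fun y => Phi w s i (x, y)) y = -(if i = j then 1 else 0) * (s * w (zz s (x, y)))
      - s * (x i - y i) * ((s - 1) * pd j w (zz s (x, y))) := by
  have hd : Differentiable ℝ w := hw.differentiable (by simp)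
  have h2 : Differentiable ℝ (fun y : V2 => w (zz s (x, y))) := by unfold zz; fun_prop
  have key : ∀ g : V2 → ℝ, Differentiable ℝ g → pd j (fun y => s * (x i - y i) * g y) y
      = -(if i = j then 1 else 0) * (s * g y) + s * (x i - y i) * pd j g y := by
    intro g hg
    simp (disch := fun_prop) only [pd_add, pd_sub, pd_mul, pd_const, pd_coord]
    ring
  refine (key _ h2).trans ?_
  rw [pd_wy hd]
  ring

lemma contDiff_Phi_x {w : V2 → ℝ} (hw : ContDiff ℝ (⊤ : ℕ∞) w) (i : Fin 2) (s : ℝ) (y : V2) :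
    ContDiff ℝ 1 (fun x => Phi w s i (x, y)) := by
  have := hw.of_le top_le1
  unfold Phi zz; fun_prop

lemma contDiff_Phi_y {w : V2 → ℝ} (hw : ContDiff ℝ (⊤ : ℕ∞) w) (i : Fin 2) (s : ℝ) (x : V2) :
    ContDiff ℝ 1 (fun y => Phi w s i (x, y)) := by
  have := hw.of_le top_le1
  unfold Phi zz; fun_prop

lemma cont_zz : Continuous (fun p : ℝ × (V2 × V2) => zz p.1 p.2) := by unfold zz; fun_prop

lemma cont_zz' (s : ℝ) : Continuous (zz s) := by unfold zz; fun_prop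

lemma cont_Phi {w : V2 → ℝ} (hw : Continuous w) (i : Fin 2) : Continuous (fun p : ℝ × (V2 × V2) => Phi w p.1 i p.2) := by
  have := cont_zz
  unfold Phi; fun_prop

lemma Phi_bdry {Ω : Set V2} {φ : V2 → ℝ} (D : Dom Ω φ) {w : V2 → ℝ} {x0 : V2} {R Cw : ℝ} (K : Ker Ω w x0 R Cw)
    {s : ℝ} (hs : 1 ≤ s) (i : Fin 2) {x y : V2} (hx : x ∈ frontier Ω) (hy : y ∈ Ω) : Phi w s i (x, y) = 0 := by
  have hz : zz s (x, y) ∉ Ω := by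
    intro hz
    have : x ∈ Ω := by
      have e : x = (1 / s) • zz s (x, y) + (1 - 1 / s) • y := by
        have : s ≠ 0 := by linarith
        simp only [zz, smul_sub, smul_smul]
        ext i; simp; field_simp; ring
      rw [e]
      exact D.conv hz hy (by positivity) (by rw [sub_nonneg, div_le_one (by linarith)]; exact hs) (by ring)
    exact (D.isOpen.frontier_eq ▸ hx).2 this
  simp [Phi, K.zero hz]

lemma Slice.ident {Ω : Set V2} {φ : V2 → ℝ} {γ μ Λ ν : ℝ} {ρ P rt Pt : V2 → ℝ} {u B mt Bt : V2 → V2}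
    (S : Slice Ω φ γ μ Λ ν ρ P rt Pt u B mt Bt) {w : V2 → ℝ} {x0 : V2} {R Cw : ℝ} (K : Ker Ω w x0 R Cw) (c c' : ℝ)
    {s : ℝ} (hs : 1 ≤ s) :
    ∫ p in Ω ×ˢ Ω, ((Pt p.2 - c') * (ρ p.1 * u p.1 0 * Phi w s 0 p + ρ p.1 * u p.1 1 * Phi w s 1 p)
      + (P p.2 - c) * (mt p.1 0 * Phi w s 0 p + mt p.1 1 * Phi w s 1 p))
    = (∫ p in Ω ×ˢ Ω, ((P p.2 - c) * (ρ p.1 * u p.1 0 * nPhi w u s 0 p + ρ p.1 * u p.1 1 * nPhi w u s 1 p)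
        - (c * div2 u p.2 + (γ - 1) * (P p.2 * div2 u p.2) + c') * (ρ p.1 * u p.1 0 * Phi w s 0 p + ρ p.1 * u p.1 1 * Phi w s 1 p)
        + (P p.2 - c) * (curl2 B p.1 * (B p.1 0 * Phi w s 1 p - B p.1 1 * Phi w s 0 p))))
      + (∫ p in Ω ×ˢ Ω, (P p.2 - c) * (P p.1 - c - Λ * div2 u p.1) * dPhi w s p)
      - μ * ∫ p in Ω ×ˢ Ω, (P p.2 - c) * curl2 u p.1 * cPhi w s p := by
  have hb := S.dom.bdd
  have hb2 : IsBounded (Ω ×ˢ Ω) := hb.prod hb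
  have hw := K.smooth
  have cw := hw.continuous
  have cw0 := continuous_pd (i := 0) (hw.of_le top_le1)
  have cw1 := continuous_pd (i := 1) (hw.of_le top_le1)
  have u0 := (S.cu 0).continuous
  have u1 := (S.cu 1).continuous
  have B0 := (S.cB 0).continuous
  have B1 := (S.cB 1).continuous
  have m0 := S.cmt 0
  have m1 := S.cmt 1
  have dc := (contDiff_div2 S.cu).continuous
  have wc := (contDiff_curl2 S.cu).continuous
  have jc := (contDiff_curl2 S.cB).continuous
  have rc := S.cρ.continuous
  have pc := S.cP.continuous
  have ptc := S.cPt
  have cz := cont_zz' s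
  have cF0 : Continuous (Phi w s 0) := by unfold Phi; fun_prop
  have cF1 : Continuous (Phi w s 1) := by unfold Phi; fun_prop
  have cD : Continuous (dPhi w s) := by unfold dPhi; fun_prop
  have cC : Continuous (cPhi w s) := by unfold cPhi; fun_prop
  have cN0 : Continuous (nPhi w u s 0) := by unfold nPhi; fun_prop
  have cN1 : Continuous (nPhi w u s 1) := by unfold nPhi; fun_prop
  -- first part
  have I1 : ∫ p in Ω ×ˢ Ω, (Pt p.2 - c') * (ρ p.1 * u p.1 0 * Phi w s 0 p + ρ p.1 * u p.1 1 * Phi w s 1 p)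
     = ∫ p in Ω ×ˢ Ω, ((P p.2 - c) *
        (ρ p.1 * u p.1 0 * (- (s * w (zz s p) * u p.2 0) - s * (p.1 0 - p.2 0) * (s - 1) * (u p.2 0 * pd 0 w (zz s p) + u p.2 1 * pd 1 w (zz s p)))
        + ρ p.1 * u p.1 1 * (- (s * w (zz s p) * u p.2 1) - s * (p.1 1 - p.2 1) * (s - 1) * (u p.2 0 * pd 0 w (zz s p) + u p.2 1 * pd 1 w (zz s p))))
        - (c * div2 u p.2 + (γ - 1) * (P p.2 * div2 u p.2) + c') * (ρ p.1 * u p.1 0 * Phi w s 0 p + ρ p.1 * u p.1 1 * Phi w s 1 p)) := by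
    rw [dbl_xy hb (by fun_prop), dbl_xy hb (by fun_prop)]
    congr 1; ext x
    have k0 := contDiff_Phi_y hw 0 s x
    have k1 := contDiff_Phi_y hw 1 s x
    have d0 := k0.differentiable one_ne_zero
    have d1 := k1.differentiable one_ne_zero
    have h := S.weak_pres c c' (η := fun y => ρ x * u x 0 * Phi w s 0 (x, y) + ρ x * u x 1 * Phi w s 1 (x, y)) (by fun_prop)
    refine h.trans ?_
    congr 1; ext y
    have key : ∀ (a b : ℝ) (g h : V2 → ℝ), Differentiable ℝ g → Differentiable ℝ h → ∀ j, pd j (fun y => a * g y + b * h y) y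
        = a * pd j g y + b * pd j h y := by
      intro a b g h hg hh j
      simp (disch := fun_prop) only [pd_add, pd_sub, pd_mul, pd_const]
      ring
    simp only [key _ _ _ _ d0 d1, pd_Phi_y hw, if_true, one_ne_zero, zero_ne_one, if_false]
    ring
  have I2 : ∫ p in Ω ×ˢ Ω, (P p.2 - c) * (mt p.1 0 * Phi w s 0 p + mt p.1 1 * Phi w s 1 p)
     = ∫ p in Ω ×ˢ Ω, (P p.2 - c) *
        (ρ p.1 * u p.1 0 * (s * w (zz s p) * u p.1 0 + s * (p.1 0 - p.2 0) * s * (u p.1 0 * pd 0 w (zz s p) + u p.1 1 * pd 1 w (zz s p)))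
        + ρ p.1 * u p.1 1 * (s * w (zz s p) * u p.1 1 + s * (p.1 1 - p.2 1) * s * (u p.1 0 * pd 0 w (zz s p) + u p.1 1 * pd 1 w (zz s p)))
        + (P p.1 - c - Λ * div2 u p.1) * dPhi w s p - μ * curl2 u p.1 * cPhi w s p
        + (curl2 B p.1 * (B p.1 0 * Phi w s 1 p - B p.1 1 * Phi w s 0 p))) := by
    rw [dbl_yx hb (by fun_prop), dbl_yx hb (by fun_prop)]
    refine setIntegral_congr_fun S.dom.meas fun y hy => ?_
    have h := S.weak_mom c (contDiff_Phi_x hw 0 s y) (contDiff_Phi_x hw 1 s y)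
      (fun x hx => Phi_bdry S.dom K hs 0 hx hy) (fun x hx => Phi_bdry S.dom K hs 1 hx hy)
    simp only
    rw [integral_const_mul, h, integral_const_mul]
    congr 2; ext x
    simp only [pd_Phi_x hw, dPhi, cPhi]
    simp
    ring
  rw [integral_add (cont_intOn hb2 (by fun_prop)) (cont_intOn hb2 (by fun_prop)), I1, I2,
    ← integral_add (cont_intOn hb2 (by fun_prop)) (cont_intOn hb2 (by fun_prop)), ← integral_const_mul,
    ← integral_add (cont_intOn hb2 (by fun_prop)) (cont_intOn hb2 (by fun_prop)),
    ← integral_sub (cont_intOn hb2 (by fun_prop)) (cont_intOn hb2 (by fun_prop))]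
  congr 1; ext p
  simp only [nPhi]
  ring


end

section
set_option linter.unusedSimpArgs false

/-- Pairs at distance at most `r`. -/
def Near (Ω : Set V2) (r : ℝ) : Set (V2 × V2) := (Ω ×ˢ Ω) ∩ {p | ‖p.1 - p.2‖ ≤ r}

lemma Near.meas {Ω : Set V2} {φ : V2 → ℝ} (D : Dom Ω φ) (r : ℝ) : MeasurableSet (Near Ω r) := by
  refine (D.meas.prod D.meas).inter (isClosed_le (f := fun p : V2 × V2 => ‖p.1 - p.2‖) ?_ continuous_const).measurableSet
  fun_prop

lemma Near.bdd {Ω : Set V2} {φ : V2 → ℝ} (D : Dom Ω φ) (r : ℝ) : IsBounded (Near Ω r) :=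
  (D.bdd.prod D.bdd).subset inter_subset_left

lemma near_lint {K : V2 → ENNReal} (hK : Measurable K) (r σ : ℝ) :
    ∫⁻ p : V2 × V2, (K (p.2 + σ • (p.1 - p.2)) * {h : V2 | ‖h‖ ≤ r}.indicator 1 (p.1 - p.2))
      = volume (Metric.closedBall (0:V2) r) * ∫⁻ y, K y := by
  have hm : MeasurableSet {h : V2 | ‖h‖ ≤ r} := (isClosed_le continuous_norm continuous_const).measurableSet
  have hI : Measurable ({h : V2 | ‖h‖ ≤ r}.indicator (1 : V2 → ENNReal)) := measurable_one.indicator hm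
  have h1 : Measurable (fun p : V2 × V2 => K (p.2 + σ • (p.1 - p.2)) * {h : V2 | ‖h‖ ≤ r}.indicator (1 : V2 → ENNReal) (p.1 - p.2)) := by
    refine (hK.comp ?_).mul (hI.comp ?_) <;> fun_prop
  have h2 : Measurable (fun p : V2 × V2 => K (p.1 + σ • p.2) * {h : V2 | ‖h‖ ≤ r}.indicator (1 : V2 → ENNReal) p.2) := by
    refine (hK.comp ?_).mul (hI.comp ?_) <;> fun_prop
  rw [Measure.volume_eq_prod, lintegral_prod_symm _ h1.aemeasurable]
  have e1 : ∀ y : V2, ∫⁻ x : V2, (K (y + σ • (x - y)) * {h : V2 | ‖h‖ ≤ r}.indicator 1 (x - y))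
      = ∫⁻ h : V2, (K (y + σ • h) * {h : V2 | ‖h‖ ≤ r}.indicator 1 h) := by
    intro y
    exact lintegral_sub_right_eq_self (fun h => K (y + σ • h) * {h : V2 | ‖h‖ ≤ r}.indicator 1 h) y
  simp only [e1]
  rw [lintegral_lintegral_swap h2.aemeasurable]
  have e2 : ∀ h : V2, ∫⁻ y : V2, (K (y + σ • h) * {h : V2 | ‖h‖ ≤ r}.indicator 1 h)
      = {h : V2 | ‖h‖ ≤ r}.indicator 1 h * ∫⁻ y, K y := by
    intro h
    have hm' : Measurable (fun y : V2 => K (y + σ • h)) := hK.comp (by fun_prop)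
    rw [lintegral_mul_const _ hm', lintegral_add_right_eq_self K, mul_comm]
  simp only [e2]
  rw [lintegral_mul_const _ hI, lintegral_indicator_one hm]
  congr 2
  ext h; simp

lemma near_avg {Ω : Set V2} {φ : V2 → ℝ} (D : Dom Ω φ) {k : V2 → ℝ} (hk : Continuous k) (h0 : ∀ x ∈ Ω, 0 ≤ k x)
    {r σ : ℝ} (hr : 0 ≤ r) (hσ : 0 ≤ σ) (hσ1 : σ ≤ 1) :
    ∫ p in Near Ω r, k (p.2 + σ • (p.1 - p.2)) ≤ (2 * r) ^ 2 * ∫ y in Ω, k y := by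
  have hin : ∀ p ∈ Near Ω r, p.2 + σ • (p.1 - p.2) ∈ Ω := by
    intro p hp
    have := D.conv hp.1.1 hp.1.2 hσ (sub_nonneg.2 hσ1) (by ring)
    convert this using 1
    module
  set K : V2 → ENNReal := Ω.indicator (fun x => ENNReal.ofReal (k x)) with hK
  have mK : Measurable K := (hk.measurable.ennreal_ofReal).indicator D.meas
  have L := near_lint mK r σ
  have hc : Continuous (fun p : V2 × V2 => k (p.2 + σ • (p.1 - p.2))) := by fun_prop
  rw [integral_eq_lintegral_of_nonneg_ae ((ae_restrict_iff' (Near.meas D r)).2 (Eventually.of_forall fun p hp => h0 _ (hin p hp)))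
    hc.aestronglyMeasurable,
    integral_eq_lintegral_of_nonneg_ae ((ae_restrict_iff' D.meas).2 (Eventually.of_forall h0)) hk.aestronglyMeasurable]
  have hv : volume (Metric.closedBall (0:V2) r) = ENNReal.ofReal ((2 * r) ^ 2) := by
    rw [Real.volume_pi_closedBall _ hr]; simp
  have hfin : ∫⁻ y, K y ≠ ⊤ := by
    rw [hK, lintegral_indicator D.meas]
    have := (cont_intOn (μ := volume) D.bdd hk).lintegral_lt_top
    exact this.ne
  have hle : ∫⁻ p in Near Ω r, ENNReal.ofReal (k (p.2 + σ • (p.1 - p.2))) ≤ ENNReal.ofReal ((2 * r) ^ 2) * ∫⁻ y, K y := by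
    rw [← hv, ← L, ← lintegral_indicator (Near.meas D r)]
    refine lintegral_mono fun p => ?_
    by_cases hp : p ∈ Near Ω r
    · have h2 : p.1 - p.2 ∈ {h : V2 | ‖h‖ ≤ r} := hp.2
      rw [indicator_of_mem hp, indicator_of_mem h2, hK, indicator_of_mem (hin p hp)]; simp
    · rw [indicator_of_notMem hp]; exact zero_le
  have := ENNReal.toReal_mono (ENNReal.mul_ne_top ENNReal.ofReal_ne_top hfin) hle
  rw [ENNReal.toReal_mul, ENNReal.toReal_ofReal (by positivity), hK, lintegral_indicator D.meas] at this
  exact this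

lemma near_x {Ω : Set V2} {φ : V2 → ℝ} (D : Dom Ω φ) {k : V2 → ℝ} (hk : Continuous k) (h0 : ∀ x ∈ Ω, 0 ≤ k x)
    {r : ℝ} (hr : 0 ≤ r) : ∫ p in Near Ω r, k p.1 ≤ (2 * r) ^ 2 * ∫ y in Ω, k y := by
  have := near_avg D hk h0 hr zero_le_one le_rfl
  simpa using this

lemma near_y {Ω : Set V2} {φ : V2 → ℝ} (D : Dom Ω φ) {k : V2 → ℝ} (hk : Continuous k) (h0 : ∀ x ∈ Ω, 0 ≤ k x)
    {r : ℝ} (hr : 0 ≤ r) : ∫ p in Near Ω r, k p.2 ≤ (2 * r) ^ 2 * ∫ y in Ω, k y := by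
  have := near_avg D hk h0 hr le_rfl zero_le_one
  simpa using this

lemma sq_int_le {g : ℝ → ℝ} (hg : Continuous g) : (∫ s in (0:ℝ)..1, g s) ^ 2 ≤ ∫ s in (0:ℝ)..1, g s ^ 2 := by
  set m := ∫ s in (0:ℝ)..1, g s with hm
  have h : 0 ≤ ∫ s in (0:ℝ)..1, (g s - m) ^ 2 := intervalIntegral.integral_nonneg zero_le_one fun s _ => sq_nonneg _
  have e : ∫ s in (0:ℝ)..1, (g s - m) ^ 2 = (∫ s in (0:ℝ)..1, g s ^ 2) - 2 * m * m + m ^ 2 := by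
    have : (fun s => (g s - m) ^ 2) = fun s => g s ^ 2 - 2 * m * g s + m ^ 2 := by ext s; ring
    rw [this, intervalIntegral.integral_add ((by fun_prop : Continuous _).intervalIntegrable _ _) (by simp),
      intervalIntegral.integral_sub ((by fun_prop : Continuous _).intervalIntegrable _ _)
        ((by fun_prop : Continuous _).intervalIntegrable _ _), intervalIntegral.integral_const_mul, ← hm]
    simp
  nlinarith

lemma near_diff {Ω : Set V2} {φ : V2 → ℝ} (D : Dom Ω φ) {v : V2 → ℝ} (hv : ContDiff ℝ 1 v)
    {r : ℝ} (hr : 0 ≤ r) : ∫ p in Near Ω r, (v p.1 - v p.2) ^ 2 ≤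
      8 * r ^ 4 * ∫ y in Ω, (pd 0 v y ^ 2 + pd 1 v y ^ 2) := by
  have c0 := continuous_pd (i := 0) hv
  have c1 := continuous_pd (i := 1) hv
  set k : V2 → ℝ := fun y => pd 0 v y ^ 2 + pd 1 v y ^ 2 with hk
  have ck : Continuous k := by rw [hk]; fun_prop
  have pw : ∀ p ∈ Near Ω r, (v p.1 - v p.2) ^ 2 ≤ ∫ σ in Ioc (0:ℝ) 1, 2 * r ^ 2 * k (p.2 + σ • (p.1 - p.2)) := by
    intro p hp
    have hf : ∀ σ : ℝ, fderiv ℝ v (p.2 + σ • (p.1 - p.2)) (p.1 - p.2)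
      = (p.1 0 - p.2 0) * pd 0 v (p.2 + σ • (p.1 - p.2)) + (p.1 1 - p.2 1) * pd 1 v (p.2 + σ • (p.1 - p.2)) := by
      intro σ
      rw [fderiv_eq_sum]; simp [Fin.sum_univ_two, mul_comm]
    have e := ftc (fun σ => line_deriv hv p.2 (p.1 - p.2) σ) (by simp only [hf]; fun_prop) 0 1
    simp only [one_smul, zero_smul, add_zero, add_sub_cancel] at e
    rw [← e, ← intervalIntegral.integral_of_le zero_le_one]
    refine (sq_int_le (by simp only [hf]; fun_prop)).trans ?_
    refine intervalIntegral.integral_mono_on zero_le_one ((by simp only [hf]; fun_prop : Continuous _).intervalIntegrable _ _)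
      ((by fun_prop : Continuous _).intervalIntegrable _ _) fun σ _ => ?_
    rw [hf]
    have hn : ∀ i, (p.1 i - p.2 i) ^ 2 ≤ r ^ 2 := by
      intro i
      have h1 := (norm_le_pi_norm (p.1 - p.2) i).trans hp.2
      rw [Pi.sub_apply, Real.norm_eq_abs] at h1
      rw [← sq_abs]; gcongr
    have h0 := hn 0
    have h1 := hn 1
    simp only [hk]
    set A := p.1 0 - p.2 0
    set A' := p.1 1 - p.2 1
    set b := pd 0 v (p.2 + σ • (p.1 - p.2))
    set b' := pd 1 v (p.2 + σ • (p.1 - p.2))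
    nlinarith [sq_nonneg (A * b - A' * b'), mul_le_mul_of_nonneg_right h0 (sq_nonneg b), mul_le_mul_of_nonneg_right h1 (sq_nonneg b'),
      mul_nonneg (sq_nonneg r) (sq_nonneg b), mul_nonneg (sq_nonneg r) (sq_nonneg b')]
  have hb := Near.bdd D r
  have hm := Near.meas D r
  have hvc := hv.continuous
  have hcc : Continuous (fun q : (V2 × V2) × ℝ => 2 * r ^ 2 * k (q.1.2 + q.2 • (q.1.1 - q.1.2))) := by fun_prop
  calc _ ≤ ∫ p in Near Ω r, ∫ σ in Ioc (0:ℝ) 1, 2 * r ^ 2 * k (p.2 + σ • (p.1 - p.2)) := by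
        refine setIntegral_mono_on (cont_intOn hb (by fun_prop)) (cont_intOn hb ?_) hm pw
        exact cont_param (Metric.isBounded_Ioc 0 1) hcc
    _ = ∫ σ in Ioc (0:ℝ) 1, ∫ p in Near Ω r, 2 * r ^ 2 * k (p.2 + σ • (p.1 - p.2)) := by
        apply integral_integral_swap
        have hI : IntegrableOn (fun q : (V2 × V2) × ℝ => 2 * r ^ 2 * k (q.1.2 + q.2 • (q.1.1 - q.1.2))) (Near Ω r ×ˢ Ioc (0:ℝ) 1) (volume.prod volume) :=
          cont_intOn (hb.prod (Metric.isBounded_Ioc 0 1)) hcc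
        rw [IntegrableOn, ← Measure.prod_restrict] at hI
        exact hI
    _ ≤ ∫ σ in Ioc (0:ℝ) 1, 8 * r ^ 4 * ∫ y in Ω, k y := by
        have hcs : Continuous (fun q : ℝ × (V2 × V2) => 2 * r ^ 2 * k (q.2.2 + q.1 • (q.2.1 - q.2.2))) := by fun_prop
        refine setIntegral_mono_on (cont_intOn (Metric.isBounded_Ioc 0 1) (cont_param hb hcs))
          (cont_intOn (Metric.isBounded_Ioc 0 1) continuous_const) measurableSet_Ioc fun σ hσ => ?_
        rw [integral_const_mul]
        have := near_avg D ck (fun x _ => by simp only [hk]; positivity) hr hσ.1.le hσ.2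
        calc _ ≤ 2 * r ^ 2 * ((2 * r) ^ 2 * ∫ y in Ω, k y) := by gcongr
          _ = _ := by ring
    _ = _ := by simp

lemma near_bound {Ω : Set V2} {φ : V2 → ℝ} (D : Dom Ω φ) {G H : V2 × V2 → ℝ} {r : ℝ} (hG : Continuous G) (hH : Continuous H)
    (h0 : ∀ p ∈ Ω ×ˢ Ω, r < ‖p.1 - p.2‖ → G p = 0) (h1 : ∀ p ∈ Near Ω r, |G p| ≤ H p) :
    |∫ p in Ω ×ˢ Ω, G p| ≤ ∫ p in Near Ω r, H p := by
  have e : ∫ p in Ω ×ˢ Ω, G p = ∫ p in Near Ω r, G p := by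
    refine setIntegral_eq_of_subset_of_forall_sdiff_eq_zero (D.meas.prod D.meas) inter_subset_left fun p hp => ?_
    refine h0 p hp.1 (not_le.1 fun h => hp.2 ⟨hp.1, h⟩)
  rw [e]
  refine (abs_integral_le_integral_abs).trans ?_
  exact setIntegral_mono_on (cont_intOn (Near.bdd D r) (by fun_prop)) (cont_intOn (Near.bdd D r) hH) (Near.meas D r) h1


end

section
set_option linter.unusedSimpArgs false

/-- A time slice together with bounds. -/
structure SB (Ω : Set V2) (φ : V2 → ℝ) (γ μ Λ ν rb pb : ℝ) (ρ P rt Pt : V2 → ℝ) (u B mt Bt : V2 → V2) (c c' : ℝ) : Prop where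
  S : Slice Ω φ γ μ Λ ν ρ P rt Pt u B mt Bt
  r0 : ∀ x ∈ Ω, 0 ≤ ρ x
  r1 : ∀ x ∈ Ω, ρ x ≤ rb
  p0 : ∀ x ∈ Ω, 0 ≤ P x
  p1 : ∀ x ∈ Ω, P x ≤ pb
  hc : c * volume.real Ω = ∫ x in Ω, P x
  hc' : c' * volume.real Ω = ∫ x in Ω, Pt x

lemma Dom.vol_pos {Ω : Set V2} {φ : V2 → ℝ} (D : Dom Ω φ) : 0 < volume.real Ω := by
  rw [measureReal_def, ENNReal.toReal_pos_iff]
  exact ⟨D.isOpen.measure_pos volume D.ne, D.bdd.measure_lt_top⟩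

lemma cs_vol {Ω : Set V2} {φ : V2 → ℝ} (D : Dom Ω φ) {g : V2 → ℝ} (hg : Continuous g) :
    (∫ x in Ω, g x) ^ 2 ≤ volume.real Ω * ∫ x in Ω, g x ^ 2 := by
  have hv := D.vol_pos
  set m := (∫ x in Ω, g x) / volume.real Ω with hm
  have h : 0 ≤ ∫ x in Ω, (g x - m) ^ 2 := integral_nonneg fun x => sq_nonneg _
  have e : ∫ x in Ω, (g x - m) ^ 2 = (∫ x in Ω, g x ^ 2) - 2 * m * (∫ x in Ω, g x) + volume.real Ω * m ^ 2 := by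
    have : (fun s => (g s - m) ^ 2) = fun s => g s ^ 2 - 2 * m * g s + m ^ 2 := by ext s; ring
    rw [this, integral_add (cont_intOn D.bdd (by fun_prop)) (cont_intOn D.bdd (by fun_prop)),
      integral_sub (cont_intOn D.bdd (by fun_prop)) (cont_intOn D.bdd (by fun_prop)), integral_const_mul, setIntegral_const]
    simp
  have e2 : ∫ x in Ω, g x = m * volume.real Ω := by rw [hm]; field_simp
  rw [e, e2] at h
  rw [e2]
  nlinarith

section
variable {Ω : Set V2} {φ : V2 → ℝ} {γ μ Λ ν rb pb : ℝ} {ρ P rt Pt : V2 → ℝ} {u B mt Bt : V2 → V2} {c c' : ℝ}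

lemma SB.c_bd (h : SB Ω φ γ μ Λ ν rb pb ρ P rt Pt u B mt Bt c c') : 0 ≤ c ∧ c ≤ pb := by
  have hv := h.S.dom.vol_pos
  have pc := h.S.cP.continuous
  have h1 : 0 ≤ ∫ x in Ω, P x := setIntegral_nonneg h.S.dom.meas h.p0
  have h2 : ∫ x in Ω, P x ≤ pb * volume.real Ω := by
    have := setIntegral_mono_on (cont_intOn (μ := volume) h.S.dom.bdd pc) (cont_intOn h.S.dom.bdd continuous_const) h.S.dom.meas h.p1
    rw [setIntegral_const] at this
    rw [mul_comm]; simpa using this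
  rw [← h.hc] at h1 h2
  exact ⟨nonneg_of_mul_nonneg_left h1 hv, le_of_mul_le_mul_right h2 hv⟩

lemma SB.f_bd (h : SB Ω φ γ μ Λ ν rb pb ρ P rt Pt u B mt Bt c c') {x : V2} (hx : x ∈ Ω) : |P x - c| ≤ pb := by
  have := h.c_bd
  have := h.p0 x hx
  have := h.p1 x hx
  rw [abs_le]; constructor <;> linarith

lemma SB.c'_eq (h : SB Ω φ γ μ Λ ν rb pb ρ P rt Pt u B mt Bt c c') :
    c' * volume.real Ω = -((γ - 1) * ∫ x in Ω, P x * div2 u x) := by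
  have := h.S.weak_pres 0 0 (η := fun _ => 1) contDiff_const
  simp only [pd_const, sub_zero, mul_one, mul_zero, add_zero, zero_mul, zero_add, zero_sub] at this
  rw [h.hc', this, integral_neg, integral_const_mul]

lemma SB.e_bd (h : SB Ω φ γ μ Λ ν rb pb ρ P rt Pt u B mt Bt c c') :
    ∫ x in Ω, (c * div2 u x + (γ - 1) * (P x * div2 u x) + c') ^ 2 ≤
      3 * pb ^ 2 * (1 + 2 * (γ - 1) ^ 2) * ∫ x in Ω, div2 u x ^ 2 := by
  have D := h.S.dom
  have hv := D.vol_pos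
  have dc := (contDiff_div2 h.S.cu).continuous
  have pc := h.S.cP.continuous
  have hcb := h.c_bd
  have k1 := cs_vol D (g := fun x => P x * div2 u x) (by fun_prop)
  have k2 : ∫ x in Ω, (P x * div2 u x) ^ 2 ≤ pb ^ 2 * ∫ x in Ω, div2 u x ^ 2 := by
    rw [← integral_const_mul]
    refine setIntegral_mono_on (cont_intOn D.bdd (by fun_prop)) (cont_intOn D.bdd (by fun_prop)) D.meas fun x hx => ?_
    rw [mul_pow]
    have := h.p0 x hx
    have := h.p1 x hx
    gcongr
  have k3 : c' ^ 2 * volume.real Ω ≤ (γ - 1) ^ 2 * (pb ^ 2 * ∫ x in Ω, div2 u x ^ 2) := by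
    have e := h.c'_eq
    have : (c' * volume.real Ω) ^ 2 ≤ (γ - 1) ^ 2 * (volume.real Ω * (pb ^ 2 * ∫ x in Ω, div2 u x ^ 2)) := by
      rw [e, neg_sq, mul_pow]
      gcongr
      exact k1.trans (by gcongr)
    have h2 : (c' ^ 2 * volume.real Ω) * volume.real Ω ≤ ((γ - 1) ^ 2 * (pb ^ 2 * ∫ x in Ω, div2 u x ^ 2)) * volume.real Ω := by
      nlinarith
    exact le_of_mul_le_mul_right h2 hv
  calc _ ≤ ∫ x in Ω, (3 * (pb ^ 2 * div2 u x ^ 2) + 3 * (γ - 1) ^ 2 * (pb ^ 2 * div2 u x ^ 2) + 3 * c' ^ 2) := by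
        refine setIntegral_mono_on (cont_intOn D.bdd (by fun_prop)) (cont_intOn D.bdd (by fun_prop)) D.meas fun x hx => ?_
        have q1 : (c * div2 u x) ^ 2 ≤ pb ^ 2 * div2 u x ^ 2 := by
          rw [mul_pow]; have := hcb.1; have := hcb.2; gcongr
        have q2 : (P x * div2 u x) ^ 2 ≤ pb ^ 2 * div2 u x ^ 2 := by
          rw [mul_pow]; have := h.p0 x hx; have := h.p1 x hx; gcongr
        have q3 : ((γ - 1) * (P x * div2 u x)) ^ 2 ≤ (γ - 1) ^ 2 * (pb ^ 2 * div2 u x ^ 2) := by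
          rw [mul_pow]; gcongr
        set A := c * div2 u x
        set A' := (γ - 1) * (P x * div2 u x)
        nlinarith [sq_nonneg (A - A'), sq_nonneg (A - c'), sq_nonneg (A' - c')]
    _ = 3 * (pb ^ 2 * ∫ x in Ω, div2 u x ^ 2) + 3 * (γ - 1) ^ 2 * (pb ^ 2 * ∫ x in Ω, div2 u x ^ 2) + 3 * (c' ^ 2 * volume.real Ω) := by
        rw [integral_add (cont_intOn D.bdd (by fun_prop)) (cont_intOn D.bdd (by fun_prop)),
          integral_add (cont_intOn D.bdd (by fun_prop)) (cont_intOn D.bdd (by fun_prop))]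
        simp only [integral_const_mul, setIntegral_const, smul_eq_mul]
        ring
    _ ≤ _ := by nlinarith
end

lemma Ker.far {Ω : Set V2} {w : V2 → ℝ} {x0 : V2} {R Cw : ℝ} (K : Ker Ω w x0 R Cw) {s : ℝ} (hs : 1 ≤ s) {p : V2 × V2}
    (hp : p ∈ Ω ×ˢ Ω) (hr : R / s < ‖p.1 - p.2‖) : zz s p ∉ Ω := by
  intro hz
  have h1 := K.diam _ hz _ hp.2
  have e : zz s p - p.2 = s • (p.1 - p.2) := by unfold zz; module
  rw [e, norm_smul, Real.norm_eq_abs, abs_of_nonneg (by linarith)] at h1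
  rw [div_lt_iff₀ (by linarith)] at hr
  linarith

lemma Ker.near {Ω : Set V2} {w : V2 → ℝ} {x0 : V2} {R Cw : ℝ} (K : Ker Ω w x0 R Cw) {s : ℝ} (hs : 1 ≤ s) {p : V2 × V2}
    (hp : p ∈ Near Ω (R / s)) (i : Fin 2) : |s * (p.1 i - p.2 i)| ≤ R := by
  have h1 := (norm_le_pi_norm (p.1 - p.2) i).trans hp.2
  rw [Pi.sub_apply, Real.norm_eq_abs, le_div_iff₀ (by linarith)] at h1
  rw [abs_mul, abs_of_nonneg (by linarith : 0 ≤ s)]; linarith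

lemma Ker.Phi_bd {Ω : Set V2} {w : V2 → ℝ} {x0 : V2} {R Cw : ℝ} (K : Ker Ω w x0 R Cw) {s : ℝ} (hs : 1 ≤ s) {p : V2 × V2}
    (hp : p ∈ Near Ω (R / s)) (i : Fin 2) : |Phi w s i p| ≤ R * Cw := by
  rw [Phi, abs_mul]
  exact mul_le_mul (K.near hs hp i) (K.bd _) (abs_nonneg _) K.Rpos.le

lemma Ker.nPhi_bd {Ω : Set V2} {w : V2 → ℝ} {x0 : V2} {R Cw : ℝ} (K : Ker Ω w x0 R Cw) {s : ℝ} (hs : 1 ≤ s) {p : V2 × V2}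
    (hp : p ∈ Near Ω (R / s)) (u : V2 → V2) (i : Fin 2) : |nPhi w u s i p| ≤ Cw * (s * |u p.1 i - u p.2 i|) +
      R * (Cw * (s * |u p.1 0 - u p.2 0| + |u p.2 0| + s * |u p.1 1 - u p.2 1| + |u p.2 1|)) := by
  rw [nPhi]
  have hs0 : 0 ≤ s := by linarith
  refine (abs_add_le _ _).trans (add_le_add ?_ ?_)
  · rw [abs_mul, abs_mul, abs_of_nonneg hs0]
    have := K.bd (zz s p)
    calc _ ≤ s * Cw * |u p.1 i - u p.2 i| := by gcongr
      _ = _ := by ring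
  · rw [abs_mul]
    refine mul_le_mul (K.near hs hp i) ?_ (abs_nonneg _) K.Rpos.le
    have q : ∀ j, |(s * u p.1 j - (s - 1) * u p.2 j) * pd j w (zz s p)| ≤ Cw * (s * |u p.1 j - u p.2 j| + |u p.2 j|) := by
      intro j
      rw [abs_mul, mul_comm]
      refine mul_le_mul (K.bd' j _) ?_ (abs_nonneg _) K.Cpos
      have e : s * u p.1 j - (s - 1) * u p.2 j = s * (u p.1 j - u p.2 j) + u p.2 j := by ring
      rw [e]
      refine (abs_add_le _ _).trans ?_
      rw [abs_mul, abs_of_nonneg hs0]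
    refine (abs_add_le _ _).trans ((add_le_add (q 0) (q 1)).trans (le_of_eq (by ring)))

set_option maxHeartbeats 1000000 in
lemma alg_low {R Cw rb pb f r U0 U1 n0 n1 e F0 F1 J B0 B1 d0 d1 V0 V1 : ℝ} (hR : 0 ≤ R) (hC : 0 ≤ Cw)
    (hf : |f| ≤ pb) (hr : |r| ≤ rb) (hF0 : |F0| ≤ R * Cw) (hF1 : |F1| ≤ R * Cw)
    (hd0 : 0 ≤ d0) (hd1 : 0 ≤ d1) (hV0 : 0 ≤ V0) (hV1 : 0 ≤ V1)
    (hn0 : |n0| ≤ Cw * d0 + R * (Cw * (d0 + V0 + d1 + V1)))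
    (hn1 : |n1| ≤ Cw * d1 + R * (Cw * (d0 + V0 + d1 + V1))) :
    |f * (r * U0 * n0 + r * U1 * n1) - e * (r * U0 * F0 + r * U1 * F1) + f * (J * (B0 * F1 - B1 * F0))| ≤
      (pb * rb * Cw * (1 + 2 * R) + rb * R * Cw + pb * R * Cw) *
        ((U0 ^ 2 + U1 ^ 2) + (d0 ^ 2 + d1 ^ 2) + (V0 ^ 2 + V1 ^ 2) + e ^ 2 + J ^ 2 + (B0 ^ 2 + B1 ^ 2)) := by
  have hpb : 0 ≤ pb := (abs_nonneg _).trans hf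
  have hrb : 0 ≤ rb := (abs_nonneg _).trans hr
  have a1 : |f * (r * U0 * n0 + r * U1 * n1)| ≤ pb * rb * Cw * (1 + 2 * R) * ((U0 ^ 2 + U1 ^ 2) + (d0 ^ 2 + d1 ^ 2) + (V0 ^ 2 + V1 ^ 2)) := by
    have : |f * (r * U0 * n0 + r * U1 * n1)| ≤ pb * (rb * (|U0| * (Cw * d0 + R * (Cw * (d0 + V0 + d1 + V1))) + |U1| * (Cw * d1 + R * (Cw * (d0 + V0 + d1 + V1))))) := by
      rw [abs_mul]
      refine mul_le_mul hf ?_ (abs_nonneg _) hpb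
      have e : r * U0 * n0 + r * U1 * n1 = r * (U0 * n0 + U1 * n1) := by ring
      rw [e, abs_mul]
      refine mul_le_mul hr ?_ (abs_nonneg _) hrb
      refine (abs_add_le _ _).trans ?_
      rw [abs_mul, abs_mul]
      gcongr
    refine this.trans ?_
    have s0 := sq_abs U0
    have s1 := sq_abs U1
    rw [← s0, ← s1]
    set A := |U0|
    set A' := |U1|
    have b1 : A * (Cw * d0 + R * (Cw * (d0 + V0 + d1 + V1))) + A' * (Cw * d1 + R * (Cw * (d0 + V0 + d1 + V1)))
      = Cw * ((A * d0 + A' * d1) + R * ((A + A') * (d0 + V0 + d1 + V1))) := by ring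
    rw [b1]
    have b2 : A * d0 + A' * d1 ≤ (A ^ 2 + A' ^ 2) + (d0 ^ 2 + d1 ^ 2) + (V0 ^ 2 + V1 ^ 2) := by
      nlinarith [sq_nonneg (A - d0), sq_nonneg (A' - d1)]
    have b3 : (A + A') * (d0 + V0 + d1 + V1) ≤ 2 * ((A ^ 2 + A' ^ 2) + (d0 ^ 2 + d1 ^ 2) + (V0 ^ 2 + V1 ^ 2)) := by
      nlinarith [sq_nonneg (A - d0), sq_nonneg (A' - d1), sq_nonneg (A - d1), sq_nonneg (A' - d0),
        sq_nonneg (A - V0), sq_nonneg (A' - V1), sq_nonneg (A - V1), sq_nonneg (A' - V0)]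
    calc _ ≤ pb * (rb * (Cw * (((A ^ 2 + A' ^ 2) + (d0 ^ 2 + d1 ^ 2) + (V0 ^ 2 + V1 ^ 2)) + R * (2 * ((A ^ 2 + A' ^ 2) + (d0 ^ 2 + d1 ^ 2) + (V0 ^ 2 + V1 ^ 2)))))) := by
          gcongr
      _ = _ := by ring
  have a2 : |e * (r * U0 * F0 + r * U1 * F1)| ≤ rb * R * Cw * (e ^ 2 + (U0 ^ 2 + U1 ^ 2)) := by
    have : |e * (r * U0 * F0 + r * U1 * F1)| ≤ |e| * (rb * (|U0| * (R * Cw) + |U1| * (R * Cw))) := by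
      rw [abs_mul]
      refine mul_le_mul_of_nonneg_left ?_ (abs_nonneg _)
      have e : r * U0 * F0 + r * U1 * F1 = r * (U0 * F0 + U1 * F1) := by ring
      rw [e, abs_mul]
      refine mul_le_mul hr ?_ (abs_nonneg _) hrb
      refine (abs_add_le _ _).trans ?_
      rw [abs_mul, abs_mul]
      gcongr
    refine this.trans ?_
    rw [← sq_abs U0, ← sq_abs U1, ← sq_abs e]
    have b : |e| * (|U0| + |U1|) ≤ |e| ^ 2 + (|U0| ^ 2 + |U1| ^ 2) := by
      nlinarith [sq_nonneg (|e| - |U0|), sq_nonneg (|e| - |U1|)]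
    calc _ = rb * R * Cw * (|e| * (|U0| + |U1|)) := by ring
      _ ≤ _ := by gcongr
  have a3 : |f * (J * (B0 * F1 - B1 * F0))| ≤ pb * R * Cw * (J ^ 2 + (B0 ^ 2 + B1 ^ 2)) := by
    have : |f * (J * (B0 * F1 - B1 * F0))| ≤ pb * (|J| * (|B0| * (R * Cw) + |B1| * (R * Cw))) := by
      rw [abs_mul]
      refine mul_le_mul hf ?_ (abs_nonneg _) hpb
      rw [abs_mul]
      refine mul_le_mul_of_nonneg_left ?_ (abs_nonneg _)
      refine (abs_sub _ _).trans ?_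
      rw [abs_mul, abs_mul]
      gcongr
    refine this.trans ?_
    rw [← sq_abs J, ← sq_abs B0, ← sq_abs B1]
    have b : |J| * (|B0| + |B1|) ≤ |J| ^ 2 + (|B0| ^ 2 + |B1| ^ 2) := by
      nlinarith [sq_nonneg (|J| - |B0|), sq_nonneg (|J| - |B1|)]
    calc _ = pb * R * Cw * (|J| * (|B0| + |B1|)) := by ring
      _ ≤ _ := by gcongr
  refine (abs_add_le _ _).trans ((add_le_add (abs_sub _ _) le_rfl).trans ?_)
  have k1 : 0 ≤ pb * rb * Cw * (1 + 2 * R) := by positivity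
  have k2 : 0 ≤ rb * R * Cw := by positivity
  have k3 : 0 ≤ pb * R * Cw := by positivity
  set K1 := pb * rb * Cw * (1 + 2 * R)
  set K2 := rb * R * Cw
  set K3 := pb * R * Cw
  set X := (U0 ^ 2 + U1 ^ 2) + (d0 ^ 2 + d1 ^ 2) + (V0 ^ 2 + V1 ^ 2) + e ^ 2 + J ^ 2 + (B0 ^ 2 + B1 ^ 2) with hX
  have x1 : (U0 ^ 2 + U1 ^ 2) + (d0 ^ 2 + d1 ^ 2) + (V0 ^ 2 + V1 ^ 2) ≤ X := by rw [hX]; linarith [sq_nonneg V0, sq_nonneg V1, sq_nonneg d0, sq_nonneg d1, sq_nonneg e, sq_nonneg J, sq_nonneg B0, sq_nonneg B1, sq_nonneg U0, sq_nonneg U1]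
  have x2 : e ^ 2 + (U0 ^ 2 + U1 ^ 2) ≤ X := by rw [hX]; linarith [sq_nonneg V0, sq_nonneg V1, sq_nonneg d0, sq_nonneg d1, sq_nonneg e, sq_nonneg J, sq_nonneg B0, sq_nonneg B1, sq_nonneg U0, sq_nonneg U1]
  have x3 : J ^ 2 + (B0 ^ 2 + B1 ^ 2) ≤ X := by rw [hX]; linarith [sq_nonneg V0, sq_nonneg V1, sq_nonneg d0, sq_nonneg d1, sq_nonneg e, sq_nonneg J, sq_nonneg B0, sq_nonneg B1, sq_nonneg U0, sq_nonneg U1]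
  calc _ ≤ K1 * X + K2 * X + K3 * X := add_le_add (add_le_add (a1.trans (by gcongr)) (a2.trans (by gcongr))) (a3.trans (by gcongr))
    _ = _ := by ring


end

section
set_option linter.unusedSimpArgs false

/-- dissipation -/
def Dn (Ω : Set V2) (u B : V2 → V2) : ℝ := ∫ x in Ω, (div2 u x ^ 2 + curl2 u x ^ 2 + curl2 B x ^ 2)

section
variable {Ω : Set V2} {φ : V2 → ℝ} {γ μ Λ ν rb pb : ℝ} {ρ P rt Pt : V2 → ℝ} {u B mt Bt : V2 → V2} {c c' : ℝ}

lemma Slice.Dn_eq (S : Slice Ω φ γ μ Λ ν ρ P rt Pt u B mt Bt) :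
    Dn Ω u B = (∫ x in Ω, div2 u x ^ 2) + (∫ x in Ω, curl2 u x ^ 2) + ∫ x in Ω, curl2 B x ^ 2 := by
  have D := S.dom
  have dc := (contDiff_div2 S.cu).continuous
  have wc := (contDiff_curl2 S.cu).continuous
  have jc := (contDiff_curl2 S.cB).continuous
  rw [Dn, integral_add (cont_intOn D.bdd (by fun_prop)) (cont_intOn D.bdd (by fun_prop)),
    integral_add (cont_intOn D.bdd (by fun_prop)) (cont_intOn D.bdd (by fun_prop))]

lemma Slice.poin (S : Slice Ω φ γ μ Λ ν ρ P rt Pt u B mt Bt) {C : ℝ} (hC : 0 ≤ C)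
    (hP : ∀ u : V2 → V2, (∀ i, ContDiff ℝ 1 (fun x => u x i)) →
    (∀ x ∈ frontier Ω, dot (u x) (grad φ x) = 0) → ∫ x in Ω, nsq (u x) ≤ C * ∫ x in Ω, gnsq u x) :
    ∫ x in Ω, gnsq u x ≤ Dn Ω u B ∧ ∫ x in Ω, nsq (u x) ≤ C * Dn Ω u B ∧ ∫ x in Ω, nsq (B x) ≤ C * Dn Ω u B
     ∧ ∫ x in Ω, div2 u x ^ 2 ≤ Dn Ω u B ∧ ∫ x in Ω, curl2 u x ^ 2 ≤ Dn Ω u B ∧ ∫ x in Ω, curl2 B x ^ 2 ≤ Dn Ω u B ∧ 0 ≤ Dn Ω u B := by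
  have D := S.dom
  have dc := (contDiff_div2 S.cu).continuous
  have wc := (contDiff_curl2 S.cu).continuous
  have jc := (contDiff_curl2 S.cB).continuous
  have bc := (contDiff_div2 S.cB).continuous
  have e := S.Dn_eq
  have n1 : 0 ≤ ∫ x in Ω, div2 u x ^ 2 := integral_nonneg fun x => sq_nonneg _
  have n2 : 0 ≤ ∫ x in Ω, curl2 u x ^ 2 := integral_nonneg fun x => sq_nonneg _
  have n3 : 0 ≤ ∫ x in Ω, curl2 B x ^ 2 := integral_nonneg fun x => sq_nonneg _
  have a1 := D.div_curl S.cu S.su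
  have a2 := D.div_curl S.cB S.sB
  rw [integral_add (cont_intOn D.bdd (by fun_prop)) (cont_intOn D.bdd (by fun_prop))] at a1 a2
  have z : ∫ x in Ω, div2 B x ^ 2 = 0 := by
    rw [setIntegral_congr_fun D.meas (g := fun _ => (0:ℝ)) (fun x hx => by simp [S.divB x hx])]; simp
  have b1 := hP u (fun i => (S.cu i).of_le one_le_two) S.su
  have b2 := hP B (fun i => (S.cB i).of_le one_le_two) S.sB
  refine ⟨by linarith, b1.trans (by gcongr; linarith), b2.trans (by gcongr; linarith), by linarith, by linarith, by linarith, by linarith⟩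

end

lemma low {Ω : Set V2} {φ : V2 → ℝ} (D : Dom Ω φ) {w : V2 → ℝ} {x0 : V2} {R Cw : ℝ} (K : Ker Ω w x0 R Cw) (γ rb pb : ℝ)
    (hrb : 0 ≤ rb) (hpb : 0 ≤ pb) :
    ∃ C : ℝ, 0 ≤ C ∧ ∀ {μ Λ ν : ℝ} {ρ P rt Pt : V2 → ℝ} {u B mt Bt : V2 → V2} {c c' : ℝ},
      SB Ω φ γ μ Λ ν rb pb ρ P rt Pt u B mt Bt c c' → ∀ s : ℝ, 1 ≤ s →
      |∫ p in Ω ×ˢ Ω, ((P p.2 - c) * (ρ p.1 * u p.1 0 * nPhi w u s 0 p + ρ p.1 * u p.1 1 * nPhi w u s 1 p)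
        - (c * div2 u p.2 + (γ - 1) * (P p.2 * div2 u p.2) + c') * (ρ p.1 * u p.1 0 * Phi w s 0 p + ρ p.1 * u p.1 1 * Phi w s 1 p)
        + (P p.2 - c) * (curl2 B p.1 * (B p.1 0 * Phi w s 1 p - B p.1 1 * Phi w s 0 p)))| ≤ C * (s ^ 2)⁻¹ * Dn Ω u B := by
  obtain ⟨CP, hCP, hP⟩ := D.poincare
  have hC := K.Cpos
  have hR := K.Rpos
  set k := pb * rb * Cw * (1 + 2 * R) + rb * R * Cw + pb * R * Cw with hk
  have hk0 : 0 ≤ k := by rw [hk]; positivity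
  set Q := 4 * R ^ 2 * (2 * CP + 3 * pb ^ 2 * (1 + 2 * (γ - 1) ^ 2) + 1 + CP) + 8 * R ^ 4 with hQ
  have hQ0 : 0 ≤ Q := by rw [hQ]; positivity
  refine ⟨k * Q, by positivity, ?_⟩
  intro μ Λ ν ρ P rt Pt u B mt Bt c c' h s hs
  have S := h.S
  have hw := K.smooth
  have cw := hw.continuous
  have cw0 := continuous_pd (i := 0) (hw.of_le top_le1)
  have cw1 := continuous_pd (i := 1) (hw.of_le top_le1)
  have u0 := (S.cu 0).continuous
  have u1 := (S.cu 1).continuous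
  have B0 := (S.cB 0).continuous
  have B1 := (S.cB 1).continuous
  have dc := (contDiff_div2 S.cu).continuous
  have wc := (contDiff_curl2 S.cu).continuous
  have jc := (contDiff_curl2 S.cB).continuous
  have rc := S.cρ.continuous
  have pc := S.cP.continuous
  have cz := cont_zz' s
  have cF0 : Continuous (Phi w s 0) := by unfold Phi; fun_prop
  have cF1 : Continuous (Phi w s 1) := by unfold Phi; fun_prop
  have cN0 : Continuous (nPhi w u s 0) := by unfold nPhi; fun_prop
  have cN1 : Continuous (nPhi w u s 1) := by unfold nPhi; fun_prop
  have hs0 : 0 < s := by linarith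
  have hr : 0 ≤ R / s := by positivity
  set ee : V2 → ℝ := fun x => c * div2 u x + (γ - 1) * (P x * div2 u x) + c' with hee
  have cee : Continuous ee := by rw [hee]; fun_prop
  have b := near_bound D (r := R / s)
    (G := fun p => (P p.2 - c) * (ρ p.1 * u p.1 0 * nPhi w u s 0 p + ρ p.1 * u p.1 1 * nPhi w u s 1 p)
        - ee p.2 * (ρ p.1 * u p.1 0 * Phi w s 0 p + ρ p.1 * u p.1 1 * Phi w s 1 p)
        + (P p.2 - c) * (curl2 B p.1 * (B p.1 0 * Phi w s 1 p - B p.1 1 * Phi w s 0 p)))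
    (H := fun p => k * ((u p.1 0 ^ 2 + u p.1 1 ^ 2) + (s ^ 2 * (u p.1 0 - u p.2 0) ^ 2 + s ^ 2 * (u p.1 1 - u p.2 1) ^ 2)
      + (u p.2 0 ^ 2 + u p.2 1 ^ 2) + ee p.2 ^ 2 + curl2 B p.1 ^ 2 + (B p.1 0 ^ 2 + B p.1 1 ^ 2))) (by fun_prop) (by fun_prop)
    (by
      intro p hp hr
      have hz := K.far hs hp hr
      simp [nPhi, Phi, K.zero hz, K.zero' hz])
    (by
      intro p hp
      have hx := hp.1.1
      have hy := hp.1.2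
      have q := alg_low (f := P p.2 - c) (r := ρ p.1) (U0 := u p.1 0) (U1 := u p.1 1) (n0 := nPhi w u s 0 p) (n1 := nPhi w u s 1 p)
        (e := ee p.2) (F0 := Phi w s 0 p) (F1 := Phi w s 1 p) (J := curl2 B p.1) (B0 := B p.1 0) (B1 := B p.1 1)
        (d0 := s * |u p.1 0 - u p.2 0|) (d1 := s * |u p.1 1 - u p.2 1|) (V0 := |u p.2 0|) (V1 := |u p.2 1|) hR.le hC (h.f_bd hy)
        (rb := rb) (by rw [abs_of_nonneg (h.r0 _ hx)]; exact h.r1 _ hx) (K.Phi_bd hs hp 0) (K.Phi_bd hs hp 1)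
        (by positivity) (by positivity) (by positivity) (by positivity) (K.nPhi_bd hs hp u 0) (K.nPhi_bd hs hp u 1)
      simp only [mul_pow, sq_abs] at q
      exact q)
  refine b.trans ?_
  have cr := Near.bdd D (R / s)
  rw [integral_const_mul]
  rw [integral_add (cont_intOn cr (by fun_prop)) (cont_intOn cr (by fun_prop)),
    integral_add (cont_intOn cr (by fun_prop)) (cont_intOn cr (by fun_prop)),
    integral_add (cont_intOn cr (by fun_prop)) (cont_intOn cr (by fun_prop)),
    integral_add (cont_intOn cr (by fun_prop)) (cont_intOn cr (by fun_prop)),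
    integral_add (cont_intOn cr (by fun_prop)) (cont_intOn cr (by fun_prop)),
    integral_add (f := fun p : V2 × V2 => s ^ 2 * (u p.1 0 - u p.2 0) ^ 2) (cont_intOn cr (by fun_prop)) (cont_intOn cr (by fun_prop)),
    integral_const_mul, integral_const_mul]
  obtain ⟨g1, g2, g3, g4, g5, g6, g7⟩ := S.poin hCP hP
  have ge := h.e_bd
  have t1 := near_x D (k := fun x => u x 0 ^ 2 + u x 1 ^ 2) (by fun_prop) (fun x _ => by positivity) hr
  have t2 := near_y D (k := fun x => u x 0 ^ 2 + u x 1 ^ 2) (by fun_prop) (fun x _ => by positivity) hr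
  have t3 := near_y D (k := fun x => ee x ^ 2) (by fun_prop) (fun x _ => by positivity) hr
  have t4 := near_x D (k := fun x => curl2 B x ^ 2) (by fun_prop) (fun x _ => by positivity) hr
  have t5 := near_x D (k := fun x => B x 0 ^ 2 + B x 1 ^ 2) (by fun_prop) (fun x _ => by positivity) hr
  have t6 := near_diff D ((S.cu 0).of_le one_le_two) hr
  have t7 := near_diff D ((S.cu 1).of_le one_le_two) hr
  have k00 := continuous_pd (i := 0) ((S.cu 0).of_le one_le_two)
  have k01 := continuous_pd (i := 1) ((S.cu 0).of_le one_le_two)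
  have k10 := continuous_pd (i := 0) ((S.cu 1).of_le one_le_two)
  have k11 := continuous_pd (i := 1) ((S.cu 1).of_le one_le_two)
  have eg : ∫ x in Ω, gnsq u x = (∫ y in Ω, (pd 0 (fun x => u x 0) y ^ 2 + pd 1 (fun x => u x 0) y ^ 2))
      + ∫ y in Ω, (pd 0 (fun x => u x 1) y ^ 2 + pd 1 (fun x => u x 1) y ^ 2) := by
    rw [← integral_add (cont_intOn D.bdd (by fun_prop)) (cont_intOn D.bdd (by fun_prop))]
    simp only [gnsq, Fin.sum_univ_two]
  simp only [nsq, Fin.sum_univ_two] at g2 g3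
  have gee : ∫ x in Ω, ee x ^ 2 ≤ 3 * pb ^ 2 * (1 + 2 * (γ - 1) ^ 2) * Dn Ω u B := ge.trans (by gcongr)
  have r1 : (2 * (R / s)) ^ 2 = 4 * R ^ 2 * (s ^ 2)⁻¹ := by field_simp; ring
  have r2 : 8 * (R / s) ^ 4 = (s ^ 2)⁻¹ * (8 * R ^ 4 * (s ^ 2)⁻¹) := by field_simp
  have hi : 0 ≤ (s ^ 2)⁻¹ := by positivity
  rw [r1] at t1 t2 t3 t4 t5
  rw [r2] at t6 t7
  set ii := (s ^ 2)⁻¹ with hii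
  have his : s ^ 2 * ii = 1 := by rw [hii]; field_simp
  have t67 : s ^ 2 * (∫ p in Near Ω (R / s), (u p.1 0 - u p.2 0) ^ 2) + s ^ 2 * (∫ p in Near Ω (R / s), (u p.1 1 - u p.2 1) ^ 2)
      ≤ 8 * R ^ 4 * ii * Dn Ω u B := by
    calc _ = s ^ 2 * ((∫ p in Near Ω (R / s), (u p.1 0 - u p.2 0) ^ 2) + ∫ p in Near Ω (R / s), (u p.1 1 - u p.2 1) ^ 2) := by ring
      _ ≤ s ^ 2 * (ii * (8 * R ^ 4 * ii) * (∫ x in Ω, gnsq u x)) := by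
          refine mul_le_mul_of_nonneg_left ?_ (by positivity)
          rw [eg, mul_add]; exact add_le_add t6 t7
      _ = 8 * R ^ 4 * ii * (∫ x in Ω, gnsq u x) := by linear_combination (8 * R ^ 4 * ii * (∫ x in Ω, gnsq u x)) * his
      _ ≤ _ := by gcongr
  have hA : 0 ≤ 4 * R ^ 2 * ii := by positivity
  have T1 := t1.trans (mul_le_mul_of_nonneg_left g2 hA)
  have T2 := t2.trans (mul_le_mul_of_nonneg_left g2 hA)
  have T3 := t3.trans (mul_le_mul_of_nonneg_left gee hA)
  have T4 := t4.trans (mul_le_mul_of_nonneg_left g6 hA)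
  have T5 := t5.trans (mul_le_mul_of_nonneg_left g3 hA)
  have e : k * Q * ii * Dn Ω u B = k * (4 * R ^ 2 * ii * (CP * Dn Ω u B) + 8 * R ^ 4 * ii * Dn Ω u B + 4 * R ^ 2 * ii * (CP * Dn Ω u B)
     + 4 * R ^ 2 * ii * (3 * pb ^ 2 * (1 + 2 * (γ - 1) ^ 2) * Dn Ω u B) + 4 * R ^ 2 * ii * (Dn Ω u B) + 4 * R ^ 2 * ii * (CP * Dn Ω u B)) := by
    rw [hQ]; ring
  rw [e]
  gcongr

lemma psi_bd {Ω : Set V2} {φ : V2 → ℝ} (D : Dom Ω φ) {w : V2 → ℝ} {x0 : V2} {R Cw : ℝ} (K : Ker Ω w x0 R Cw) {rb pb c : ℝ}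
    {ρ P : V2 → ℝ} {u : V2 → V2} (cr : Continuous ρ) (cP : Continuous P) (u0 : Continuous fun x => u x 0) (u1 : Continuous fun x => u x 1)
    (r0 : ∀ x ∈ Ω, 0 ≤ ρ x) (r1 : ∀ x ∈ Ω, ρ x ≤ rb) (hp : ∀ x ∈ Ω, |P x - c| ≤ pb) {s : ℝ} (hs : 1 ≤ s) :
    |∫ p in Ω ×ˢ Ω, (P p.2 - c) * (ρ p.1 * u p.1 0 * Phi w s 0 p + ρ p.1 * u p.1 1 * Phi w s 1 p)| ≤
      4 * pb * R ^ 3 * Cw * (s ^ 2)⁻¹ * (rb * volume.real Ω + ∫ x in Ω, ρ x * nsq (u x) / 2) := by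
  have hC := K.Cpos
  have hR := K.Rpos
  have cw := K.smooth.continuous
  have cz := cont_zz' s
  have cF0 : Continuous (Phi w s 0) := by unfold Phi; fun_prop
  have cF1 : Continuous (Phi w s 1) := by unfold Phi; fun_prop
  have hs0 : 0 < s := by linarith
  have hr : 0 ≤ R / s := by positivity
  obtain ⟨xx, hxx⟩ := D.ne
  have hpb : 0 ≤ pb := (abs_nonneg _).trans (hp xx hxx)
  have hrb : 0 ≤ rb := (r0 xx hxx).trans (r1 xx hxx)
  have b := near_bound D (r := R / s)
    (G := fun p => (P p.2 - c) * (ρ p.1 * u p.1 0 * Phi w s 0 p + ρ p.1 * u p.1 1 * Phi w s 1 p))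
    (H := fun p => pb * R * Cw * (rb + ρ p.1 * (u p.1 0 ^ 2 + u p.1 1 ^ 2) / 2)) (by fun_prop) (by fun_prop)
    (by
      intro p hp hr
      have hz := K.far hs hp hr
      simp [Phi, K.zero hz])
    (by
      intro p hn
      have hx := hn.1.1
      have hy := hn.1.2
      have f0 := K.Phi_bd hs hn 0
      have f1 := K.Phi_bd hs hn 1
      have q0 := r0 _ hx
      have q1 := r1 _ hx
      rw [abs_mul, mul_assoc pb, mul_assoc pb]
      refine mul_le_mul (hp _ hy) ?_ (abs_nonneg _) hpb
      have e : ρ p.1 * u p.1 0 * Phi w s 0 p + ρ p.1 * u p.1 1 * Phi w s 1 p = ρ p.1 * (u p.1 0 * Phi w s 0 p + u p.1 1 * Phi w s 1 p) := by ring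
      rw [e, abs_mul, abs_of_nonneg q0]
      have e2 : |u p.1 0 * Phi w s 0 p + u p.1 1 * Phi w s 1 p| ≤ (R * Cw) * (1 + (u p.1 0 ^ 2 + u p.1 1 ^ 2) / 2) := by
        refine (abs_add_le _ _).trans ?_
        rw [abs_mul, abs_mul]
        have : |u p.1 0| * |Phi w s 0 p| + |u p.1 1| * |Phi w s 1 p| ≤ |u p.1 0| * (R * Cw) + |u p.1 1| * (R * Cw) := by gcongr
        refine this.trans ?_
        rw [← add_mul, mul_comm]
        refine mul_le_mul_of_nonneg_left ?_ (by positivity)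
        nlinarith [sq_nonneg (|u p.1 0| - 1), sq_nonneg (|u p.1 1| - 1), sq_abs (u p.1 0), sq_abs (u p.1 1)]
      calc ρ p.1 * |u p.1 0 * Phi w s 0 p + u p.1 1 * Phi w s 1 p| ≤ ρ p.1 * ((R * Cw) * (1 + (u p.1 0 ^ 2 + u p.1 1 ^ 2) / 2)) := by gcongr
        _ = (R * Cw) * (ρ p.1 + ρ p.1 * (u p.1 0 ^ 2 + u p.1 1 ^ 2) / 2) := by ring
        _ ≤ (R * Cw) * (rb + ρ p.1 * (u p.1 0 ^ 2 + u p.1 1 ^ 2) / 2) := by gcongr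
        _ = _ := by ring)
  refine b.trans ?_
  rw [integral_const_mul]
  have t := near_x D (k := fun x => rb + ρ x * (u x 0 ^ 2 + u x 1 ^ 2) / 2) (by fun_prop)
    (fun x hx => by have := r0 x hx; positivity) hr
  have e : ∫ x in Ω, (rb + ρ x * (u x 0 ^ 2 + u x 1 ^ 2) / 2) = rb * volume.real Ω + ∫ x in Ω, ρ x * nsq (u x) / 2 := by
    rw [integral_add (cont_intOn D.bdd (by fun_prop)) (cont_intOn D.bdd (by fun_prop))]
    simp [nsq, Fin.sum_univ_two, mul_comm]
  rw [e] at t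
  calc _ ≤ pb * R * Cw * ((2 * (R / s)) ^ 2 * (rb * volume.real Ω + ∫ x in Ω, ρ x * nsq (u x) / 2)) := by gcongr
    _ = _ := by field_simp; ring


end

section
set_option linter.unusedSimpArgs false

lemma zz_eq (s : ℝ) (p : V2 × V2) : zz s p = p.2 + s • (p.1 - p.2) := by unfold zz; module

lemma cont_dPhi {w : V2 → ℝ} (hw : ContDiff ℝ (⊤ : ℕ∞) w) : Continuous (fun p : ℝ × (V2 × V2) => dPhi w p.1 p.2) := by
  have cw := hw.continuous
  have cw0 := continuous_pd (i := 0) (hw.of_le top_le1)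
  have cw1 := continuous_pd (i := 1) (hw.of_le top_le1)
  have cz := cont_zz
  unfold dPhi; fun_prop

lemma cont_cPhi {w : V2 → ℝ} (hw : ContDiff ℝ (⊤ : ℕ∞) w) : Continuous (fun p : ℝ × (V2 × V2) => cPhi w p.1 p.2) := by
  have cw := hw.continuous
  have cw0 := continuous_pd (i := 0) (hw.of_le top_le1)
  have cw1 := continuous_pd (i := 1) (hw.of_le top_le1)
  have cz := cont_zz
  unfold cPhi; fun_prop

lemma main_subst {Ω : Set V2} {φ : V2 → ℝ} (D : Dom Ω φ) {w : V2 → ℝ} {x0 : V2} {R Cw : ℝ} (K : Ker Ω w x0 R Cw)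
    {f q : V2 → ℝ} (hf : Continuous f) (hq : Continuous q) {s : ℝ} (hs : 1 ≤ s) :
    ∫ p in Ω ×ˢ Ω, f p.2 * q p.1 * (s ^ 2 * w (zz s p)) = ∫ p in Ω ×ˢ Ω, f p.2 * w p.1 * q (p.2 + s⁻¹ • (p.1 - p.2)) := by
  have cw := K.smooth.continuous
  have cz := cont_zz' s
  have hs0 : 0 < s := by linarith
  rw [dbl_yx D.bdd (by fun_prop), dbl_yx D.bdd (by fun_prop)]
  refine setIntegral_congr_fun D.meas fun y hy => ?_
  simp only
  have h1 : ∫ x in Ω, f y * q x * (s ^ 2 * w (zz s (x, y))) = ∫ x, f y * q x * (s ^ 2 * w (zz s (x, y))) := by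
    refine setIntegral_eq_integral_of_forall_compl_eq_zero fun x hx => ?_
    have hz : zz s (x, y) ∉ Ω := by
      intro hz
      apply hx
      have e : x = (1 / s) • zz s (x, y) + (1 - 1 / s) • y := by
        simp only [zz, smul_sub, smul_smul]
        ext i; simp; field_simp; ring
      rw [e]
      exact D.conv hz hy (by positivity) (by rw [sub_nonneg, div_le_one hs0]; exact hs) (by ring)
    rw [K.zero hz]; ring
  have h2 : ∫ x in Ω, f y * w x * q (y + s⁻¹ • (x - y)) = ∫ x, f y * w x * q (y + s⁻¹ • (x - y)) := by
    refine setIntegral_eq_integral_of_forall_compl_eq_zero fun x hx => ?_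
    rw [K.zero hx]; ring
  rw [h1, h2]
  set k : V2 → ℝ := fun x => f y * w x * q (y + s⁻¹ • (x - y)) with hk
  have e1 : ∀ x, f y * q x * (s ^ 2 * w (zz s (x, y))) = s ^ 2 * (fun x' => k (x' + -((s - 1) • y))) (s • x) := by
    intro x
    simp only [hk, zz, ← sub_eq_add_neg]
    have : y + s⁻¹ • (s • x - (s - 1) • y - y) = x := by
      ext i; simp; field_simp; ring
    rw [this]; ring
  simp only [e1]
  rw [integral_const_mul, Measure.integral_comp_smul volume (fun x' => k (x' + -((s - 1) • y))) s, integral_add_right_eq_self k]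
  simp only [Module.finrank_fin_fun, smul_eq_mul]
  rw [abs_of_nonneg (by positivity)]
  field_simp

lemma main_term {Ω : Set V2} {φ : V2 → ℝ} (D : Dom Ω φ) {w : V2 → ℝ} {x0 : V2} {R Cw : ℝ} (K : Ker Ω w x0 R Cw)
    {f q : V2 → ℝ} (hf : Continuous f) (hq : Continuous q) (h0 : ∫ x in Ω, f x = 0) {S : ℝ} (hS : 1 ≤ S) :
    ∫ s in (1:ℝ)..S, ∫ p in Ω ×ˢ Ω, f p.2 * q p.1 * dPhi w s p
      = ∫ p in Ω ×ˢ Ω, f p.2 * w p.1 * q (p.2 + S⁻¹ • (p.1 - p.2)) := by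
  have hb2 := D.bdd.prod D.bdd
  have hw := K.smooth
  have cw := hw.continuous
  have cz := cont_zz
  have cd := cont_dPhi hw
  have hc' : Continuous (fun q' : ℝ × (V2 × V2) => f q'.2.2 * q q'.2.1 * dPhi w q'.1 q'.2) := by fun_prop
  have hd : ∀ t, HasDerivAt (fun s => ∫ p in Ω ×ˢ Ω, f p.2 * q p.1 * (s ^ 2 * w (zz s p)))
      (∫ p in Ω ×ˢ Ω, f p.2 * q p.1 * dPhi w t p) t := by
    intro t
    refine deriv_param (H := fun s p => f p.2 * q p.1 * (s ^ 2 * w (zz s p))) (H' := fun s p => f p.2 * q p.1 * dPhi w s p)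
      hb2 (D.meas.prod D.meas) (by fun_prop) hc' (fun t p => ?_) t
    have l := line_deriv (hw.of_le top_le1) p.2 (p.1 - p.2) t
    have l2 : HasDerivAt (fun s : ℝ => s ^ 2) (2 * t) t := by simpa using hasDerivAt_pow 2 t
    have l3 := (l2.mul l).const_mul (f p.2 * q p.1)
    simp only [zz_eq]
    refine l3.congr_deriv ?_
    rw [fderiv_eq_sum]
    simp only [dPhi, zz_eq, Fin.sum_univ_two, Pi.sub_apply]
    try ring
  rw [ftc hd (cont_param hb2 hc') 1 S, main_subst D K hf hq hS]
  have : ∫ p in Ω ×ˢ Ω, f p.2 * q p.1 * ((1:ℝ) ^ 2 * w (zz 1 p)) = 0 := by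
    have e : ∀ p : V2 × V2, f p.2 * q p.1 * ((1:ℝ) ^ 2 * w (zz 1 p)) = f p.2 * (q p.1 * w p.1) := by
      intro p; simp only [zz]; simp; ring
    simp only [e]
    rw [dbl_xy D.bdd (by fun_prop)]
    simp only [integral_mul_const, h0, zero_mul, integral_zero]
  rw [this, sub_zero]

lemma curl_near {Ω : Set V2} {φ : V2 → ℝ} (D : Dom Ω φ) {w : V2 → ℝ} {x0 : V2} {R Cw : ℝ} (K : Ker Ω w x0 R Cw)
    {f g : V2 → ℝ} (hf : Continuous f) (hg : Continuous g) {κ s : ℝ} (hκ : 0 < κ) (hs : 1 ≤ s) (hs2 : s ≤ 2) :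
    |∫ p in Ω ×ˢ Ω, f p.2 * g p.1 * cPhi w s p| ≤ 16 * R ^ 3 * Cw * (κ ^ 2 * (∫ x in Ω, f x ^ 2) + κ⁻¹ ^ 2 * ∫ x in Ω, g x ^ 2) := by
  have hC := K.Cpos
  have hR := K.Rpos
  have hs0 : 0 < s := by linarith
  have hr : 0 ≤ R / s := by positivity
  have hc : Continuous (cPhi w s) := (cont_cPhi K.smooth).comp (by fun_prop : Continuous fun p : V2 × V2 => (s, p))
  have b := near_bound D (r := R / s) (G := fun p => f p.2 * g p.1 * cPhi w s p)
    (H := fun p => (4 * R * Cw) * (κ ^ 2 * f p.2 ^ 2 + κ⁻¹ ^ 2 * g p.1 ^ 2)) (by fun_prop) (by fun_prop)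
    (by
      intro p hp hr
      have hz := K.far hs hp hr
      simp [cPhi, K.zero' hz])
    (by
      intro p hp
      have h1 : |cPhi w s p| ≤ 4 * R * Cw := by
        have e : cPhi w s p = s * ((s * (p.1 1 - p.2 1)) * pd 0 w (zz s p) - (s * (p.1 0 - p.2 0)) * pd 1 w (zz s p)) := by
          unfold cPhi; ring
        rw [e, abs_mul, abs_of_nonneg hs0.le]
        have n0 := K.near hs hp 0
        have n1 := K.near hs hp 1
        have m0 := K.bd' 0 (zz s p)
        have m1 := K.bd' 1 (zz s p)
        calc _ ≤ 2 * (R * Cw + R * Cw) := by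
              refine mul_le_mul hs2 ?_ (abs_nonneg _) (by norm_num)
              refine (abs_sub _ _).trans (add_le_add ?_ ?_)
              · rw [abs_mul]; exact mul_le_mul n1 m0 (abs_nonneg _) hR.le
              · rw [abs_mul]; exact mul_le_mul n0 m1 (abs_nonneg _) hR.le
          _ = _ := by ring
      have h2 : |f p.2 * g p.1| ≤ κ ^ 2 * f p.2 ^ 2 + κ⁻¹ ^ 2 * g p.1 ^ 2 := by
        have e : f p.2 * g p.1 = (κ * f p.2) * (κ⁻¹ * g p.1) := by field_simp
        rw [e, ← mul_pow, ← mul_pow]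
        set A := κ * f p.2
        set A' := κ⁻¹ * g p.1
        rw [abs_le]; constructor <;> nlinarith [sq_nonneg (A - A'), sq_nonneg (A + A')]
      rw [abs_mul, mul_comm]
      exact mul_le_mul h1 h2 (abs_nonneg _) (by positivity))
  refine b.trans ?_
  have cr := Near.bdd D (R / s)
  rw [integral_const_mul, integral_add (cont_intOn cr (by fun_prop)) (cont_intOn cr (by fun_prop)), integral_const_mul, integral_const_mul]
  have t1 := near_y D (k := fun x => f x ^ 2) (by fun_prop) (fun x _ => by positivity) hr
  have t2 := near_x D (k := fun x => g x ^ 2) (by fun_prop) (fun x _ => by positivity) hr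
  have hr2 : (2 * (R / s)) ^ 2 ≤ 4 * R ^ 2 := by
    have : R / s ≤ R := div_le_self hR.le hs
    calc _ ≤ (2 * R) ^ 2 := by gcongr
      _ = _ := by ring
  have n1 : 0 ≤ ∫ x in Ω, f x ^ 2 := integral_nonneg fun x => sq_nonneg _
  have n2 : 0 ≤ ∫ x in Ω, g x ^ 2 := integral_nonneg fun x => sq_nonneg _
  calc _ ≤ 4 * R * Cw * (κ ^ 2 * (4 * R ^ 2 * ∫ x in Ω, f x ^ 2) + κ⁻¹ ^ 2 * (4 * R ^ 2 * ∫ x in Ω, g x ^ 2)) := by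
        gcongr
        · exact t1.trans (by gcongr)
        · exact t2.trans (by gcongr)
    _ = _ := by ring

lemma curl_term {Ω : Set V2} {φ : V2 → ℝ} (D : Dom Ω φ) {w : V2 → ℝ} {x0 : V2} {R Cw : ℝ} (K : Ker Ω w x0 R Cw) :
    ∃ C : ℝ, 0 ≤ C ∧ ∀ (f g : V2 → ℝ) (κ S : ℝ), Continuous f → Continuous g → 0 < κ → 2 ≤ S →
      |∫ s in (1:ℝ)..S, ∫ p in Ω ×ˢ Ω, f p.2 * g p.1 * cPhi w s p| ≤ C * (κ ^ 2 * (∫ x in Ω, f x ^ 2) + κ⁻¹ ^ 2 * ∫ x in Ω, g x ^ 2) := by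
  obtain ⟨C0, hC0, H0⟩ := fourier_V2 w K.smooth K.cs 0
  obtain ⟨C1, hC1, H1⟩ := fourier_V2 w K.smooth K.cs 1
  have hC := K.Cpos
  have hR := K.Rpos
  obtain ⟨L, hL⟩ := D.bdd.exists_norm_le
  set L2 := L + ‖x0‖ with hL2
  have hy : ∀ y ∈ Ω, ∀ i, (x0 i - y i) ^ 2 ≤ L2 ^ 2 := by
    intro y hy i
    have h1 := norm_le_pi_norm (x0 - y) i
    have h2 := norm_sub_le x0 y
    have h3 := hL y hy
    rw [Pi.sub_apply, Real.norm_eq_abs] at h1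
    rw [← sq_abs]
    have : |x0 i - y i| ≤ L2 := by rw [hL2]; linarith
    gcongr
  refine ⟨16 * R ^ 3 * Cw + (C0 + C1) * (1 + L2 ^ 2), by positivity, ?_⟩
  intro f g κ S hf hg hκ hS
  have hb2 := D.bdd.prod D.bdd
  have hw := K.smooth
  have cw0 := continuous_pd (i := 0) (hw.of_le top_le1)
  have cw1 := continuous_pd (i := 1) (hw.of_le top_le1)
  have cz := cont_zz
  have cc := cont_cPhi hw
  set I : ℝ → ℝ := fun s => ∫ p in Ω ×ˢ Ω, f p.2 * g p.1 * cPhi w s p with hI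
  have cI : Continuous I := cont_param hb2 (f := fun s (p : V2 × V2) => f p.2 * g p.1 * cPhi w s p) (by fun_prop)
  rw [← intervalIntegral.integral_add_adjacent_intervals (cI.intervalIntegrable 1 2) (cI.intervalIntegrable 2 S)]
  have n1 : 0 ≤ ∫ x in Ω, f x ^ 2 := integral_nonneg fun x => sq_nonneg _
  have n2 : 0 ≤ ∫ x in Ω, g x ^ 2 := integral_nonneg fun x => sq_nonneg _
  set X := κ ^ 2 * (∫ x in Ω, f x ^ 2) + κ⁻¹ ^ 2 * ∫ x in Ω, g x ^ 2 with hX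
  have a1 : |∫ s in (1:ℝ)..2, I s| ≤ 16 * R ^ 3 * Cw * X := by
    have := intervalIntegral.norm_integral_le_of_norm_le_const (a := 1) (b := 2) (f := I) (C := 16 * R ^ 3 * Cw * X) (fun s hs => by
      rw [uIoc_of_le (by norm_num)] at hs
      exact curl_near D K hf hg hκ hs.1.le hs.2)
    rw [Real.norm_eq_abs] at this
    norm_num at this ⊢
    exact this
  have e : ∀ s, I s = s * (∫ p in Ω ×ˢ Ω, (κ⁻¹ * g p.1) * (κ * (f p.2 * (x0 1 - p.2 1))) * pd 0 w (s • p.1 - (s - 1) • p.2))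
      - s * (∫ p in Ω ×ˢ Ω, (κ⁻¹ * g p.1) * (κ * (f p.2 * (x0 0 - p.2 0))) * pd 1 w (s • p.1 - (s - 1) • p.2)) := by
    intro s
    rw [← integral_const_mul, ← integral_const_mul, ← integral_sub (cont_intOn hb2 (by fun_prop)) (cont_intOn hb2 (by fun_prop))]
    simp only [hI]
    congr 1; ext p
    have r := K.rad (zz s p)
    have z0 : zz s p 0 = s * p.1 0 - (s - 1) * p.2 0 := by simp [zz]
    have z1 : zz s p 1 = s * p.1 1 - (s - 1) * p.2 1 := by simp [zz]
    rw [z0, z1] at r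
    have hk : κ⁻¹ * κ = 1 := inv_mul_cancel₀ hκ.ne'
    rw [cPhi]
    change _ = s * ((κ⁻¹ * g p.1) * (κ * (f p.2 * (x0 1 - p.2 1))) * pd 0 w (zz s p)) - s * ((κ⁻¹ * g p.1) * (κ * (f p.2 * (x0 0 - p.2 0))) * pd 1 w (zz s p))
    linear_combination (f p.2 * g p.1 * s) * r - (s * g p.1 * f p.2 * ((x0 1 - p.2 1) * pd 0 w (zz s p) - (x0 0 - p.2 0) * pd 1 w (zz s p))) * hk
  have fb : ∀ (j i : Fin 2) (C : ℝ), 0 ≤ C → (∀ (Ω : Set V2) (g F : V2 → ℝ) (S : ℝ), MeasurableSet Ω → IsBounded Ω → Continuous g → Continuous F → 2 ≤ S →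
      |∫ s in (2:ℝ)..S, s * ∫ p in Ω ×ˢ Ω, g p.1 * F p.2 * pd j w (s • p.1 - (s - 1) • p.2)| ≤ C * ((∫ x in Ω, g x ^ 2) + ∫ x in Ω, F x ^ 2)) →
      |∫ s in (2:ℝ)..S, s * (∫ p in Ω ×ˢ Ω, (κ⁻¹ * g p.1) * (κ * (f p.2 * (x0 i - p.2 i))) * pd j w (s • p.1 - (s - 1) • p.2))| ≤ C * ((1 + L2 ^ 2) * X) := by
    intro j i C hC H
    refine (H Ω (fun x => κ⁻¹ * g x) (fun y => κ * (f y * (x0 i - y i))) S D.meas D.bdd (by fun_prop) (by fun_prop) hS).trans ?_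
    refine mul_le_mul_of_nonneg_left ?_ hC
    have q1 : ∫ x in Ω, (κ⁻¹ * g x) ^ 2 = κ⁻¹ ^ 2 * ∫ x in Ω, g x ^ 2 := by
      simp only [mul_pow]; rw [integral_const_mul]
    have q2 : ∫ x in Ω, (κ * (f x * (x0 i - x i))) ^ 2 ≤ κ ^ 2 * (L2 ^ 2 * ∫ x in Ω, f x ^ 2) := by
      rw [← integral_const_mul, ← integral_const_mul]
      refine setIntegral_mono_on (cont_intOn D.bdd (by fun_prop)) (cont_intOn D.bdd (by fun_prop)) D.meas fun x hx => ?_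
      rw [mul_pow, mul_pow]
      have := hy x hx i
      have h2 : f x ^ 2 * (x0 i - x i) ^ 2 ≤ f x ^ 2 * L2 ^ 2 := by gcongr
      have h3 : f x ^ 2 * (x0 i - x i) ^ 2 ≤ L2 ^ 2 * f x ^ 2 := by linarith
      gcongr
    rw [q1]
    have m1 : 0 ≤ κ ^ 2 * ∫ x in Ω, f x ^ 2 := by positivity
    have m2 : 0 ≤ κ⁻¹ ^ 2 * ∫ x in Ω, g x ^ 2 := by positivity
    have m3 : 0 ≤ L2 ^ 2 * (κ⁻¹ ^ 2 * ∫ x in Ω, g x ^ 2) := by positivity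
    rw [hX]
    nlinarith
  have b0 := fb 0 1 C0 hC0 H0
  have b1 := fb 1 0 C1 hC1 H1
  have ci : ∀ (j i : Fin 2), Continuous fun s : ℝ => s * (∫ p in Ω ×ˢ Ω, (κ⁻¹ * g p.1) * (κ * (f p.2 * (x0 i - p.2 i))) * pd j w (s • p.1 - (s - 1) • p.2)) := by
    intro j i
    have cwj := continuous_pd (i := j) (hw.of_le top_le1)
    refine continuous_id.mul (cont_param hb2 (f := fun s (p : V2 × V2) => (κ⁻¹ * g p.1) * (κ * (f p.2 * (x0 i - p.2 i))) * pd j w (s • p.1 - (s - 1) • p.2)) ?_)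
    fun_prop
  have a2 : |∫ s in (2:ℝ)..S, I s| ≤ C0 * ((1 + L2 ^ 2) * X) + C1 * ((1 + L2 ^ 2) * X) := by
    simp only [e]
    rw [intervalIntegral.integral_sub ((ci 0 1).intervalIntegrable _ _) ((ci 1 0).intervalIntegrable _ _)]
    exact (abs_sub _ _).trans (add_le_add b0 b1)
  refine (abs_add_le _ _).trans ((add_le_add a1 a2).trans (le_of_eq ?_))
  ring


end

section
set_option linter.unusedSimpArgs false

lemma inv_sq_ii {S : ℝ} (hS : 1 ≤ S) : IntervalIntegrable (fun s : ℝ => (s ^ 2)⁻¹) volume 1 S := by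
  apply ContinuousOn.intervalIntegrable
  rw [uIcc_of_le hS]
  intro s hs
  have : s ≠ 0 := by have := hs.1; linarith
  exact ContinuousAt.continuousWithinAt (by fun_prop (disch := positivity))

lemma inv_sq_int {S : ℝ} (hS : 1 ≤ S) : ∫ s in (1:ℝ)..S, (s ^ 2)⁻¹ ≤ 1 := by
  have := intervalIntegral.integral_eq_sub_of_hasDerivAt (a := 1) (b := S) (f := fun s : ℝ => - s⁻¹) (f' := fun s => (s ^ 2)⁻¹)
    (fun s hs => by
      rw [uIcc_of_le hS] at hs
      have h0 : s ≠ 0 := by have := hs.1; linarith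
      simpa using (hasDerivAt_inv h0).fun_neg) (inv_sq_ii hS)
  rw [this]
  have : 0 ≤ S⁻¹ := by positivity
  norm_num
  linarith

lemma key_slice {Ω : Set V2} {φ : V2 → ℝ} (D : Dom Ω φ) {w : V2 → ℝ} {x0 : V2} {R Cw : ℝ} (K : Ker Ω w x0 R Cw) (γ rb pb : ℝ)
    (hrb : 0 ≤ rb) (hpb : 0 ≤ pb) :
    ∃ C : ℝ, 0 ≤ C ∧ ∀ {μ Λ ν : ℝ} {ρ P rt Pt : V2 → ℝ} {u B mt Bt : V2 → V2} {c c' : ℝ},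
      SB Ω φ γ μ Λ ν rb pb ρ P rt Pt u B mt Bt c c' → 0 ≤ μ → ∀ κ S : ℝ, 0 < κ → 2 ≤ S →
      ∫ p in Ω ×ˢ Ω, (P p.2 - c) * w p.1 * (P (p.2 + S⁻¹ • (p.1 - p.2)) - c - Λ * div2 u (p.2 + S⁻¹ • (p.1 - p.2)))
      ≤ (∫ s in (1:ℝ)..S, ∫ p in Ω ×ˢ Ω, ((Pt p.2 - c') * (ρ p.1 * u p.1 0 * Phi w s 0 p + ρ p.1 * u p.1 1 * Phi w s 1 p)
        + (P p.2 - c) * (mt p.1 0 * Phi w s 0 p + mt p.1 1 * Phi w s 1 p)))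
        + C * Dn Ω u B + μ * (C * (κ ^ 2 * (∫ x in Ω, (P x - c) ^ 2) + κ⁻¹ ^ 2 * ∫ x in Ω, curl2 u x ^ 2)) := by
  obtain ⟨C1, hC1, H1⟩ := low D K γ rb pb hrb hpb
  obtain ⟨C2, hC2, H2⟩ := curl_term D K
  refine ⟨C1 + C2, by positivity, ?_⟩
  intro μ Λ ν ρ P rt Pt u B mt Bt c c' h hμ κ S hκ hS
  have L := h.S
  have hb2 := D.bdd.prod D.bdd
  have hw := K.smooth
  have cw := hw.continuous
  have cP := L.cP.continuous
  have cPt := L.cPt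
  have cr := L.cρ.continuous
  have u0 := (L.cu 0).continuous
  have u1 := (L.cu 1).continuous
  have m0 := L.cmt 0
  have m1 := L.cmt 1
  have dc := (contDiff_div2 L.cu).continuous
  have wc := (contDiff_curl2 L.cu).continuous
  have cF0 := cont_Phi cw 0
  have cF1 := cont_Phi cw 1
  have cd := cont_dPhi hw
  have cc := cont_cPhi hw
  have hS1 : 1 ≤ S := by linarith
  have h0 : ∫ x in Ω, (P x - c) = 0 := by
    rw [integral_sub (cont_intOn D.bdd cP) (cont_intOn D.bdd continuous_const), ← h.hc]
    simp [mul_comm]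
  have mt' := main_term D K (f := fun x => P x - c) (q := fun x => P x - c - Λ * div2 u x) (by fun_prop) (by fun_prop) h0 hS1
  have ct := H2 (fun x => P x - c) (curl2 u) κ S (by fun_prop) wc hκ hS
  set Y := κ ^ 2 * (∫ x in Ω, (P x - c) ^ 2) + κ⁻¹ ^ 2 * ∫ x in Ω, curl2 u x ^ 2 with hY
  have n1 : 0 ≤ ∫ x in Ω, (P x - c) ^ 2 := integral_nonneg fun x => sq_nonneg _
  have n2 : 0 ≤ ∫ x in Ω, curl2 u x ^ 2 := integral_nonneg fun x => sq_nonneg _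
  have hY0 : 0 ≤ Y := by rw [hY]; positivity
  have hD0 : 0 ≤ Dn Ω u B := integral_nonneg fun x => by positivity
  rw [← mt']
  set ps : ℝ → ℝ := fun s => ∫ p in Ω ×ˢ Ω, ((Pt p.2 - c') * (ρ p.1 * u p.1 0 * Phi w s 0 p + ρ p.1 * u p.1 1 * Phi w s 1 p)
        + (P p.2 - c) * (mt p.1 0 * Phi w s 0 p + mt p.1 1 * Phi w s 1 p)) with hps
  set mn : ℝ → ℝ := fun s => ∫ p in Ω ×ˢ Ω, (P p.2 - c) * (P p.1 - c - Λ * div2 u p.1) * dPhi w s p with hmn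
  set cu : ℝ → ℝ := fun s => ∫ p in Ω ×ˢ Ω, (P p.2 - c) * curl2 u p.1 * cPhi w s p with hcu
  have ips : Continuous ps := cont_param hb2 (f := fun s (p : V2 × V2) => ((Pt p.2 - c') * (ρ p.1 * u p.1 0 * Phi w s 0 p + ρ p.1 * u p.1 1 * Phi w s 1 p)
        + (P p.2 - c) * (mt p.1 0 * Phi w s 0 p + mt p.1 1 * Phi w s 1 p))) (by fun_prop)
  have imn : Continuous mn := cont_param hb2 (f := fun s (p : V2 × V2) => (P p.2 - c) * (P p.1 - c - Λ * div2 u p.1) * dPhi w s p) (by fun_prop)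
  have icu : Continuous cu := cont_param hb2 (f := fun s (p : V2 × V2) => (P p.2 - c) * curl2 u p.1 * cPhi w s p) (by fun_prop)
  have i1 : IntervalIntegrable (fun s => ps s + μ * cu s) volume 1 S := (by fun_prop : Continuous fun s => ps s + μ * cu s).intervalIntegrable _ _
  have i2 : IntervalIntegrable (fun s : ℝ => (C1 * Dn Ω u B) * (s ^ 2)⁻¹) volume 1 S := (inv_sq_ii hS1).const_mul _
  have key : ∫ s in (1:ℝ)..S, mn s ≤ ∫ s in (1:ℝ)..S, ((ps s + μ * cu s) + (C1 * Dn Ω u B) * (s ^ 2)⁻¹) := by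
    refine intervalIntegral.integral_mono_on hS1 (imn.intervalIntegrable _ _) (i1.add i2) fun s hs => ?_
    have e := L.ident K c c' hs.1
    have l := H1 h s hs.1
    have l2 := (abs_le.1 l).1
    have e' : ps s = _ := e
    simp only [hmn, hcu]
    rw [e']
    linarith
  rw [intervalIntegral.integral_add i1 i2, intervalIntegral.integral_add (ips.intervalIntegrable _ _) ((icu.const_mul μ).intervalIntegrable _ _),
    intervalIntegral.integral_const_mul, intervalIntegral.integral_const_mul] at key
  have q1 : C1 * Dn Ω u B * ∫ s in (1:ℝ)..S, (s ^ 2)⁻¹ ≤ C1 * Dn Ω u B * 1 :=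
    mul_le_mul_of_nonneg_left (inv_sq_int hS1) (by positivity)
  have q2 : μ * ∫ s in (1:ℝ)..S, cu s ≤ μ * (C2 * Y) := mul_le_mul_of_nonneg_left ((le_abs_self _).trans ct) hμ
  have q3 : 0 ≤ C2 * Dn Ω u B := by positivity
  have q4 : 0 ≤ μ * (C1 * Y) := by positivity
  change ∫ s in (1:ℝ)..S, mn s ≤ _
  nlinarith

end

section
set_option linter.unusedSimpArgs false

/-- A time dependent solution, in a convenient form. -/
structure Flow (Ω : Set V2) (φ : V2 → ℝ) (γ μ Λ ν rb pb T : ℝ) (ρ P : ℝ → V2 → ℝ) (u B : ℝ → V2 → V2) : Prop where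
  dom : Dom Ω φ
  hT : 0 < T
  cρ : ContDiff ℝ 1 (fun p : ℝ × V2 => ρ p.1 p.2)
  cP : ContDiff ℝ 1 (fun p : ℝ × V2 => P p.1 p.2)
  cu : ∀ i, ContDiff ℝ 1 (fun p : ℝ × V2 => u p.1 p.2 i)
  cB : ∀ i, ContDiff ℝ 1 (fun p : ℝ × V2 => B p.1 p.2 i)
  sl : ∀ t ∈ Ioc 0 T, Slice Ω φ γ μ Λ ν (ρ t) (P t) (dt ρ t) (dt P t) (u t) (B t)
    (fun x i => dt (fun s y => ρ s y * u s y i) t x) (dtV B t)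
  r0 : ∀ t ∈ Icc 0 T, ∀ x ∈ Ω, 0 ≤ ρ t x
  r1 : ∀ t ∈ Icc 0 T, ∀ x ∈ Ω, ρ t x ≤ rb
  p0 : ∀ t ∈ Icc 0 T, ∀ x ∈ Ω, 0 ≤ P t x
  p1 : ∀ t ∈ Icc 0 T, ∀ x ∈ Ω, P t x ≤ pb

/-- Total energy. -/
def En (Ω : Set V2) (γ : ℝ) (ρ P : ℝ → V2 → ℝ) (u B : ℝ → V2 → V2) (t : ℝ) : ℝ :=
  ∫ x in Ω, (ρ t x * nsq (u t x) / 2 + nsq (B t x) / 2 + P t x / (γ - 1))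

section
variable {Ω : Set V2} {φ : V2 → ℝ} {γ μ Λ ν rb pb T : ℝ} {ρ P : ℝ → V2 → ℝ} {u B : ℝ → V2 → V2}

lemma Flow.cdiv (F : Flow Ω φ γ μ Λ ν rb pb T ρ P u B) : Continuous (fun p : ℝ × V2 => div2 (u p.1) p.2) := by
  have e : ∀ p : ℝ × V2, div2 (u p.1) p.2 = pd 0 (fun y => u p.1 y 0) p.2 + pd 1 (fun y => u p.1 y 1) p.2 := by
    intro p; simp [div2]
  simp only [e]
  exact (cont_pd2 (f := fun t x => u t x 0) (F.cu 0) 0).add (cont_pd2 (f := fun t x => u t x 1) (F.cu 1) 1)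

lemma Flow.ccurl (F : Flow Ω φ γ μ Λ ν rb pb T ρ P u B) : Continuous (fun p : ℝ × V2 => curl2 (u p.1) p.2) := by
  simp only [curl2]
  exact (cont_pd2 (f := fun t x => u t x 1) (F.cu 1) 0).sub (cont_pd2 (f := fun t x => u t x 0) (F.cu 0) 1)

lemma Flow.ccurlB (F : Flow Ω φ γ μ Λ ν rb pb T ρ P u B) : Continuous (fun p : ℝ × V2 => curl2 (B p.1) p.2) := by
  simp only [curl2]
  exact (cont_pd2 (f := fun t x => B t x 1) (F.cB 1) 0).sub (cont_pd2 (f := fun t x => B t x 0) (F.cB 0) 1)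

lemma Flow.cmom (F : Flow Ω φ γ μ Λ ν rb pb T ρ P u B) (i : Fin 2) :
    ContDiff ℝ 1 (fun p : ℝ × V2 => ρ p.1 p.2 * u p.1 p.2 i) := F.cρ.mul (F.cu i)

lemma Flow.mom_eq (F : Flow Ω φ γ μ Λ ν rb pb T ρ P u B) (i : Fin 2) (t : ℝ) (x : V2) :
    dt (fun s y => ρ s y * u s y i) t x = dt ρ t x * u t x i + ρ t x * dt (fun s y => u s y i) t x :=
  (hasDeriv_dt (f := fun s y => ρ s y * u s y i) (F.cmom i) t x).unique
    ((hasDeriv_dt F.cρ t x).mul (hasDeriv_dt (f := fun s y => u s y i) (F.cu i) t x))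

lemma Flow.energy (hγ : 1 < γ) (F : Flow Ω φ γ μ Λ ν rb pb T ρ P u B) :
    En Ω γ ρ P u B T + ∫ t in (0:ℝ)..T, ∫ x in Ω, (Λ * div2 (u t) x ^ 2 + μ * curl2 (u t) x ^ 2 + ν * curl2 (B t) x ^ 2)
      ≤ En Ω γ ρ P u B 0 := by
  have D := F.dom
  have r := F.cρ.continuous
  have pc := F.cP.continuous
  have u0 := (F.cu 0).continuous
  have u1 := (F.cu 1).continuous
  have b0 := (F.cB 0).continuous
  have b1 := (F.cB 1).continuous
  have dr := cont_dt F.cρ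
  have dP := cont_dt F.cP
  have dm0 := cont_dt (f := fun s y => ρ s y * u s y 0) (F.cmom 0)
  have dm1 := cont_dt (f := fun s y => ρ s y * u s y 1) (F.cmom 1)
  have db0 := cont_dt (f := fun s y => B s y 0) (F.cB 0)
  have db1 := cont_dt (f := fun s y => B s y 1) (F.cB 1)
  have cd := F.cdiv
  have cc := F.ccurl
  have cb := F.ccurlB
  set H' : ℝ → V2 → ℝ := fun t x => dt (fun s y => ρ s y * u s y 0) t x * u t x 0 + dt (fun s y => ρ s y * u s y 1) t x * u t x 1
    - dt ρ t x * nsq (u t x) / 2 + dtV B t x 0 * B t x 0 + dtV B t x 1 * B t x 1 + dt P t x / (γ - 1) with hH'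
  have cH' : Continuous (fun p : ℝ × V2 => H' p.1 p.2) := by
    simp only [hH', nsq, dtV, Fin.sum_univ_two]; fun_prop
  have hd : ∀ t, HasDerivAt (En Ω γ ρ P u B) (∫ x in Ω, H' t x) t := by
    refine deriv_param (H := fun t x => ρ t x * nsq (u t x) / 2 + nsq (B t x) / 2 + P t x / (γ - 1)) D.bdd D.meas ?_ cH' ?_
    · simp only [nsq, Fin.sum_univ_two]; fun_prop
    · intro t x
      have hr := hasDeriv_dt F.cρ t x
      have hP := hasDeriv_dt F.cP t x
      have hu0 := hasDeriv_dt (f := fun s y => u s y 0) (F.cu 0) t x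
      have hu1 := hasDeriv_dt (f := fun s y => u s y 1) (F.cu 1) t x
      have hB0 := hasDeriv_dt (f := fun s y => B s y 0) (F.cB 0) t x
      have hB1 := hasDeriv_dt (f := fun s y => B s y 1) (F.cB 1) t x
      simp only [nsq, Fin.sum_univ_two]
      have := ((((hr.fun_mul ((hu0.fun_pow 2).fun_add (hu1.fun_pow 2))).div_const 2).fun_add
        (((hB0.fun_pow 2).fun_add (hB1.fun_pow 2)).div_const 2)).fun_add (hP.div_const (γ - 1)))
      refine this.congr_deriv ?_
      simp only [hH', F.mom_eq, nsq, dtV, Fin.sum_univ_two]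
      push_cast
      ring
  have cE : Continuous fun t => ∫ x in Ω, H' t x := cont_param D.bdd cH'
  have f := ftc hd cE 0 T
  have cG : Continuous fun t => ∫ x in Ω, (Λ * div2 (u t) x ^ 2 + μ * curl2 (u t) x ^ 2 + ν * curl2 (B t) x ^ 2) :=
    cont_param D.bdd (f := fun t x => Λ * div2 (u t) x ^ 2 + μ * curl2 (u t) x ^ 2 + ν * curl2 (B t) x ^ 2) (by fun_prop)
  have m := intervalIntegral.integral_mono_on_of_le_Ioo F.hT.le (cE.intervalIntegrable (μ := volume) 0 T) (cG.neg.intervalIntegrable (μ := volume) 0 T)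
    (fun t ht => ((F.sl t ⟨ht.1, ht.2.le⟩).energy hγ).le)
  rw [f] at m
  have : ∫ t in (0:ℝ)..T, (-fun t => ∫ x in Ω, (Λ * div2 (u t) x ^ 2 + μ * curl2 (u t) x ^ 2 + ν * curl2 (B t) x ^ 2)) t
    = - ∫ t in (0:ℝ)..T, ∫ x in Ω, (Λ * div2 (u t) x ^ 2 + μ * curl2 (u t) x ^ 2 + ν * curl2 (B t) x ^ 2) :=
    intervalIntegral.integral_neg
  linarith

lemma Flow.kin_le (hγ : 1 < γ) (F : Flow Ω φ γ μ Λ ν rb pb T ρ P u B) {t : ℝ} (ht : t ∈ Icc 0 T) :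
    ∫ x in Ω, ρ t x * nsq (u t x) / 2 ≤ En Ω γ ρ P u B t := by
  have D := F.dom
  have e : ∀ {f : ℝ × V2 → ℝ}, Continuous f → Continuous fun x => f (t, x) := fun h => h.comp (by fun_prop)
  have r := e F.cρ.continuous
  have pc := e F.cP.continuous
  have u0 := e (F.cu 0).continuous
  have u1 := e (F.cu 1).continuous
  have b0 := e (F.cB 0).continuous
  have b1 := e (F.cB 1).continuous
  dsimp only at r pc u0 u1 b0 b1
  unfold En
  simp only [nsq, Fin.sum_univ_two]
  refine setIntegral_mono_on (cont_intOn D.bdd (by fun_prop)) (cont_intOn D.bdd (by fun_prop)) D.meas fun x hx => ?_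
  have h1 := F.p0 t ht x hx
  have h2 : 0 ≤ P t x / (γ - 1) := div_nonneg h1 (by linarith)
  have h3 : 0 ≤ (B t x 0 ^ 2 + B t x 1 ^ 2) / 2 := by positivity
  linarith

lemma Flow.avg_bd (F : Flow Ω φ γ μ Λ ν rb pb T ρ P u B) {t : ℝ} (ht : t ∈ Icc 0 T) {x : V2} (hx : x ∈ Ω) :
    |P t x - avg Ω (P t)| ≤ pb := by
  have D := F.dom
  have hv := D.vol_pos
  have pc : Continuous (P t) := F.cP.continuous.comp (by fun_prop : Continuous fun x : V2 => (t, x))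
  have h1 : 0 ≤ ∫ x in Ω, P t x := setIntegral_nonneg D.meas (F.p0 t ht)
  have h2 : ∫ x in Ω, P t x ≤ pb * volume.real Ω := by
    have := setIntegral_mono_on (cont_intOn (μ := volume) D.bdd pc) (cont_intOn D.bdd continuous_const) D.meas (F.p1 t ht)
    rw [setIntegral_const] at this
    rw [mul_comm]; simpa using this
  have h3 : 0 ≤ avg Ω (P t) := div_nonneg h1 hv.le
  have h4 : avg Ω (P t) ≤ pb := (div_le_iff₀ hv).2 h2
  have := F.p0 t ht x hx
  have := F.p1 t ht x hx
  rw [abs_le]; constructor <;> linarith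

lemma Flow.sb (F : Flow Ω φ γ μ Λ ν rb pb T ρ P u B) {t : ℝ} (ht : t ∈ Ioc 0 T) :
    SB Ω φ γ μ Λ ν rb pb (ρ t) (P t) (dt ρ t) (dt P t) (u t) (B t)
    (fun x i => dt (fun s y => ρ s y * u s y i) t x) (dtV B t) (avg Ω (P t)) (avg Ω (dt P t)) where
  S := F.sl t ht
  r0 := F.r0 t ⟨ht.1.le, ht.2⟩
  r1 := F.r1 t ⟨ht.1.le, ht.2⟩
  p0 := F.p0 t ⟨ht.1.le, ht.2⟩
  p1 := F.p1 t ⟨ht.1.le, ht.2⟩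
  hc := div_mul_cancel₀ _ F.dom.vol_pos.ne'
  hc' := div_mul_cancel₀ _ F.dom.vol_pos.ne'

lemma Flow.avg_deriv (F : Flow Ω φ γ μ Λ ν rb pb T ρ P u B) (t : ℝ) :
    HasDerivAt (fun s => avg Ω (P s)) (avg Ω (dt P t)) t :=
  (deriv_param F.dom.bdd F.dom.meas F.cP.continuous (cont_dt F.cP) (fun t y => hasDeriv_dt F.cP t y) t).div_const _

lemma Flow.avg_cont (F : Flow Ω φ γ μ Λ ν rb pb T ρ P u B) : Continuous (fun s => avg Ω (P s)) :=
  (cont_param F.dom.bdd F.cP.continuous).div_const _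

lemma Flow.avg_cont' (F : Flow Ω φ γ μ Λ ν rb pb T ρ P u B) : Continuous (fun s => avg Ω (dt P s)) :=
  (cont_param F.dom.bdd (cont_dt F.cP)).div_const _
end

end

section
set_option linter.unusedSimpArgs false

lemma time_bd {Ω : Set V2} {φ : V2 → ℝ} (D : Dom Ω φ) (γ rb pb : ℝ) (hγ : 1 < γ)
    (hrb : 0 ≤ rb) (hpb : 0 ≤ pb) :
    ∃ C : ℝ, 0 ≤ C ∧ ∀ {μ Λ ν T : ℝ} {ρ P : ℝ → V2 → ℝ} {u B : ℝ → V2 → V2},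
      Flow Ω φ γ μ Λ ν rb pb T ρ P u B → 0 ≤ μ → 0 ≤ Λ → 0 ≤ ν → ∀ κ : ℝ, 0 < κ →
      ∫ t in (0:ℝ)..T, ∫ x in Ω, (P t x - avg Ω (P t)) * (P t x - avg Ω (P t) - Λ * div2 (u t) x)
      ≤ C * (1 + En Ω γ ρ P u B 0) + ∫ t in (0:ℝ)..T, (C * Dn Ω (u t) (B t)
        + μ * (C * (κ ^ 2 * (∫ x in Ω, (P t x - avg Ω (P t)) ^ 2) + κ⁻¹ ^ 2 * ∫ x in Ω, curl2 (u t) x ^ 2))) := by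
  obtain ⟨w, x0, R, Cw, K⟩ := exists_ker D
  obtain ⟨C1, hC1, H1⟩ := key_slice D K γ rb pb hrb hpb
  have hCw := K.Cpos
  have hR := K.Rpos
  have hv := D.vol_pos
  set q0 := 4 * pb * R ^ 3 * Cw with hq0
  have hq0' : 0 ≤ q0 := by rw [hq0]; positivity
  refine ⟨C1 + 2 * q0 * (rb * volume.real Ω + 1), by positivity, ?_⟩
  intro μ Λ ν T ρ P u B F hμ hΛ hν κ hκ
  have hT := F.hT
  have hb2 := D.bdd.prod D.bdd
  have hw := K.smooth
  have cw := hw.continuous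
  have r := F.cρ.continuous
  have pc := F.cP.continuous
  have u0 := (F.cu 0).continuous
  have u1 := (F.cu 1).continuous
  have dr := cont_dt F.cρ
  have dP := cont_dt F.cP
  have dm0 := cont_dt (f := fun s y => ρ s y * u s y 0) (F.cmom 0)
  have dm1 := cont_dt (f := fun s y => ρ s y * u s y 1) (F.cmom 1)
  have cd := F.cdiv
  have cc := F.ccurl
  have cb := F.ccurlB
  have ca := F.avg_cont
  have ca' := F.avg_cont'
  obtain ⟨av, hav⟩ : ∃ av : ℝ → ℝ, ∀ t, avg Ω (P t) = av t := ⟨_, fun _ => rfl⟩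
  obtain ⟨av', hav'⟩ : ∃ av : ℝ → ℝ, ∀ t, avg Ω (dt P t) = av t := ⟨_, fun _ => rfl⟩
  obtain ⟨dv, hdv⟩ : ∃ dv : ℝ → V2 → ℝ, ∀ t x, div2 (u t) x = dv t x := ⟨_, fun _ _ => rfl⟩
  have cdv : Continuous fun p : ℝ × V2 => dv p.1 p.2 := by simpa only [hdv] using cd
  simp only [hav] at ca
  simp only [hav'] at ca'
  have cF0 := cont_Phi cw 0
  have cF1 := cont_Phi cw 1
  set E0 := En Ω γ ρ P u B 0 with hE0
  -- kinetic energies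
  have k0 : ∫ x in Ω, ρ 0 x * nsq (u 0 x) / 2 ≤ E0 := F.kin_le hγ ⟨le_rfl, hT.le⟩
  have kn : 0 ≤ ∫ x in Ω, ρ 0 x * nsq (u 0 x) / 2 := setIntegral_nonneg D.meas fun x hx => by
    have := F.r0 0 ⟨le_rfl, hT.le⟩ x hx
    simp only [nsq, Fin.sum_univ_two]; positivity
  have E0n : 0 ≤ E0 := kn.trans k0
  have kT : ∫ x in Ω, ρ T x * nsq (u T x) / 2 ≤ E0 := by
    have h1 := F.kin_le hγ (t := T) ⟨hT.le, le_rfl⟩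
    have h2 := F.energy hγ
    have h3 : 0 ≤ ∫ t in (0:ℝ)..T, ∫ x in Ω, (Λ * div2 (u t) x ^ 2 + μ * curl2 (u t) x ^ 2 + ν * curl2 (B t) x ^ 2) :=
      intervalIntegral.integral_nonneg hT.le fun t _ => integral_nonneg fun x => by positivity
    linarith
  -- the potential
  set psi : ℝ → ℝ → ℝ := fun s t => ∫ p in Ω ×ˢ Ω, (P t p.2 - avg Ω (P t)) * (ρ t p.1 * u t p.1 0 * Phi w s 0 p + ρ t p.1 * u t p.1 1 * Phi w s 1 p) with hpsi
  set psit : ℝ → ℝ → ℝ := fun s t => ∫ p in Ω ×ˢ Ω, ((dt P t p.2 - avg Ω (dt P t)) * (ρ t p.1 * u t p.1 0 * Phi w s 0 p + ρ t p.1 * u t p.1 1 * Phi w s 1 p)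
        + (P t p.2 - avg Ω (P t)) * (dt (fun s y => ρ s y * u s y 0) t p.1 * Phi w s 0 p + dt (fun s y => ρ s y * u s y 1) t p.1 * Phi w s 1 p)) with hpsit
  have cpsit : Continuous (fun q : ℝ × ℝ => psit q.1 q.2) :=
    cont_param hb2 (f := fun (q : ℝ × ℝ) (p : V2 × V2) => ((dt P q.2 p.2 - avg Ω (dt P q.2)) * (ρ q.2 p.1 * u q.2 p.1 0 * Phi w q.1 0 p + ρ q.2 p.1 * u q.2 p.1 1 * Phi w q.1 1 p)
        + (P q.2 p.2 - avg Ω (P q.2)) * (dt (fun s y => ρ s y * u s y 0) q.2 p.1 * Phi w q.1 0 p + dt (fun s y => ρ s y * u s y 1) q.2 p.1 * Phi w q.1 1 p))) (by simp only [hav, hav']; fun_prop)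
  have cpsi : ∀ t, Continuous (fun s => psi s t) := fun t =>
    cont_param hb2 (f := fun (s : ℝ) (p : V2 × V2) => (P t p.2 - avg Ω (P t)) * (ρ t p.1 * u t p.1 0 * Phi w s 0 p + ρ t p.1 * u t p.1 1 * Phi w s 1 p)) (by simp only [hav, hav']; fun_prop)
  have dpsi : ∀ s t, HasDerivAt (psi s) (psit s t) t := by
    intro s t
    refine deriv_param (H := fun t (p : V2 × V2) => (P t p.2 - avg Ω (P t)) * (ρ t p.1 * u t p.1 0 * Phi w s 0 p + ρ t p.1 * u t p.1 1 * Phi w s 1 p))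
      (H' := fun t p => ((dt P t p.2 - avg Ω (dt P t)) * (ρ t p.1 * u t p.1 0 * Phi w s 0 p + ρ t p.1 * u t p.1 1 * Phi w s 1 p)
        + (P t p.2 - avg Ω (P t)) * (dt (fun s y => ρ s y * u s y 0) t p.1 * Phi w s 0 p + dt (fun s y => ρ s y * u s y 1) t p.1 * Phi w s 1 p)))
      hb2 (D.meas.prod D.meas) (by simp only [hav, hav']; fun_prop) (by simp only [hav, hav']; fun_prop) (fun t p => ?_) t
    exact ((hasDeriv_dt F.cP t p.2).fun_sub (F.avg_deriv t)).fun_mul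
      (((hasDeriv_dt (f := fun s y => ρ s y * u s y 0) (F.cmom 0) t p.1).mul_const _).fun_add
        ((hasDeriv_dt (f := fun s y => ρ s y * u s y 1) (F.cmom 1) t p.1).mul_const _))
  have slice2 : ∀ {f : ℝ × V2 → ℝ} (t : ℝ), Continuous f → Continuous fun x => f (t, x) := fun t h => h.comp (by fun_prop)
  have psib : ∀ t ∈ Icc 0 T, (∫ x in Ω, ρ t x * nsq (u t x) / 2) ≤ E0 → ∀ s, 1 ≤ s → |psi s t| ≤ (q0 * (rb * volume.real Ω + E0)) * (s ^ 2)⁻¹ := by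
    intro t ht hk s hs
    have := psi_bd D K (slice2 t r) (slice2 t pc) (slice2 t u0) (slice2 t u1) (F.r0 t ht) (F.r1 t ht) (fun x hx => F.avg_bd ht hx) hs
    refine this.trans ?_
    have h0 : 0 ≤ (s ^ 2)⁻¹ := by positivity
    calc _ ≤ 4 * pb * R ^ 3 * Cw * (s ^ 2)⁻¹ * (rb * volume.real Ω + E0) := by gcongr
      _ = _ := by rw [hq0]; ring
  -- the averaged quantity
  set A : ℝ → ℝ := fun ε => ∫ t in (0:ℝ)..T, ∫ p in Ω ×ˢ Ω, (P t p.2 - avg Ω (P t)) * w p.1 *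
    (P t (p.2 + ε • (p.1 - p.2)) - avg Ω (P t) - Λ * div2 (u t) (p.2 + ε • (p.1 - p.2))) with hA
  have cA1 : Continuous (fun q : ℝ × ℝ => ∫ p in Ω ×ˢ Ω, (P q.2 p.2 - avg Ω (P q.2)) * w p.1 *
    (P q.2 (p.2 + q.1 • (p.1 - p.2)) - avg Ω (P q.2) - Λ * div2 (u q.2) (p.2 + q.1 • (p.1 - p.2)))) :=
    cont_param hb2 (f := fun (q : ℝ × ℝ) (p : V2 × V2) => (P q.2 p.2 - avg Ω (P q.2)) * w p.1 *
      (P q.2 (p.2 + q.1 • (p.1 - p.2)) - avg Ω (P q.2) - Λ * div2 (u q.2) (p.2 + q.1 • (p.1 - p.2)))) (by simp only [hav, hdv]; fun_prop)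
  have cA : Continuous A := by
    simp only [hA, intervalIntegral.integral_of_le hT.le]
    exact cont_param (Metric.isBounded_Ioc 0 T) cA1
  have A0 : A 0 = ∫ t in (0:ℝ)..T, ∫ x in Ω, (P t x - avg Ω (P t)) * (P t x - avg Ω (P t) - Λ * div2 (u t) x) := by
    simp only [hA]
    congr 1; ext t
    have c1 := slice2 t pc
    have c2 := slice2 t cd
    dsimp only at c1 c2
    rw [dbl_yx D.bdd (by fun_prop)]
    simp only [zero_smul, add_zero]
    congr 1; ext y
    have : ∀ x, (P t y - avg Ω (P t)) * w x * (P t y - avg Ω (P t) - Λ * div2 (u t) y)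
      = ((P t y - avg Ω (P t)) * (P t y - avg Ω (P t) - Λ * div2 (u t) y)) * w x := fun x => by ring
    simp only [this, integral_const_mul, K.int1, mul_one]
  -- the remainder
  set Gr : ℝ → ℝ → ℝ := fun C t => C * Dn Ω (u t) (B t)
        + μ * (C * (κ ^ 2 * (∫ x in Ω, (P t x - avg Ω (P t)) ^ 2) + κ⁻¹ ^ 2 * ∫ x in Ω, curl2 (u t) x ^ 2)) with hGr
  have cDn : Continuous fun t => Dn Ω (u t) (B t) :=
    cont_param D.bdd (f := fun t x => div2 (u t) x ^ 2 + curl2 (u t) x ^ 2 + curl2 (B t) x ^ 2) (by fun_prop)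
  have cf2 : Continuous fun t => ∫ x in Ω, (P t x - avg Ω (P t)) ^ 2 :=
    cont_param D.bdd (f := fun t x => (P t x - avg Ω (P t)) ^ 2) (by simp only [hav, hav']; fun_prop)
  have cw2 : Continuous fun t => ∫ x in Ω, curl2 (u t) x ^ 2 :=
    cont_param D.bdd (f := fun t x => curl2 (u t) x ^ 2) (by fun_prop)
  have cGr : ∀ C, Continuous (Gr C) := by intro C; simp only [hGr]; fun_prop
  have main : ∀ S : ℝ, 2 ≤ S → A S⁻¹ ≤ 2 * (q0 * (rb * volume.real Ω + E0)) + ∫ t in (0:ℝ)..T, Gr C1 t := by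
    intro S hS
    have hS1 : 1 ≤ S := by linarith
    have cI : Continuous fun t => ∫ s in (1:ℝ)..S, psit s t := by
      simp only [intervalIntegral.integral_of_le hS1]
      exact cont_param (Metric.isBounded_Ioc 1 S) (f := fun t s => psit s t) (cpsit.comp (by fun_prop : Continuous fun q : ℝ × ℝ => (q.2, q.1)))
    have cA2 : Continuous fun t => ∫ p in Ω ×ˢ Ω, (P t p.2 - avg Ω (P t)) * w p.1 *
      (P t (p.2 + S⁻¹ • (p.1 - p.2)) - avg Ω (P t) - Λ * div2 (u t) (p.2 + S⁻¹ • (p.1 - p.2))) :=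
      cA1.comp (by fun_prop : Continuous fun t : ℝ => (S⁻¹, t))
    have m : A S⁻¹ ≤ ∫ t in (0:ℝ)..T, ((∫ s in (1:ℝ)..S, psit s t) + Gr C1 t) := by
      refine intervalIntegral.integral_mono_on_of_le_Ioo hT.le (cA2.intervalIntegrable _ _) ((cI.add (cGr C1)).intervalIntegrable _ _) fun t ht => ?_
      have := H1 (F.sb ⟨ht.1, ht.2.le⟩) hμ κ S hκ hS
      simp only [hGr, hpsit]
      linarith
    rw [intervalIntegral.integral_add (cI.intervalIntegrable _ _) ((cGr C1).intervalIntegrable _ _),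
      ← swap_int cpsit hS1 hT.le] at m
    have e : ∀ s, ∫ t in (0:ℝ)..T, psit s t = psi s T - psi s 0 := fun s =>
      ftc (dpsi s) (cpsit.comp (by fun_prop : Continuous fun t : ℝ => (s, t))) 0 T
    simp only [e] at m
    have b : ∫ s in (1:ℝ)..S, (psi s T - psi s 0) ≤ ∫ s in (1:ℝ)..S, (2 * (q0 * (rb * volume.real Ω + E0))) * (s ^ 2)⁻¹ := by
      refine intervalIntegral.integral_mono_on hS1 (((cpsi T).sub (cpsi 0)).intervalIntegrable _ _) ((inv_sq_ii hS1).const_mul _) fun s hs => ?_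
      have b1 := (abs_le.1 (psib T ⟨hT.le, le_rfl⟩ kT s hs.1)).2
      have b2 := (abs_le.1 (psib 0 ⟨le_rfl, hT.le⟩ k0 s hs.1)).1
      linarith
    rw [intervalIntegral.integral_const_mul] at b
    have b' : (2 * (q0 * (rb * volume.real Ω + E0))) * (∫ s in (1:ℝ)..S, (s ^ 2)⁻¹) ≤ (2 * (q0 * (rb * volume.real Ω + E0))) * 1 :=
      mul_le_mul_of_nonneg_left (inv_sq_int hS1) (by positivity)
    linarith
  have lim : Tendsto (fun S : ℝ => A S⁻¹) atTop (𝓝 (A 0)) := (cA.tendsto 0).comp tendsto_inv_atTop_zero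
  have fin := le_of_tendsto lim (eventually_atTop.2 ⟨2, main⟩)
  rw [A0] at fin
  refine fin.trans (add_le_add ?_ ?_)
  · have h1 : 0 ≤ rb * volume.real Ω := by positivity
    have h2 : 0 ≤ C1 * (1 + E0) := by positivity
    have h3 : q0 * (rb * volume.real Ω + E0) ≤ q0 * ((rb * volume.real Ω + 1) * (1 + E0)) := by
      refine mul_le_mul_of_nonneg_left ?_ hq0'
      nlinarith [mul_nonneg h1 E0n]
    linarith
  · refine intervalIntegral.integral_mono_on hT.le ((cGr _).intervalIntegrable _ _) ((cGr _).intervalIntegrable _ _) fun t _ => ?_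
    have n0 : 0 ≤ 2 * q0 * (rb * volume.real Ω + 1) := by positivity
    have n1 : 0 ≤ ∫ x in Ω, (P t x - avg Ω (P t)) ^ 2 := integral_nonneg fun x => sq_nonneg _
    have n2 : 0 ≤ ∫ x in Ω, curl2 (u t) x ^ 2 := integral_nonneg fun x => sq_nonneg _
    have n3 : 0 ≤ Dn Ω (u t) (B t) := integral_nonneg fun x => by positivity
    have n4 : C1 ≤ C1 + 2 * q0 * (rb * volume.real Ω + 1) := by linarith
    simp only [hGr]
    gcongr

end

section
set_option linter.unusedSimpArgs false

set_option maxHeartbeats 800000 in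
lemma flow_bd {Ω : Set V2} {φ : V2 → ℝ} (D : Dom Ω φ) (γ rb pb μ ν : ℝ) (hγ : 1 < γ)
    (hrb : 0 ≤ rb) (hpb : 0 ≤ pb) (hμ : 0 < μ) (hν : 0 < ν) :
    ∃ C : ℝ, 0 ≤ C ∧ ∀ {Λ T : ℝ} {ρ P : ℝ → V2 → ℝ} {u B : ℝ → V2 → V2},
      Flow Ω φ γ μ Λ ν rb pb T ρ P u B → 1 ≤ Λ →
      ∫ t in (0:ℝ)..T, ∫ x in Ω, (P t x - avg Ω (P t)) ^ 2 ≤ C * Λ * (1 + En Ω γ ρ P u B 0) := by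
  obtain ⟨C, hC, H⟩ := time_bd D γ rb pb hγ hrb hpb
  set κ := (2 * (μ * C + 1))⁻¹ with hκ
  have hκ0 : 0 < κ := by rw [hκ]; positivity
  have hκ1 : μ * C * κ ^ 2 ≤ 1 / 4 := by
    have h0 : 0 ≤ μ * C := by positivity
    rw [hκ, inv_pow, ← div_eq_mul_inv, div_le_iff₀ (by positivity)]
    nlinarith
  refine ⟨4 * (1 / 2 + C + C * (1 + μ⁻¹ + ν⁻¹) + C * κ⁻¹ ^ 2), by positivity, ?_⟩
  intro Λ T ρ P u B F hΛ
  have hT := F.hT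
  have pc := F.cP.continuous
  have cd := F.cdiv
  have cc := F.ccurl
  have cb := F.ccurlB
  have ca := F.avg_cont
  have main := H F hμ.le (by linarith) hν.le κ hκ0
  have en := F.energy hγ
  set E0 := En Ω γ ρ P u B 0 with hE0
  have kn : 0 ≤ ∫ x in Ω, ρ T x * nsq (u T x) / 2 := setIntegral_nonneg D.meas fun x hx => by
    have := F.r0 T ⟨hT.le, le_rfl⟩ x hx
    simp only [nsq, Fin.sum_univ_two]; positivity
  have kT := kn.trans (F.kin_le hγ (t := T) ⟨hT.le, le_rfl⟩)
  obtain ⟨f, hf⟩ : ∃ f : ℝ → V2 → ℝ, ∀ t x, P t x - avg Ω (P t) = f t x := ⟨_, fun _ _ => rfl⟩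
  obtain ⟨d, hd⟩ : ∃ dv : ℝ → V2 → ℝ, ∀ t x, div2 (u t) x = dv t x := ⟨_, fun _ _ => rfl⟩
  obtain ⟨o, ho⟩ : ∃ dv : ℝ → V2 → ℝ, ∀ t x, curl2 (u t) x = dv t x := ⟨_, fun _ _ => rfl⟩
  obtain ⟨j, hj⟩ : ∃ dv : ℝ → V2 → ℝ, ∀ t x, curl2 (B t) x = dv t x := ⟨_, fun _ _ => rfl⟩
  have cf : Continuous fun p : ℝ × V2 => f p.1 p.2 := by
    simp only [← hf]
    exact pc.sub (ca.comp continuous_fst)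
  simp only [hd] at cd
  simp only [ho] at cc
  simp only [hj] at cb
  simp only [Dn] at main
  simp only [hf, hd, ho, hj] at main en ⊢
  have sl : ∀ {f : ℝ × V2 → ℝ} (t : ℝ), Continuous f → Continuous fun x => f (t, x) := fun t h => h.comp (by fun_prop)
  have sf : ∀ t, Continuous (f t) := fun t => sl t cf
  have sd : ∀ t, Continuous (d t) := fun t => sl t cd
  have so : ∀ t, Continuous (o t) := fun t => sl t cc
  have sj : ∀ t, Continuous (j t) := fun t => sl t cb
  set N : ℝ → ℝ := fun t => ∫ x in Ω, f t x ^ 2 with hN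
  set U : ℝ → ℝ := fun t => ∫ x in Ω, d t x ^ 2 with hU
  set W : ℝ → ℝ := fun t => ∫ x in Ω, o t x ^ 2 with hW
  set J : ℝ → ℝ := fun t => ∫ x in Ω, j t x ^ 2 with hJ
  have cN : Continuous N := cont_param D.bdd (f := fun t x => f t x ^ 2) (by fun_prop)
  have cU : Continuous U := cont_param D.bdd (f := fun t x => d t x ^ 2) (by fun_prop)
  have cW : Continuous W := cont_param D.bdd (f := fun t x => o t x ^ 2) (by fun_prop)
  have cJ : Continuous J := cont_param D.bdd (f := fun t x => j t x ^ 2) (by fun_prop)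
  have eN : ∀ g : ℝ → ℝ, Continuous g → IntervalIntegrable g volume 0 T := fun g hg => hg.intervalIntegrable _ _
  have iN := eN N cN
  have iU := eN U cU
  have iW := eN W cW
  have iJ := eN J cJ
  have e1 : ∫ t in (0:ℝ)..T, ∫ x in Ω, (Λ * d t x ^ 2 + μ * o t x ^ 2 + ν * j t x ^ 2) = Λ * (∫ t in (0:ℝ)..T, U t) + μ * (∫ t in (0:ℝ)..T, W t) + ν * ∫ t in (0:ℝ)..T, J t := by
    rw [← intervalIntegral.integral_const_mul, ← intervalIntegral.integral_const_mul, ← intervalIntegral.integral_const_mul,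
      ← intervalIntegral.integral_add (iU.const_mul _) (iW.const_mul _), ← intervalIntegral.integral_add ((iU.const_mul _).add (iW.const_mul _)) (iJ.const_mul _)]
    congr 1; ext t
    have := sd t; have := so t; have := sj t
    rw [integral_add (cont_intOn D.bdd (by fun_prop)) (cont_intOn D.bdd (by fun_prop)), integral_add (cont_intOn D.bdd (by fun_prop)) (cont_intOn D.bdd (by fun_prop)),
      integral_const_mul, integral_const_mul, integral_const_mul]
  have e2 : ∫ t in (0:ℝ)..T, (C * (∫ x in Ω, (d t x ^ 2 + o t x ^ 2 + j t x ^ 2)) + μ * (C * (κ ^ 2 * N t + κ⁻¹ ^ 2 * W t)))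
      = C * (∫ t in (0:ℝ)..T, U t) + (C + μ * (C * κ⁻¹ ^ 2)) * (∫ t in (0:ℝ)..T, W t) + C * (∫ t in (0:ℝ)..T, J t) + μ * C * κ ^ 2 * ∫ t in (0:ℝ)..T, N t := by
    rw [← intervalIntegral.integral_const_mul, ← intervalIntegral.integral_const_mul, ← intervalIntegral.integral_const_mul, ← intervalIntegral.integral_const_mul,
      ← intervalIntegral.integral_add (iU.const_mul _) (iW.const_mul _), ← intervalIntegral.integral_add ((iU.const_mul _).add (iW.const_mul _)) (iJ.const_mul _),
      ← intervalIntegral.integral_add (((iU.const_mul _).add (iW.const_mul _)).add (iJ.const_mul _)) (iN.const_mul _)]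
    congr 1; ext t
    have := sd t; have := so t; have := sj t
    rw [integral_add (cont_intOn D.bdd (by fun_prop)) (cont_intOn D.bdd (by fun_prop)), integral_add (cont_intOn D.bdd (by fun_prop)) (cont_intOn D.bdd (by fun_prop))]
    simp only [hU, hW, hJ]
    ring
  have e3 : 1 / 2 * (∫ t in (0:ℝ)..T, N t) - Λ ^ 2 / 2 * (∫ t in (0:ℝ)..T, U t) ≤ ∫ t in (0:ℝ)..T, ∫ x in Ω, f t x * (f t x - Λ * d t x) := by
    rw [← intervalIntegral.integral_const_mul, ← intervalIntegral.integral_const_mul, ← intervalIntegral.integral_sub (iN.const_mul _) (iU.const_mul _)]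
    refine intervalIntegral.integral_mono_on hT.le ((iN.const_mul _).sub (iU.const_mul _))
      (eN _ (cont_param D.bdd (f := fun t x => f t x * (f t x - Λ * d t x)) (by fun_prop))) fun t _ => ?_
    have := sd t; have := sf t
    simp only [hN, hU]
    rw [← integral_const_mul, ← integral_const_mul, ← integral_sub (cont_intOn D.bdd (by fun_prop)) (cont_intOn D.bdd (by fun_prop))]
    refine setIntegral_mono_on (cont_intOn D.bdd (by fun_prop)) (cont_intOn D.bdd (by fun_prop)) D.meas fun x _ => ?_
    nlinarith [sq_nonneg (f t x - Λ * d t x)]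
  rw [e1] at en
  rw [e2] at main
  have main' := e3.trans main
  have pos : ∀ g : ℝ → V2 → ℝ, 0 ≤ ∫ t in (0:ℝ)..T, ∫ x in Ω, g t x ^ 2 := fun g =>
    intervalIntegral.integral_nonneg hT.le fun t _ => integral_nonneg fun x => sq_nonneg _
  have pN : 0 ≤ ∫ t in (0:ℝ)..T, N t := pos f
  have pU : 0 ≤ ∫ t in (0:ℝ)..T, U t := pos d
  have pW : 0 ≤ ∫ t in (0:ℝ)..T, W t := pos o
  have pJ : 0 ≤ ∫ t in (0:ℝ)..T, J t := pos j
  change ∫ t in (0:ℝ)..T, N t ≤ _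
  generalize (∫ t in (0:ℝ)..T, N t) = n at *
  generalize (∫ t in (0:ℝ)..T, U t) = v at *
  generalize (∫ t in (0:ℝ)..T, W t) = y at *
  generalize (∫ t in (0:ℝ)..T, J t) = z at *
  have l0 : 0 ≤ Λ * v := by positivity
  have l1 : 0 ≤ μ * y := by positivity
  have l2 : 0 ≤ ν * z := by positivity
  have g1 : Λ * v ≤ E0 := by linarith
  have g2 : μ * y ≤ E0 := by linarith
  have g3 : ν * z ≤ E0 := by linarith
  have E0n : 0 ≤ E0 := by linarith
  have g4 : v ≤ E0 := (le_mul_of_one_le_left pU hΛ).trans g1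
  have g5 : y ≤ μ⁻¹ * E0 := by rw [← div_eq_inv_mul, le_div_iff₀ hμ]; linarith
  have g6 : z ≤ ν⁻¹ * E0 := by rw [← div_eq_inv_mul, le_div_iff₀ hν]; linarith
  have g7 : Λ ^ 2 * v ≤ Λ * E0 := by
    rw [sq, mul_assoc]; exact mul_le_mul_of_nonneg_left g1 (by linarith)
  have h1 : C * v ≤ C * E0 := mul_le_mul_of_nonneg_left g4 hC
  have h2 : C * y ≤ C * (μ⁻¹ * E0) := mul_le_mul_of_nonneg_left g5 hC
  have h3 : C * z ≤ C * (ν⁻¹ * E0) := mul_le_mul_of_nonneg_left g6 hC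
  have h4 : (C * κ⁻¹ ^ 2) * (μ * y) ≤ (C * κ⁻¹ ^ 2) * E0 := mul_le_mul_of_nonneg_left g2 (by positivity)
  have h5 : μ * C * κ ^ 2 * n ≤ 1 / 4 * n := mul_le_mul_of_nonneg_right hκ1 pN
  have step : n ≤ 2 * (Λ * E0) + 4 * (C * (1 + E0) + C * (1 + μ⁻¹ + ν⁻¹) * E0 + C * κ⁻¹ ^ 2 * E0) := by linarith
  have a2 : 1 + E0 ≤ Λ * (1 + E0) := le_mul_of_one_le_left (by linarith) hΛ
  have a1 : E0 ≤ Λ * (1 + E0) := by linarith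
  have b1 := mul_le_mul_of_nonneg_left a2 hC
  have b2 := mul_le_mul_of_nonneg_left a1 (by positivity : 0 ≤ C * (1 + μ⁻¹ + ν⁻¹))
  have b3 := mul_le_mul_of_nonneg_left a1 (by positivity : 0 ≤ C * κ⁻¹ ^ 2)
  linarith

end

section
set_option linter.unusedSimpArgs false

lemma contDiff_pow {γ a : ℝ} (hγ : 1 < γ) : ContDiff ℝ 1 (fun r : ℝ => a * r ^ γ) := by
  have := Real.contDiff_rpow_const_of_le (p := γ) (n := 1) (by simpa using hγ.le)
  exact contDiff_const.mul (by exact_mod_cast this)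

lemma hasDeriv_pow {γ a : ℝ} (hγ : 1 < γ) (r : ℝ) : HasDerivAt (fun r : ℝ => a * r ^ γ) (a * (γ * r ^ (γ - 1))) r :=
  (Real.hasDerivAt_rpow_const (Or.inr hγ.le)).const_mul a

lemma pow_id {γ r : ℝ} (hγ : 1 < γ) (hr : 0 ≤ r) : r ^ (γ - 1) * r = r ^ γ := by
  have := Real.rpow_add_one' hr (y := γ - 1) (by linarith)
  rw [← this]; congr 1; ring

lemma pd_div_zero {Ω : Set V2} (ho : IsOpen Ω) {g : V2 → ℝ} (hg : ∀ x ∈ Ω, g x = 0) (i : Fin 2) {x : V2} (hx : x ∈ Ω) : pd i g x = 0 := by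
  have : g =ᶠ[𝓝 x] fun _ => 0 := by
    filter_upwards [ho.mem_nhds hx] with y hy using hg y hy
  unfold pd
  rw [this.fderiv_eq]; simp

lemma slip_grad {v g m : V2} (hg : g ≠ 0) (hm : m = (Real.sqrt (nsq g))⁻¹ • g) (h : dot v m = 0) : dot v g = 0 := by
  have hn : 0 < nsq g := by
    simp only [nsq, Fin.sum_univ_two]
    by_contra hh
    apply hg
    have h0 : g 0 = 0 := by nlinarith [sq_nonneg (g 0), sq_nonneg (g 1)]
    have h1 : g 1 = 0 := by nlinarith [sq_nonneg (g 0), sq_nonneg (g 1)]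
    ext i; fin_cases i <;> simp [h0, h1]
  have hs : (Real.sqrt (nsq g))⁻¹ ≠ 0 := by positivity
  rw [hm] at h
  simp only [dot, Fin.sum_univ_two, Pi.smul_apply, smul_eq_mul] at h ⊢
  have : (Real.sqrt (nsq g))⁻¹ * (v 0 * g 0 + v 1 * g 1) = 0 := by linarith
  exact (mul_eq_zero.1 this).resolve_left hs

lemma mom_alg0 {u B : V2 → V2} (hu : ∀ i, ContDiff ℝ 2 (fun x => u x i)) (hB : ∀ i, ContDiff ℝ 2 (fun x => B x i)) (μ lam : ℝ) (x : V2) :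
    μ * lap (fun y => u y 0) x + (μ + lam) * pd 0 (fun y => div2 u y) x + dot (B x) (grad (fun y => B y 0) x) - pd 0 (fun y => nsq (B y)) x / 2
    = (2 * μ + lam) * pd 0 (div2 u) x - μ * pd 1 (curl2 u) x - curl2 B x * B x 1 := by
  have u00 := (contDiff_pd2 (i := 0) (hu 0)).differentiable one_ne_zero
  have u10 := (contDiff_pd2 (i := 1) (hu 0)).differentiable one_ne_zero
  have u01 := (contDiff_pd2 (i := 0) (hu 1)).differentiable one_ne_zero
  have u11 := (contDiff_pd2 (i := 1) (hu 1)).differentiable one_ne_zero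
  have b0 := (hB 0).differentiable two_ne_zero
  have b1 := (hB 1).differentiable two_ne_zero
  have e1 : pd 0 (div2 u) x = pd 0 (pd 0 fun y => u y 0) x + pd 0 (pd 1 fun y => u y 1) x := by
    have : div2 u = fun y => pd 0 (fun y => u y 0) y + pd 1 (fun y => u y 1) y := by ext y; simp [div2]
    rw [this]; exact pd_add (u00 x) (u11 x)
  have e2 : pd 1 (curl2 u) x = pd 1 (pd 0 fun y => u y 1) x - pd 1 (pd 1 fun y => u y 0) x := pd_sub (u01 x) (u10 x)
  have e3 : pd 0 (fun y => nsq (B y)) x = 2 * (B x 0 * pd 0 (fun y => B y 0) x + B x 1 * pd 0 (fun y => B y 1) x) := by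
    simp only [nsq, Fin.sum_univ_two, sq]
    simp (disch := fun_prop) only [pd_add, pd_mul]
    ring
  have e4 := pd_comm (hu 1) 0 1 x
  change μ * lap (fun y => u y 0) x + (μ + lam) * pd 0 (div2 u) x + _ - _ = _
  rw [e3, e2]
  simp only [lap, dot, grad, curl2, Fin.sum_univ_two]
  rw [e1]
  linear_combination -μ * e4

lemma mom_alg1 {u B : V2 → V2} (hu : ∀ i, ContDiff ℝ 2 (fun x => u x i)) (hB : ∀ i, ContDiff ℝ 2 (fun x => B x i)) (μ lam : ℝ) (x : V2) :
    μ * lap (fun y => u y 1) x + (μ + lam) * pd 1 (fun y => div2 u y) x + dot (B x) (grad (fun y => B y 1) x) - pd 1 (fun y => nsq (B y)) x / 2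
    = (2 * μ + lam) * pd 1 (div2 u) x + μ * pd 0 (curl2 u) x + curl2 B x * B x 0 := by
  have u00 := (contDiff_pd2 (i := 0) (hu 0)).differentiable one_ne_zero
  have u10 := (contDiff_pd2 (i := 1) (hu 0)).differentiable one_ne_zero
  have u01 := (contDiff_pd2 (i := 0) (hu 1)).differentiable one_ne_zero
  have u11 := (contDiff_pd2 (i := 1) (hu 1)).differentiable one_ne_zero
  have b0 := (hB 0).differentiable two_ne_zero
  have b1 := (hB 1).differentiable two_ne_zero
  have e1 : pd 1 (div2 u) x = pd 1 (pd 0 fun y => u y 0) x + pd 1 (pd 1 fun y => u y 1) x := by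
    have : div2 u = fun y => pd 0 (fun y => u y 0) y + pd 1 (fun y => u y 1) y := by ext y; simp [div2]
    rw [this]; exact pd_add (u00 x) (u11 x)
  have e2 : pd 0 (curl2 u) x = pd 0 (pd 0 fun y => u y 1) x - pd 0 (pd 1 fun y => u y 0) x := pd_sub (u01 x) (u10 x)
  have e3 : pd 1 (fun y => nsq (B y)) x = 2 * (B x 0 * pd 1 (fun y => B y 0) x + B x 1 * pd 1 (fun y => B y 1) x) := by
    simp only [nsq, Fin.sum_univ_two, sq]
    simp (disch := fun_prop) only [pd_add, pd_mul]
    ring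
  have e4 := pd_comm (hu 0) 0 1 x
  change μ * lap (fun y => u y 1) x + (μ + lam) * pd 1 (div2 u) x + _ - _ = _
  rw [e3, e2]
  simp only [lap, dot, grad, curl2, Fin.sum_univ_two]
  rw [e1]
  linear_combination μ * e4

lemma mag_alg {Ω : Set V2} (ho : IsOpen Ω) {u B Bt : V2 → V2} (hu : ∀ i, ContDiff ℝ 2 (fun x => u x i)) (hB : ∀ i, ContDiff ℝ 2 (fun x => B x i)) {ν : ℝ}
    (hd : ∀ x ∈ Ω, div2 B x = 0) {x : V2} (hx : x ∈ Ω)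
    (h : ∀ i, Bt x i + dot (u x) (grad (fun y => B y i) x)
      - dot (B x) (grad (fun y => u y i) x) + B x i * div2 u x = ν * lap (fun y => B y i) x) :
    Bt x 0 = pd 1 (fun y => u y 0 * B y 1 - u y 1 * B y 0 - ν * curl2 B y) x ∧
    Bt x 1 = - pd 0 (fun y => u y 0 * B y 1 - u y 1 * B y 0 - ν * curl2 B y) x := by
  have b00 := (contDiff_pd2 (i := 0) (hB 0)).differentiable one_ne_zero
  have b10 := (contDiff_pd2 (i := 1) (hB 0)).differentiable one_ne_zero
  have b01 := (contDiff_pd2 (i := 0) (hB 1)).differentiable one_ne_zero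
  have b11 := (contDiff_pd2 (i := 1) (hB 1)).differentiable one_ne_zero
  have b0 := (hB 0).differentiable two_ne_zero
  have b1 := (hB 1).differentiable two_ne_zero
  have u0 := (hu 0).differentiable two_ne_zero
  have u1 := (hu 1).differentiable two_ne_zero
  have cJ := (contDiff_curl2 hB).differentiable one_ne_zero
  have e1 : ∀ i, pd i (div2 B) x = pd i (pd 0 fun y => B y 0) x + pd i (pd 1 fun y => B y 1) x := by
    intro i
    have : div2 B = fun y => pd 0 (fun y => B y 0) y + pd 1 (fun y => B y 1) y := by ext y; simp [div2]
    rw [this]; exact pd_add (b00 x) (b11 x)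
  have e2 : ∀ i, pd i (curl2 B) x = pd i (pd 0 fun y => B y 1) x - pd i (pd 1 fun y => B y 0) x := fun i => pd_sub (b01 x) (b10 x)
  have z0 := e1 0
  have z1 := e1 1
  rw [pd_div_zero ho hd 0 hx] at z0
  rw [pd_div_zero ho hd 1 hx] at z1
  have d0 := hd x hx
  have c0 := pd_comm (hB 0) 0 1 x
  have c1 := pd_comm (hB 1) 0 1 x
  have h0 := h 0
  have h1 := h 1
  have E : ∀ i, pd i (fun y => u y 0 * B y 1 - u y 1 * B y 0 - ν * curl2 B y) x =
     (u x 0 * pd i (fun y => B y 1) x + pd i (fun y => u y 0) x * B x 1) - (u x 1 * pd i (fun y => B y 0) x + pd i (fun y => u y 1) x * B x 0)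
       - ν * (pd i (pd 0 fun y => B y 1) x - pd i (pd 1 fun y => B y 0) x) := by
    intro i
    simp (disch := fun_prop) only [pd_sub, pd_mul, pd_const]
    rw [e2]; ring
  rw [E 0, E 1]
  simp only [lap, dot, grad, div2, Fin.sum_univ_two] at h0 h1 d0
  constructor
  · linear_combination h0 - ν * z0 - ν * c1 - u x 0 * d0
  · linear_combination h1 - ν * z1 + ν * c0 - u x 1 * d0

end

section
set_option linter.unusedSimpArgs false

lemma pres_alg {ρ : ℝ → V2 → ℝ} {u : ℝ → V2 → V2} (hρ : Smooth2 ρ) (hu : Smooth2V u) {a γ : ℝ} (hγ : 1 < γ) {t : ℝ} {x : V2}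
    (hr : 0 ≤ ρ t x) (hm : dt ρ t x + div2 (fun y j => ρ t y * u t y j) x = 0) :
    dt (fun s y => a * ρ s y ^ γ) t x = - div2 (fun y j => (a * ρ t y ^ γ) * u t y j) x - (γ - 1) * ((a * ρ t x ^ γ) * div2 (u t) x) := by
  have r1 := (hρ.slice t).differentiable (by simp)
  have u0 : Differentiable ℝ (fun y => u t y 0) := ((hu 0).slice t).differentiable (by simp)
  have u1 : Differentiable ℝ (fun y => u t y 1) := ((hu 1).slice t).differentiable (by simp)
  have p1 : Differentiable ℝ (fun y => a * ρ t y ^ γ) := ((contDiff_pow hγ).differentiable one_ne_zero).comp r1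
  have e1 : dt (fun s y => a * ρ s y ^ γ) t x = (a * (γ * ρ t x ^ (γ - 1))) * dt ρ t x := by
    have h0 : HasDerivAt (fun s => ρ s x) (dt ρ t x) t := hasDeriv_dt (f := ρ) (ContDiff.of_le hρ top_le1) t x
    have h := HasDerivAt.comp (h₂ := fun r : ℝ => a * r ^ γ) (h := fun s => ρ s x) t (hasDeriv_pow (a := a) hγ (ρ t x)) h0
    exact h.deriv
  have e2 : ∀ i, pd i (fun y => a * ρ t y ^ γ) x = (a * (γ * ρ t x ^ (γ - 1))) * pd i (ρ t) x := by
    intro i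
    have := pd_comp (i := i) (hasDeriv_pow (a := a) hγ (ρ t x)).differentiableAt (r1 x)
    rw [this, (hasDeriv_pow hγ _).deriv]
  rw [e1]
  simp only [div2, Fin.sum_univ_two] at hm ⊢
  rw [pd_mul (r1 x) (u0 x), pd_mul (r1 x) (u1 x)] at hm
  rw [pd_mul (p1 x) (u0 x), pd_mul (p1 x) (u1 x), e2, e2]
  have := pow_id hγ hr
  rw [← this]
  linear_combination (a * (γ * ρ t x ^ (γ - 1))) * hm

lemma exists_dom {Ω : Set V2} {n : V2 → V2} (hΩ : SmoothDomain Ω n) (hconv : Convex ℝ Ω) :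
    ∃ φ, Dom Ω φ ∧ ∀ x ∈ frontier Ω, n x = (Real.sqrt (nsq (grad φ x)))⁻¹ • grad φ x := by
  obtain ⟨φ, h1, h2, h3, h4, h5⟩ := hΩ.defining
  exact ⟨φ, ⟨h1, hΩ.bounded, h2, h3, h4, hconv, hΩ.nonempty⟩, h5⟩

lemma mk_flow {Ω : Set V2} {n : V2 → V2} {φ : V2 → ℝ} (D : Dom Ω φ)
    (hn : ∀ x ∈ frontier Ω, n x = (Real.sqrt (nsq (grad φ x)))⁻¹ • grad φ x)
    {a γ μ lam ν ρhat M T : ℝ} (ha : 0 < a) (hγ : 1 < γ) {ρ : ℝ → V2 → ℝ} {u B : ℝ → V2 → V2}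
    (h : DataHyps Ω n a γ μ lam ν ρhat M T ρ u B) (h2 : APriori Ω a γ μ lam ρhat T ρ) :
    Flow Ω φ γ μ (2 * μ + lam) ν (2 * ρhat) (a * (2 * ρhat) ^ γ) T ρ (fun t x => a * ρ t x ^ γ) u B := by
  obtain ⟨-, hT, hρ, hu, hB, sol, r0, -⟩ := h
  have r1 := h2.1
  have cρ : ContDiff ℝ 1 (fun p : ℝ × V2 => ρ p.1 p.2) := ContDiff.of_le hρ top_le1
  have cu : ∀ i, ContDiff ℝ 1 (fun p : ℝ × V2 => u p.1 p.2 i) := fun i => ContDiff.of_le (hu i) top_le1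
  have cB : ∀ i, ContDiff ℝ 1 (fun p : ℝ × V2 => B p.1 p.2 i) := fun i => ContDiff.of_le (hB i) top_le1
  have cP : ContDiff ℝ 1 (fun p : ℝ × V2 => a * ρ p.1 p.2 ^ γ) := (contDiff_pow hγ).comp cρ
  have sc : ∀ {f : ℝ → V2 → ℝ} (t : ℝ), Continuous (fun p : ℝ × V2 => f p.1 p.2) → Continuous (f t) :=
    fun t h => h.comp (by fun_prop : Continuous fun x : V2 => (t, x))
  refine ⟨D, hT, cρ, cP, cu, cB, ?_, r0, r1, ?_, ?_⟩
  · intro t ht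
    have su : ∀ i, ContDiff ℝ 2 (fun x => u t x i) := fun i => ((hu i).slice t).of_le top_le2
    have sB : ∀ i, ContDiff ℝ 2 (fun x => B t x i) := fun i => ((hB i).slice t).of_le top_le2
    have sr : ContDiff ℝ 1 (ρ t) := (hρ.slice t).of_le top_le1
    have mag := fun x hx => mag_alg D.isOpen su sB (Bt := dtV B t) (ν := ν) (fun x hx => sol.divB t ht x hx) (x := x) hx
      (fun i => sol.magnetic t ht x hx i)
    exact
    { dom := D
      cρ := sr
      cP := (contDiff_pow hγ).comp sr
      cu := su
      cB := sB
      crt := sc t (cont_dt cρ)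
      cPt := sc t (cont_dt (f := fun t x => a * ρ t x ^ γ) cP)
      cmt := fun i => sc t (cont_dt (f := fun s y => ρ s y * u s y i) (cρ.mul (cu i)))
      cBt := fun i => sc t (cont_dt (f := fun s y => B s y i) (cB i))
      mass := fun x hx => by have := sol.mass t ht x hx; linarith
      pres := fun x hx => pres_alg hρ hu hγ (r0 t ⟨ht.1.le, ht.2⟩ x hx) (sol.mass t ht x hx)
      mom0 := fun x hx => by
        have := sol.momentum t ht x hx 0
        rw [mom_alg0 su sB] at this
        linarith
      mom1 := fun x hx => by
        have := sol.momentum t ht x hx 1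
        rw [mom_alg1 su sB] at this
        linarith
      mag0 := fun x hx => (mag x hx).1
      mag1 := fun x hx => (mag x hx).2
      divB := fun x hx => sol.divB t ht x hx
      su := fun x hx => slip_grad (D.gr x hx) (hn x hx) (sol.slipU t ht x hx).1
      sω := fun x hx => (sol.slipU t ht x hx).2
      sB := fun x hx => slip_grad (D.gr x hx) (hn x hx) (sol.slipB t ht x hx).1
      sJ := fun x hx => (sol.slipB t ht x hx).2 }
  · intro t ht x hx
    have := r0 t ht x hx
    positivity
  · intro t ht x hx
    have := r0 t ht x hx
    have := r1 t ht x hx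
    gcongr

end

section
set_option linter.unusedSimpArgs false

lemma Gpot_nonneg {a γ b r : ℝ} (ha : 0 < a) (hγ : 1 < γ) (hb : 0 ≤ b) (hr : 0 ≤ r) : 0 ≤ Gpot a γ b r := by
  refine mul_nonneg hr ?_
  rcases le_total b r with h | h
  · refine intervalIntegral.integral_nonneg h fun x hx => ?_
    refine div_nonneg ?_ (sq_nonneg _)
    have := Real.rpow_le_rpow hb hx.1 (by linarith : 0 ≤ γ)
    have := mul_le_mul_of_nonneg_left this ha.le
    linarith
  · rw [intervalIntegral.integral_symm, ← intervalIntegral.integral_neg]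
    refine intervalIntegral.integral_nonneg h fun x hx => ?_
    rw [← neg_div]
    refine div_nonneg ?_ (sq_nonneg _)
    have := Real.rpow_le_rpow (hr.trans hx.1) hx.2 (by linarith : 0 ≤ γ)
    have := mul_le_mul_of_nonneg_left this ha.le
    linarith

lemma Gpot_formula {a γ b r : ℝ} (hγ : 1 < γ) (hb : 0 < b) (hr : 0 < r) :
    Gpot a γ b r = a * (r * r ^ (γ - 1)) / (γ - 1) + a * b ^ γ - r * (a * b ^ (γ - 1) / (γ - 1) + a * b ^ γ * b⁻¹) := by
  have pos : ∀ x ∈ uIcc b r, 0 < x := fun x hx => lt_of_lt_of_le (lt_min hb hr) hx.1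
  have hg : γ - 1 ≠ 0 := by linarith
  have key := intervalIntegral.integral_eq_sub_of_hasDerivAt (a := b) (b := r)
    (f := fun ξ : ℝ => a * ξ ^ (γ - 1) / (γ - 1) + a * b ^ γ * ξ⁻¹) (f' := fun ξ => (a * ξ ^ γ - a * b ^ γ) / ξ ^ 2) ?_ ?_
  · unfold Gpot
    rw [key]
    field_simp
  · intro x hx
    have hx := pos x hx
    have h1 := ((Real.hasDerivAt_rpow_const (x := x) (p := γ - 1) (Or.inl hx.ne')).const_mul a).div_const (γ - 1)
    have h2 := (hasDerivAt_inv hx.ne').const_mul (a * b ^ γ)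
    refine (h1.fun_add h2).congr_deriv ?_
    rw [Real.rpow_sub_one hx.ne', Real.rpow_sub_one hx.ne']
    field_simp
    ring
  · apply ContinuousOn.intervalIntegrable
    intro x hx
    have hx := pos x hx
    have : ContinuousAt (fun ξ : ℝ => ξ ^ γ) x := Real.continuousAt_rpow_const x γ (Or.inl hx.ne')
    exact (((this.const_mul a).sub continuousAt_const).div (continuousAt_id.pow 2) (pow_ne_zero 2 hx.ne')).continuousWithinAt

lemma Gpot_int {Ω : Set V2} {φ : V2 → ℝ} (D : Dom Ω φ) {a γ : ℝ} (hγ : 1 < γ) {r : V2 → ℝ} (hc : Continuous r)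
    (h0 : ∀ x ∈ Ω, 0 ≤ r x) : IntegrableOn (fun x => Gpot a γ (avg Ω r) (r x)) Ω := by
  have hv := D.vol_pos
  have h1 : 0 ≤ ∫ x in Ω, r x := setIntegral_nonneg D.meas h0
  rcases h1.eq_or_lt with h | h
  · have ae : 0 ≤ᵐ[volume.restrict Ω] r := (ae_restrict_iff' D.meas).2 (ae_of_all _ h0)
    have := (integral_eq_zero_iff_of_nonneg_ae ae (cont_intOn D.bdd hc)).1 h.symm
    refine (integrable_zero V2 ℝ (volume.restrict Ω)).congr ?_
    filter_upwards [this] with x hx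
    simp [Gpot, hx]
  · have hb : 0 < avg Ω r := div_pos h hv
    set b := avg Ω r
    have hcc : Continuous (fun x => a * (r x * r x ^ (γ - 1)) / (γ - 1) + a * b ^ γ - r x * (a * b ^ (γ - 1) / (γ - 1) + a * b ^ γ * b⁻¹)) := by
      have : Continuous (fun x => r x ^ (γ - 1)) := hc.rpow_const (fun x => Or.inr (by linarith))
      fun_prop
    have hi := (cont_intOn (μ := volume) D.bdd hcc).indicator (t := {x | 0 < r x}) (measurableSet_lt measurable_const hc.measurable)
    refine IntegrableOn.congr_fun hi ?_ D.meas
    intro x hx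
    by_cases hp : 0 < r x
    · simp only [indicator, mem_ofPred_eq, hp, if_true]
      exact (Gpot_formula hγ hb hp).symm
    · have : r x = 0 := le_antisymm (not_lt.1 hp) (h0 x hx)
      simp [indicator, this, Gpot]

lemma energy0 {Ω : Set V2} {φ : V2 → ℝ} (D : Dom Ω φ) {a γ rh : ℝ} (ha : 0 < a) (hγ : 1 < γ) {ρ : ℝ → V2 → ℝ} {u B : ℝ → V2 → V2}
    (cr : Continuous (ρ 0)) (cu : ∀ i, Continuous (fun x => u 0 x i)) (cB : ∀ i, Continuous (fun x => B 0 x i))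
    (h0 : ∀ x ∈ Ω, 0 ≤ ρ 0 x) (h1 : ∀ x ∈ Ω, ρ 0 x ≤ rh) :
    0 ≤ C0 Ω a γ (ρ 0) (u 0) (B 0) ∧
    En Ω γ ρ (fun t x => a * ρ t x ^ γ) u B 0 ≤ C0 Ω a γ (ρ 0) (u 0) (B 0) + volume.real Ω * (a * rh ^ γ / (γ - 1)) := by
  have hu0 := cu 0
  have hu1 := cu 1
  have hB0 := cB 0
  have hB1 := cB 1
  have cP : Continuous (fun x => ρ 0 x ^ γ) := cr.rpow_const (fun x => Or.inr (by linarith))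
  have hg : 0 < γ - 1 := by linarith
  have av : 0 ≤ avg Ω (ρ 0) := div_nonneg (setIntegral_nonneg D.meas h0) ENNReal.toReal_nonneg
  have k0 : ∀ x ∈ Ω, 0 ≤ ρ 0 x * nsq (u 0 x) / 2 + nsq (B 0 x) / 2 := by
    intro x hx
    have := h0 x hx
    simp only [nsq, Fin.sum_univ_two]
    positivity
  have ik : IntegrableOn (fun x => ρ 0 x * nsq (u 0 x) / 2 + nsq (B 0 x) / 2) Ω := by
    simp only [nsq, Fin.sum_univ_two]
    exact cont_intOn D.bdd (by fun_prop)
  have iG := Gpot_int D (a := a) hγ cr h0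
  have iP : IntegrableOn (fun x => a * ρ 0 x ^ γ / (γ - 1)) Ω := cont_intOn D.bdd (by fun_prop)
  have eC : C0 Ω a γ (ρ 0) (u 0) (B 0) = (∫ x in Ω, (ρ 0 x * nsq (u 0 x) / 2 + nsq (B 0 x) / 2)) + ∫ x in Ω, Gpot a γ (avg Ω (ρ 0)) (ρ 0 x) :=
    integral_add ik iG
  have eE : En Ω γ ρ (fun t x => a * ρ t x ^ γ) u B 0 = (∫ x in Ω, (ρ 0 x * nsq (u 0 x) / 2 + nsq (B 0 x) / 2)) + ∫ x in Ω, a * ρ 0 x ^ γ / (γ - 1) :=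
    integral_add ik iP
  have pk := setIntegral_nonneg (μ := volume) D.meas k0
  have pG := setIntegral_nonneg (μ := volume) D.meas fun x hx => Gpot_nonneg ha hγ av (h0 x hx)
  have pP : ∫ x in Ω, a * ρ 0 x ^ γ / (γ - 1) ≤ volume.real Ω * (a * rh ^ γ / (γ - 1)) := by
    have := setIntegral_mono_on iP (cont_intOn (μ := volume) D.bdd continuous_const (f := fun _ => a * rh ^ γ / (γ - 1))) D.meas (by
      intro x hx
      have := Real.rpow_le_rpow (h0 x hx) (h1 x hx) (by linarith : 0 ≤ γ)
      gcongr)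
    rw [setIntegral_const] at this
    simpa using this
  rw [eC, eE]
  exact ⟨by linarith, by linarith⟩


end

section
set_option linter.unusedSimpArgs false

lemma LpS4 (Ω : Set V2) (f : V2 → ℝ) : LpS 4 Ω f ^ 4 = ∫ x in Ω, f x ^ 4 := by
  have h : ∀ x, |f x| ^ (4:ℝ) = f x ^ 4 := by
    intro x
    rw [show (4:ℝ) = ((4:ℕ):ℝ) by norm_num, Real.rpow_natCast]
    exact Even.pow_abs (by decide) _
  unfold LpS
  simp only [h]
  have h0 : 0 ≤ ∫ x in Ω, f x ^ 4 := integral_nonneg fun x => by positivity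
  rw [← Real.rpow_natCast, ← Real.rpow_mul h0]
  norm_num

lemma flow_L4 {Ω : Set V2} {φ : V2 → ℝ} {γ μ Λ ν rb pb T : ℝ} {ρ P : ℝ → V2 → ℝ} {u B : ℝ → V2 → V2}
    (F : Flow Ω φ γ μ Λ ν rb pb T ρ P u B) :
    ∫ t in (0:ℝ)..T, LpS 4 Ω (fun x => P t x - avg Ω (P t)) ^ 4 ≤
      pb ^ 2 * ∫ t in (0:ℝ)..T, ∫ x in Ω, (P t x - avg Ω (P t)) ^ 2 := by
  simp only [LpS4]
  rw [← intervalIntegral.integral_const_mul]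
  have hc : Continuous (fun p : ℝ × V2 => P p.1 p.2 - avg Ω (P p.1)) :=
    F.cP.continuous.sub (F.avg_cont.comp continuous_fst)
  have c4 : Continuous fun t => ∫ x in Ω, (P t x - avg Ω (P t)) ^ 4 :=
    cont_param F.dom.bdd (f := fun t x => (P t x - avg Ω (P t)) ^ 4) (hc.pow 4)
  have c2 : Continuous fun t => ∫ x in Ω, (P t x - avg Ω (P t)) ^ 2 :=
    cont_param F.dom.bdd (f := fun t x => (P t x - avg Ω (P t)) ^ 2) (hc.pow 2)
  refine intervalIntegral.integral_mono_on F.hT.le (c4.intervalIntegrable _ _) ((c2.const_mul _).intervalIntegrable _ _) fun t ht => ?_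
  have hs : Continuous fun x => P t x - avg Ω (P t) := hc.comp (by fun_prop : Continuous fun x : V2 => (t, x))
  rw [← integral_const_mul]
  refine setIntegral_mono_on (cont_intOn F.dom.bdd (hs.pow 4)) (cont_intOn F.dom.bdd ((hs.pow 2).const_mul _)) F.dom.meas fun x hx => ?_
  have hb := F.avg_bd ht hx
  have h2 : (P t x - avg Ω (P t)) ^ 2 ≤ pb ^ 2 := by
    rw [← sq_abs]; exact pow_le_pow_left₀ (abs_nonneg _) hb 2
  calc (P t x - avg Ω (P t)) ^ 4 = (P t x - avg Ω (P t)) ^ 2 * (P t x - avg Ω (P t)) ^ 2 := by ring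
    _ ≤ _ := mul_le_mul_of_nonneg_right h2 (sq_nonneg _)

lemma num_final {K C M : ℝ} (hK : 0 ≤ K) (hC : 0 ≤ C) (hM : 0 ≤ M) :
    K * (1 + C) ≤ (2 + M) ^ Real.exp (3 * (K + 1) * (1 + C) ^ 3) := by
  set y := 3 * (K + 1) * (1 + C) ^ 3 with hy
  have h1 : 1 + C ≤ (1 + C) ^ 3 := le_self_pow₀ (by linarith) (by norm_num)
  have h2 : K * (1 + C) ≤ y := by
    have : K * (1 + C) ≤ (3 * (K + 1)) * (1 + C) ^ 3 := mul_le_mul (by linarith) h1 (by linarith) (by linarith)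
    exact this
  have h3 : y ≤ Real.exp y := by linarith [Real.add_one_le_exp y]
  set z := Real.exp y
  have hz : 0 < z := Real.exp_pos y
  have hz1 : 1 ≤ z := Real.one_le_exp (by positivity)
  have h4 : 1 + z * 1 ≤ (1 + 1) ^ z := one_add_mul_self_le_rpow_one_add (by norm_num) hz1
  have h5 : (1 + 1 : ℝ) ^ z ≤ (2 + M) ^ z := Real.rpow_le_rpow (by norm_num) (by linarith) hz.le
  linarith


end

/-- Lemma 3.3: bound on `(2μ+λ)⁻¹ ∫₀^T ‖P−P̄‖⁴_{L⁴} dt`.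
With `D₂` the constant from the `L^∞(0,T;L²)` estimate, provided
`λ ≥ exp{(2+M)^{exp(D(1+C₀)³)}}` for some `D ≥ 2D₂`, one has
`(2μ+λ)⁻¹ ∫₀^T ‖P−P̄‖⁴_{L⁴} dt ≤ (2+M)^{exp(3D₂(1+C₀)³)}`. -/
theorem stmt_16
    (Ω : Set V2) (n : V2 → V2) (hΩ : SmoothDomain Ω n) (hconv : Convex ℝ Ω)
    (a γ μ ν ρhat : ℝ) (ha : 0 < a) (hγ : 1 < γ) (hμ : 0 < μ) (hν : 0 < ν)
    (hρhat : 0 < ρhat) :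
    ∃ D₂ > (0:ℝ), ∀ (lam M T : ℝ) (ρ : ℝ → V2 → ℝ) (u B : ℝ → V2 → V2),
      DataHyps Ω n a γ μ lam ν ρhat M T ρ u B →
      APriori Ω a γ μ lam ρhat T ρ →
      (∃ D, 2 * D₂ ≤ D ∧
        Real.exp ((2 + M) ^ Real.exp (D * (1 + C0 Ω a γ (ρ 0) (u 0) (B 0)) ^ 3)) ≤ lam) →
      (2 * μ + lam)⁻¹ * (∫ t in (0:ℝ)..T,
          (LpS 4 Ω (fun x => a * ρ t x ^ γ - Pbar Ω a γ ρ t)) ^ 4)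
        ≤ (2 + M) ^ Real.exp (3 * D₂ * (1 + C0 Ω a γ (ρ 0) (u 0) (B 0)) ^ 3) := by
  obtain ⟨φ, D, hn⟩ := exists_dom hΩ hconv
  have hpb : 0 ≤ a * (2 * ρhat) ^ γ := by positivity
  obtain ⟨C, hC, hbd⟩ := flow_bd D γ (2 * ρhat) (a * (2 * ρhat) ^ γ) μ ν hγ (by linarith) hpb hμ hν
  have hg : 0 < γ - 1 := by linarith
  obtain ⟨pb, hpbe⟩ : ∃ p, a * (2 * ρhat) ^ γ = p := ⟨_, rfl⟩
  obtain ⟨E1, hE1⟩ : ∃ p, volume.real Ω * (a * ρhat ^ γ / (γ - 1)) = p := ⟨_, rfl⟩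
  have hE1p : 0 ≤ E1 := by rw [← hE1]; positivity
  have hK : 0 ≤ pb ^ 2 * C * (1 + E1) := by positivity
  refine ⟨pb ^ 2 * C * (1 + E1) + 1, by linarith, ?_⟩
  intro lam M T ρ u B h h2 hlam
  have F := mk_flow D hn ha hγ h h2
  obtain ⟨hml, hT, hρ, hu, hB, -, r0, r1, -, -, hM⟩ := h
  have z0 : (0:ℝ) ∈ Icc 0 T := ⟨le_rfl, hT.le⟩
  have ii : Continuous fun x : V2 => ((0:ℝ), x) := by fun_prop
  obtain ⟨c0, he⟩ := energy0 D ha hγ (ρ := ρ) (u := u) (B := B) (hρ.continuous.comp ii)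
    (fun i => (hu i).continuous.comp ii) (fun i => (hB i).continuous.comp ii) (r0 0 z0) r1
  obtain ⟨C₀, hC₀⟩ : ∃ p, C0 Ω a γ (ρ 0) (u 0) (B 0) = p := ⟨_, rfl⟩
  rw [hC₀] at c0 he hM hlam ⊢
  have M0 : 0 ≤ M := by
    have e1 : 0 ≤ (2 * μ + lam) * (LpS 2 Ω (div2 (u 0))) ^ 2 := mul_nonneg (by linarith) (sq_nonneg _)
    have e2 : 0 ≤ μ * (LpS 2 Ω (curl2 (u 0))) ^ 2 := by positivity
    have e3 : 0 ≤ ν * (LpS 2 Ω (curl2 (B 0))) ^ 2 := by positivity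
    linarith
  have lam1 : 1 ≤ lam := by
    obtain ⟨d, -, hd⟩ := hlam
    refine le_trans (Real.one_le_exp ?_) hd
    exact Real.rpow_nonneg (by linarith) _
  have hL : 1 ≤ 2 * μ + lam := by linarith
  have key := hbd F hL
  have k4 := flow_L4 F
  rw [hpbe] at k4
  rw [hE1] at he
  refine le_trans ?_ (num_final hK c0 M0)
  rw [inv_mul_le_iff₀ (by linarith)]
  refine le_trans k4 ?_
  have s1 : C * (2 * μ + lam) * (1 + En Ω γ ρ (fun t x => a * ρ t x ^ γ) u B 0) ≤ C * (2 * μ + lam) * ((1 + E1) * (1 + C₀)) := by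
    refine mul_le_mul_of_nonneg_left ?_ (by positivity)
    have := mul_nonneg hE1p c0
    linarith
  refine le_trans (mul_le_mul_of_nonneg_left (key.trans s1) (sq_nonneg pb)) (le_of_eq ?_)
  ring

end MHD
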